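/- Let g be a complete Riemannian metric without conjugate points on the plane ℝ². Then for every p ∈ ℝ², liminf_{r→∞} A_p(r)/(π r²) ≥ 1, and equality holds if and only if g is flat. -/

import Mathlib

open MeasureTheory Filter Set Real
open scoped ENNReal NNReal

noncomputable section

/-- Points / tangent vectors of the plane. -/
abbrev V2 : Type := Fin 2 → ℝ

/-- Componentwise velocity of a curve in the plane. -/
def vel (γ : ℝ → V2) (t : ℝ) : V2 := fun k => deriv (fun s => γ s k) t

/-- Componentwise acceleration of a curve in the plane. -/
def acc (γ : ℝ → V2) (t : ℝ) : V2 := fun k => deriv (fun s => vel γ s k) t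

/-- The deck transformation `τⁿ(x,y) = (x+n,y)`. -/
def shift (n : ℤ) (p : V2) : V2 := p + (n : ℝ) • (Pi.single 0 1 : V2)

/-- A (smooth) Riemannian metric on the plane ℝ²: a smooth family of
positive-definite symmetric matrices. -/
structure RMetric where
  g : V2 → Matrix (Fin 2) (Fin 2) ℝ
  smooth : ∀ i j, ContDiff ℝ (⊤ : ℕ∞) fun p => g p i j
  symm : ∀ p, (g p).IsSymm
  posDef : ∀ p, (g p).PosDef

/-- `B` has tangent direction `τ` at `p`. -/
def TangentDirAt (B : Set V2) (p τ : V2) : Prop :=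
  τ ≠ 0 ∧ ∀ ε > 0, ∃ δ > 0, ∀ q ∈ B, q ≠ p → ‖q - p‖ < δ →
    ∃ s : ℝ, ‖q - p - s • τ‖ ≤ ε * ‖q - p‖

/-- `B` is, near `x`, after a bi-Lipschitz change of coordinates, the graph of a
Lipschitz function. -/
def IsLipGraphAt (B : Set V2) (x : V2) : Prop :=
  ∃ U : Set V2, IsOpen U ∧ x ∈ U ∧
    ∃ (φ : V2 → ℝ × ℝ) (ψ : ℝ × ℝ → V2) (L : NNReal) (f : ℝ → ℝ),
      LipschitzOnWith L φ U ∧ LipschitzOnWith L ψ (φ '' U) ∧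
      (∀ y ∈ U, ψ (φ y) = y) ∧ LipschitzWith L f ∧
      ∀ y ∈ U, (y ∈ B ↔ (φ y).2 = f (φ y).1)

/-- A (compact) 1-dimensional strong Lipschitz submanifold of the plane. -/
def IsStrongLipschitzCurve (B : Set V2) : Prop := ∀ x ∈ B, IsLipGraphAt B x

/-- `Q` is the closure of its interior and its boundary `Q \ int Q` is a
1-dimensional strong Lipschitz submanifold. -/
def HasStrongLipschitzBoundary (Q : Set V2) : Prop :=
  Q = closure (interior Q) ∧ IsStrongLipschitzCurve (Q \ interior Q)

/-- Absolute continuity of `F` on `[a,b]`. -/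
def AbsContOn (F : ℝ → ℝ) (a b : ℝ) : Prop :=
  ∀ ε > 0, ∃ δ > 0, ∀ n : ℕ, ∀ I : Fin n → ℝ × ℝ,
    (∀ i, a ≤ (I i).1 ∧ (I i).1 ≤ (I i).2 ∧ (I i).2 ≤ b) →
    (∀ i j, i ≠ j → Disjoint (Set.Ioo (I i).1 (I i).2) (Set.Ioo (I j).1 (I j).2)) →
    (∑ i, ((I i).2 - (I i).1)) < δ → (∑ i, |F (I i).2 - F (I i).1|) < ε

/-- Local absolute continuity on a set: absolute continuity on every compact
subinterval. -/
def LocAbsContOn (F : ℝ → ℝ) (s : Set ℝ) : Prop :=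
  ∀ a ∈ s, ∀ b ∈ s, a ≤ b → AbsContOn F a b

namespace RMetric

variable (M : RMetric)

/-- The inner product `g_p(v,w)`. -/
def met (p v w : V2) : ℝ := ∑ i, ∑ j, M.g p i j * v i * w j

/-- The unit tangent bundle `T¹ = {(p,v) : g_p(v,v) = 1}`. -/
def UnitTangent : Set (V2 × V2) := {x | M.met x.1 x.2 x.2 = 1}

/-- Riemannian length of a `C¹` curve. -/
def curveLen (γ : ℝ → V2) (a b : ℝ) : ℝ :=
  ∫ t in a..b, Real.sqrt (M.met (γ t) (vel γ t) (vel γ t))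

/-- The Riemannian distance: infimum of lengths of `C¹` curves joining the points. -/
def dist (p q : V2) : ℝ :=
  sInf {L | ∃ γ : ℝ → V2, ContDiff ℝ 1 γ ∧ γ 0 = p ∧ γ 1 = q ∧ L = M.curveLen γ 0 1}

/-- Completeness of the induced metric space. -/
def Complete : Prop :=
  ∀ u : ℕ → V2, (∀ ε > 0, ∃ N, ∀ m ≥ N, ∀ n ≥ N, M.dist (u m) (u n) < ε) →
    ∃ p, Tendsto (fun n => M.dist (u n) p) atTop (nhds 0)

/-- Open metric ball. -/
def ball (p : V2) (r : ℝ) : Set V2 := {q | M.dist p q < r}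

/-- Metric sphere. -/
def sphere (p : V2) (r : ℝ) : Set V2 := {q | M.dist p q = r}

/-- Coordinate derivative `∂_d g_{ij}`. -/
def dg (d i j : Fin 2) (p : V2) : ℝ :=
  deriv (fun s : ℝ => M.g (p + s • (Pi.single d 1 : V2)) i j) 0

/-- Christoffel symbols `Γ^k_{ij}`. -/
def Γ (k i j : Fin 2) (p : V2) : ℝ :=
  (1 / 2) * ∑ l, (M.g p)⁻¹ k l * (M.dg i j l p + M.dg j i l p - M.dg l i j p)

/-- Coordinate derivative `∂_d Γ^k_{ij}`. -/
def dΓ (d k i j : Fin 2) (p : V2) : ℝ :=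
  deriv (fun s : ℝ => M.Γ k i j (p + s • (Pi.single d 1 : V2))) 0

/-- Gaussian curvature `K = R_{1212} / det g`. -/
def K (p : V2) : ℝ :=
  (∑ l, M.g p 0 l *
      (M.dΓ 0 l 1 1 p - M.dΓ 1 l 0 1 p +
        ∑ m, (M.Γ l 0 m p * M.Γ m 1 1 p - M.Γ l 1 m p * M.Γ m 0 1 p))) /
    (M.g p).det

/-- Flatness: vanishing Gaussian curvature. -/
def Flat : Prop := ∀ p, M.K p = 0

/-- A geodesic of `g`: a `C²` solution of the geodesic equation. -/
def IsGeodesic (γ : ℝ → V2) : Prop :=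
  ContDiff ℝ 2 γ ∧
    ∀ t, ∀ k, acc γ t k + ∑ i, ∑ j, M.Γ k i j (γ t) * vel γ t i * vel γ t j = 0

/-- Unit-speed curve. -/
def UnitSpeed (γ : ℝ → V2) : Prop := ∀ t, M.met (γ t) (vel γ t) (vel γ t) = 1

/-- No conjugate points: every nontrivial solution of the Jacobi equation along a
unit-speed geodesic vanishing at `a` vanishes nowhere else. -/
def NoConjugatePoints : Prop :=
  ∀ γ : ℝ → V2, M.IsGeodesic γ → M.UnitSpeed γ →
    ∀ J : ℝ → ℝ, ContDiff ℝ 2 J →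
      (∀ t, deriv (deriv J) t + M.K (γ t) * J t = 0) →
      (∃ t₀, J t₀ ≠ 0) → ∀ a, J a = 0 → ∀ t, t ≠ a → J t ≠ 0

/-- Riemannian area measure: density `√(det g)` with respect to Lebesgue measure. -/
def area : Measure V2 := volume.withDensity fun p => ENNReal.ofReal (Real.sqrt (M.g p).det)

/-- `Φ` is the geodesic flow of `g` on the unit tangent bundle. -/
def IsGeodesicFlow (Φ : V2 × V2 → ℝ → V2 × V2) : Prop :=
  ∀ x ∈ M.UnitTangent, Φ x 0 = x ∧ M.IsGeodesic (fun t => (Φ x t).1) ∧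
    ∀ t : ℝ, (Φ x t).2 = vel (fun s => (Φ x s).1) t

/-- First vector of the Gram-Schmidt `g`-orthonormal frame. -/
def E1 (p : V2) : V2 :=
  (Real.sqrt (M.met p (Pi.single 0 1) (Pi.single 0 1)))⁻¹ • (Pi.single 0 1 : V2)

def w2 (p : V2) : V2 :=
  (Pi.single 1 1 : V2) - (M.met p (Pi.single 1 1) (M.E1 p)) • M.E1 p

/-- Second vector of the Gram-Schmidt `g`-orthonormal frame. -/
def E2 (p : V2) : V2 := (Real.sqrt (M.met p (M.w2 p) (M.w2 p)))⁻¹ • M.w2 p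

/-- The `g`-unit tangent vector at `p` of angle `θ` (arclength parametrization of
the `g_p`-unit circle). -/
def unitVec (p : V2) (θ : ℝ) : V2 := Real.cos θ • M.E1 p + Real.sin θ • M.E2 p

/-- The Liouville measure on the unit tangent bundle: locally the product of the
area measure with the arclength (angle) measure on the fibers; `σ_* μ = 2π A`. -/
def liouville : Measure (V2 × V2) :=
  Measure.map (fun x : V2 × ℝ => (x.1, M.unitVec x.1 x.2))
    (M.area.prod (volume.restrict (Set.Ico 0 (2 * π))))

/-- Diameter with respect to the Riemannian distance. -/
def ediam (S : Set V2) : ℝ≥0∞ := ⨆ p ∈ S, ⨆ q ∈ S, ENNReal.ofReal (M.dist p q)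

/-- 1-dimensional Hausdorff measure (as an outer-measure set function) with
respect to the Riemannian distance. -/
def H1 (S : Set V2) : ℝ≥0∞ :=
  ⨆ (δ : ℝ) (_ : 0 < δ),
    ⨅ (U : ℕ → Set V2) (_ : S ⊆ ⋃ n, U n) (_ : ∀ n, M.ediam (U n) ≤ ENNReal.ofReal δ),
      ∑' n, M.ediam (U n)

/-- The "tube" in the unit tangent bundle over `S` with angles in `Θ`. -/
def tube (S : Set V2) (Θ : Set ℝ) : Set (V2 × V2) :=
  (fun x : V2 × ℝ => (x.1, M.unitVec x.1 x.2)) '' (S ×ˢ Θ)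

/-- `ν` is the measure on `σ⁻¹(B)` which is locally the product of the
1-dimensional Hausdorff measure on `B` with the angle measure on the fibers. -/
def IsNuOn (B : Set V2) (ν : Measure (V2 × V2)) : Prop :=
  ν {x : V2 × V2 | x.1 ∉ B} = 0 ∧
    ∀ S : Set V2, ∀ Θ : Set ℝ, S ⊆ B → MeasurableSet Θ → Θ ⊆ Set.Ico 0 (2 * π) →
      ν (M.tube S Θ) = M.H1 S * volume Θ

/-- Locally bounded function on the unit tangent bundle. -/
def LocBddUT (f : V2 × V2 → ℝ) : Prop :=
  ∀ R : ℝ, ∃ Cb : ℝ, ∀ x ∈ M.UnitTangent, ‖x.1‖ ≤ R → |f x| ≤ Cb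

/-- Locally bounded function on `T¹ × ℝ`. -/
def LocBddHopf (u : (V2 × V2) × ℝ → ℝ) : Prop :=
  ∀ R : ℝ, ∃ Cb : ℝ, ∀ x ∈ M.UnitTangent, ‖x.1‖ ≤ R → ∀ t : ℝ, |t| ≤ R → |u (x, t)| ≤ Cb

/-- The function `u` produced by E. Hopf's construction: Borel measurable, locally
bounded, solving the Riccati equation along every unit-speed geodesic, and
invariant under the geodesic flow. -/
def IsHopfSolution (Φ : V2 × V2 → ℝ → V2 × V2) (u : (V2 × V2) × ℝ → ℝ) : Prop :=
  Measurable u ∧ M.LocBddHopf u ∧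
    (∀ x ∈ M.UnitTangent, ∀ t : ℝ,
      HasDerivAt (fun s => u (x, s)) (-(u (x, t)) ^ 2 - M.K ((Φ x t).1)) t) ∧
    ∀ x ∈ M.UnitTangent, ∀ s t : ℝ, u (x, s + t) = u (Φ x s, t)

/-- `n` is the inner (w.r.t. `Q`) unit normal of the curve `B` at `p`. -/
def IsInnerUnitNormalAt (Q B : Set V2) (p n : V2) : Prop :=
  M.met p n n = 1 ∧ (∃ τ, TangentDirAt B p τ ∧ M.met p n τ = 0) ∧
    ∀ᶠ t in nhdsWithin (0 : ℝ) (Set.Ioi 0), p + t • n ∈ interior Q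

end RMetric

/-- A Riemannian metric on the cylinder `C = S¹ × ℝ`, modeled by a metric on ℝ²
invariant under the translation `τ(x,y) = (x+1,y)`. -/
structure CylMetric where
  M : RMetric
  invariant : ∀ p, M.g (shift 1 p) = M.g p

/-- τ-invariant subsets of ℝ², i.e. subsets of the cylinder. -/
def InvSet (S : Set V2) : Prop := ∀ p, p ∈ S ↔ shift 1 p ∈ S

/-- The fundamental strip `[0,1) × ℝ`. -/
def strip : Set V2 := {p : V2 | p 0 ∈ Set.Ico (0 : ℝ) 1}

namespace CylMetric

variable (C : CylMetric)

/-- The distance on the cylinder: `d(p,q) = min_n d̃(p̃, τⁿ q̃)`. -/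
def cdist (p q : V2) : ℝ := ⨅ n : ℤ, C.M.dist p (shift n q)

/-- Metric ball in the cylinder. -/
def cball (p : V2) (r : ℝ) : Set V2 := {q | C.cdist p q < r}

/-- Metric sphere in the cylinder. -/
def csphere (p : V2) (r : ℝ) : Set V2 := {q | C.cdist p q = r}

/-- Completeness of the cylinder. -/
def Complete : Prop :=
  ∀ u : ℕ → V2, (∀ ε > 0, ∃ N, ∀ m ≥ N, ∀ n ≥ N, C.cdist (u m) (u n) < ε) →
    ∃ p, Tendsto (fun n => C.cdist (u n) p) atTop (nhds 0)

/-- Area measure on the cylinder, computed in the fundamental strip. -/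
def carea (S : Set V2) : ℝ≥0∞ := C.M.area (S ∩ strip)

/-- The length `l(p)` of a shortest non-contractible loop based at `p`:
`l(p) = min_{n ≠ 0} d̃(p̃, τⁿ p̃)`. -/
def loopLen (p : V2) : ℝ := ⨅ n : {n : ℤ // n ≠ 0}, C.M.dist p (shift n.1 p)

/-- Diameter with respect to the cylinder distance. -/
def ediamC (S : Set V2) : ℝ≥0∞ := ⨆ p ∈ S, ⨆ q ∈ S, ENNReal.ofReal (C.cdist p q)

/-- 1-dimensional Hausdorff measure of a (τ-invariant) subset of the cylinder. -/
def cH1 (S : Set V2) : ℝ≥0∞ :=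
  ⨆ (δ : ℝ) (_ : 0 < δ),
    ⨅ (U : ℕ → Set V2) (_ : S ∩ strip ⊆ ⋃ n, U n)
      (_ : ∀ n, C.ediamC (U n) ≤ ENNReal.ofReal δ),
      ∑' n, C.ediamC (U n)

/-- Distance from a point to a set in the cylinder. -/
def cinfDist (p : V2) (S : Set V2) : ℝ := ⨅ q : S, C.cdist p (q : V2)

/-- A neighborhood of the end `ℰ₊` (`pos = true`) resp. `ℰ₋` (`pos = false`). -/
def EndNbhd (U : Set V2) (pos : Bool) : Prop :=
  InvSet U ∧ ∃ c : ℝ, 0 < c ∧ ∀ p : V2, (if pos then c < p 1 else p 1 < -c) → p ∈ U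

/-- The end has subquadratic area growth. -/
def Subquadratic (pos : Bool) : Prop :=
  ∃ U : Set V2, EndNbhd U pos ∧ ∃ p : V2,
    Filter.liminf (fun r : ℝ => C.carea (U ∩ C.cball p r) / ENNReal.ofReal (r ^ 2)) atTop = 0

/-- A sequence converging to the end `ℰ₊` resp. `ℰ₋`. -/
def TendstoEnd (p : ℕ → V2) (pos : Bool) : Prop :=
  Tendsto (fun i => p i 1) atTop (if pos then atTop else atBot)

/-- The end opens less than linearly. -/
def OpensLessThanLinearly (pos : Bool) : Prop :=
  ∃ p : ℕ → V2, TendstoEnd p pos ∧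
    Tendsto (fun i => C.loopLen (p i) / C.cdist (p i) (p 0)) atTop (nhds 0)

/-- A ray in the cylinder. -/
def IsRay (γ : ℝ → V2) : Prop := ∀ s ≥ (0:ℝ), ∀ t ≥ (0:ℝ), C.cdist (γ s) (γ t) = |s - t|

/-- A ray converging to the end `ℰ₊` resp. `ℰ₋`. -/
def RayToEnd (γ : ℝ → V2) (pos : Bool) : Prop :=
  C.IsRay γ ∧ Tendsto (fun t => γ t 1) atTop (if pos then atTop else atBot)

/-- A minimal geodesic line in the cylinder. -/
def IsMinimalLine (γ : ℝ → V2) : Prop :=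
  C.M.IsGeodesic γ ∧ ∀ s t : ℝ, C.cdist (γ s) (γ t) = |s - t|

/-- The line joins the two ends of the cylinder. -/
def JoinsEnds (γ : ℝ → V2) : Prop :=
  Tendsto (fun t : ℝ => γ t 1) atTop atTop ∧ Tendsto (fun t : ℝ => γ t 1) atBot atBot

/-- `b` is the Busemann function of the ray `γ`: `b(p) = lim_t (d(p,γ(t)) - t)`. -/
def IsBusemann (γ : ℝ → V2) (b : V2 → ℝ) : Prop :=
  ∀ p : V2, Tendsto (fun t : ℝ => C.cdist p (γ t) - t) atTop (nhds (b p))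

end CylMetric

end

noncomputable section

open scoped Topology

section ODE

variable {E : Type*} [NormedAddCommGroup E] [NormedSpace ℝ E] [FiniteDimensional ℝ E]

/-- A `C¹` vector field on a finite-dimensional space is Lipschitz on balls. -/
lemma lipschitzOn_closedBall {F : Type*} [NormedAddCommGroup F] [NormedSpace ℝ F]
    {Z : E → F} (hZ : ContDiff ℝ 1 Z) (R : ℝ) :
    ∃ K : ℝ≥0, LipschitzOnWith K Z (Metric.closedBall 0 R) := by
  have : ProperSpace E := FiniteDimensional.proper_real E
  obtain ⟨C, hC⟩ := (isCompact_closedBall (0 : E) R).exists_bound_of_continuousOn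
    (hZ.continuous_fderiv one_ne_zero).continuousOn
  refine ⟨C.toNNReal, Convex.lipschitzOnWith_of_nnnorm_fderiv_le
    (fun x _ => hZ.differentiable one_ne_zero x) (fun x hx => ?_) (convex_closedBall 0 R)⟩
  have := hC x hx
  rw [← NNReal.coe_le_coe, coe_nnnorm]
  exact this.trans (Real.le_coe_toNNReal C)

/-- Uniqueness of integral curves on open intervals. -/
lemma integralCurve_eqOn_Ioo {Z : E → E} (hZ : ContDiff ℝ 1 Z) {f g : ℝ → E} {a b t₀ : ℝ}
    (ht : t₀ ∈ Ioo a b) (hf : ∀ t ∈ Ioo a b, HasDerivAt f (Z (f t)) t)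
    (hg : ∀ t ∈ Ioo a b, HasDerivAt g (Z (g t)) t) (heq : f t₀ = g t₀) :
    EqOn f g (Ioo a b) := by
  intro t ht'
  obtain ⟨c, hac, hc⟩ : ∃ c, a < c ∧ c < min t t₀ := exists_between (lt_min ht'.1 ht.1)
  obtain ⟨d, hd, hdb⟩ : ∃ d, max t t₀ < d ∧ d < b := exists_between (max_lt ht'.2 ht.2)
  have hsub : Icc c d ⊆ Ioo a b := fun s hs => ⟨hac.trans_le hs.1, hs.2.trans_lt hdb⟩
  have hfc : ContinuousOn f (Icc c d) := fun s hs =>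
    (hf s (hsub hs)).continuousAt.continuousWithinAt
  have hgc : ContinuousOn g (Icc c d) := fun s hs =>
    (hg s (hsub hs)).continuousAt.continuousWithinAt
  obtain ⟨R₁, h₁⟩ := isCompact_Icc.exists_bound_of_continuousOn hfc
  obtain ⟨R₂, h₂⟩ := isCompact_Icc.exists_bound_of_continuousOn hgc
  obtain ⟨K, hK⟩ := lipschitzOn_closedBall hZ (max R₁ R₂)
  have hss : Ioo c d ⊆ Icc c d := Ioo_subset_Icc_self
  refine ODE_solution_unique_of_mem_Ioo (v := fun _ => Z) (s := fun _ => Metric.closedBall 0 (max R₁ R₂))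
    (fun _ _ => hK) (t₀ := t₀) ⟨hc.trans_le (min_le_right _ _), (le_max_right _ _).trans_lt hd⟩
    (fun s hs => ⟨hf s (hsub (hss hs)), ?_⟩) (fun s hs => ⟨hg s (hsub (hss hs)), ?_⟩) heq
    ⟨hc.trans_le (min_le_left _ _), (le_max_left _ _).trans_lt hd⟩
  · simpa using Or.inl (h₁ s (hss hs))
  · simpa using Or.inr (h₂ s (hss hs))

lemma integralCurve_eq {Z : E → E} (hZ : ContDiff ℝ 1 Z) {f g : ℝ → E} (t₀ : ℝ)
    (hf : ∀ t, HasDerivAt f (Z (f t)) t)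
    (hg : ∀ t, HasDerivAt g (Z (g t)) t) (heq : f t₀ = g t₀) : f = g := by
  ext t
  exact integralCurve_eqOn_Ioo hZ (t₀ := t₀) (a := min t t₀ - 1) (b := max t t₀ + 1)
    ⟨by linarith [min_le_right t t₀], by linarith [le_max_right t t₀]⟩
    (fun s _ => hf s) (fun s _ => hg s) heq
    ⟨by linarith [min_le_left t t₀], by linarith [le_max_left t t₀]⟩

/-- On a compact set the local existence time of integral curves is uniform. -/
lemma exists_uniform_time {Z : E → E} (hZ : ContDiff ℝ 1 Z) {C : Set E} (hC : IsCompact C) :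
    ∃ ε > (0 : ℝ), ∀ x ∈ C, ∀ t₀ : ℝ, ∃ α : ℝ → E, α t₀ = x ∧
      ∀ t ∈ Ioo (t₀ - ε) (t₀ + ε), HasDerivAt α (Z (α t)) t := by
  suffices h : ∃ ε > (0 : ℝ), ∀ x ∈ C, ∃ α : ℝ → E, α 0 = x ∧
      ∀ t ∈ Ioo (-ε) (ε), HasDerivAt α (Z (α t)) t by
    obtain ⟨ε, hε, h⟩ := h
    refine ⟨ε, hε, fun x hx t₀ => ?_⟩
    obtain ⟨α, h0, hα⟩ := h x hx
    refine ⟨fun t => α (t - t₀), by simp [h0], fun t ht => ?_⟩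
    exact (hα (t - t₀) ⟨by linarith [ht.1], by linarith [ht.2]⟩).comp_sub_const t t₀
  have : CompleteSpace E := FiniteDimensional.complete ℝ E
  refine hC.induction_on (p := fun C => ∃ ε > (0 : ℝ), ∀ x ∈ C, ∃ α : ℝ → E, α 0 = x ∧
      ∀ t ∈ Ioo (-ε) (ε), HasDerivAt α (Z (α t)) t) ⟨1, one_pos, by simp⟩ ?_ ?_ ?_
  · rintro s t hst ⟨ε, hε, h⟩
    exact ⟨ε, hε, fun x hx => h x (hst hx)⟩
  · rintro s t ⟨ε, hε, h⟩ ⟨ε', hε', h'⟩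
    refine ⟨min ε ε', lt_min hε hε', fun x hx => ?_⟩
    rcases hx with hx | hx
    · obtain ⟨α, h0, hα⟩ := h x hx
      exact ⟨α, h0, fun t ht => hα t ⟨by linarith [ht.1, min_le_left ε ε'],
        by linarith [ht.2, min_le_left ε ε']⟩⟩
    · obtain ⟨α, h0, hα⟩ := h' x hx
      exact ⟨α, h0, fun t ht => hα t ⟨by linarith [ht.1, min_le_right ε ε'],
        by linarith [ht.2, min_le_right ε ε']⟩⟩
  · intro x _
    obtain ⟨r, hr, ε, hε, h⟩ :=
      (hZ.contDiffAt (x := x)).exists_forall_mem_closedBall_exists_eq_forall_mem_Ioo_hasDerivAt 0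
    refine ⟨Metric.closedBall x r, mem_nhdsWithin_of_mem_nhds (Metric.closedBall_mem_nhds x hr),
      ε, hε, fun y hy => ?_⟩
    obtain ⟨α, h0, hα⟩ := h y hy
    exact ⟨α, h0, fun t ht => hα t ⟨by linarith [ht.1], by linarith [ht.2]⟩⟩

/-- Gluing of two integral curves on overlapping intervals. -/
lemma integralCurve_glue {Z : E → E} (hZ : ContDiff ℝ 1 Z) {f g : ℝ → E} {a b c d t₀ : ℝ}
    (h1 : t₀ ∈ Ioo a b) (h2 : t₀ ∈ Ioo c d)
    (hf : ∀ t ∈ Ioo a b, HasDerivAt f (Z (f t)) t)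
    (hg : ∀ t ∈ Ioo c d, HasDerivAt g (Z (g t)) t) (heq : f t₀ = g t₀) :
    ∃ k : ℝ → E, EqOn k f (Ioo a b) ∧
      ∀ t ∈ Ioo (min a c) (max b d), HasDerivAt k (Z (k t)) t := by
  classical
  let k : ℝ → E := fun t => if t ∈ Ioo a b then f t else g t
  have hkf : EqOn k f (Ioo a b) := fun t ht => if_pos ht
  have hkg : EqOn k g (Ioo c d) := by
    intro t ht
    by_cases h : t ∈ Ioo a b
    · rw [hkf h]
      refine integralCurve_eqOn_Ioo hZ (a := max a c) (b := min b d) (t₀ := t₀)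
        ⟨max_lt h1.1 h2.1, lt_min h1.2 h2.2⟩ (fun s hs => hf s ?_) (fun s hs => hg s ?_) heq
        ⟨max_lt h.1 ht.1, lt_min h.2 ht.2⟩
      · exact ⟨(le_max_left _ _).trans_lt hs.1, hs.2.trans_le (min_le_left _ _)⟩
      · exact ⟨(le_max_right _ _).trans_lt hs.1, hs.2.trans_le (min_le_right _ _)⟩
    · exact if_neg h
  refine ⟨k, hkf, fun t ht => ?_⟩
  have hmem : t ∈ Ioo a b ∨ t ∈ Ioo c d := by
    by_contra hcon
    simp only [not_or, mem_Ioo, not_and, not_lt] at hcon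
    obtain ⟨h3, h4⟩ := hcon
    rcases min_lt_iff.1 ht.1 with h | h <;> rcases lt_max_iff.1 ht.2 with h' | h'
    · linarith [h3 h]
    · by_cases hc : c < t
      · linarith [h4 hc]
      · linarith [h3 h, h1.2, h2.1]
    · by_cases ha : a < t
      · linarith [h3 ha]
      · linarith [h4 h, h1.1, h2.2]
    · linarith [h4 h]
  rcases hmem with h | h
  · rw [hkf h]
    exact (hf t h).congr_of_eventuallyEq (hkf.eventuallyEq_of_mem (Ioo_mem_nhds h.1 h.2))
  · rw [hkg h]
    exact (hg t h).congr_of_eventuallyEq (hkg.eventuallyEq_of_mem (Ioo_mem_nhds h.1 h.2))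

/-- If integral curves on bounded intervals are bounded, they extend to all times. -/
theorem exists_global_integralCurve {Z : E → E} (hZ : ContDiff ℝ 1 Z) (y : E)
    (H : ∀ T > (0 : ℝ), ∀ γ : ℝ → E, γ 0 = y → (∀ t ∈ Ioo (-T) T, HasDerivAt γ (Z (γ t)) t) →
      Bornology.IsBounded (γ '' Ioo (-T) T)) :
    ∃ γ : ℝ → E, γ 0 = y ∧ ∀ t, HasDerivAt γ (Z (γ t)) t := by
  have : ProperSpace E := FiniteDimensional.proper_real E
  let s : Set ℝ := {a | ∃ γ : ℝ → E, γ 0 = y ∧ ∀ t ∈ Ioo (-a) a, HasDerivAt γ (Z (γ t)) t}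
  have hmono : ∀ a ∈ s, ∀ b ≤ a, b ∈ s := by
    rintro a ⟨γ, h0, hγ⟩ b hb
    exact ⟨γ, h0, fun t ht => hγ t ⟨by linarith [ht.1], by linarith [ht.2]⟩⟩
  -- gluing a family of curves
  have hglue : ∀ A : ℝ → ℝ, (∀ t, A t ∈ s) → ∀ B : Set ℝ, (∀ t ∈ B, ContinuousAt A t) →
      (∀ t ∈ B, |t| < A t) → ∃ γ : ℝ → E, γ 0 = y ∧ ∀ t ∈ B, HasDerivAt γ (Z (γ t)) t := by
    intro A hA B hAc hB
    choose γ h0 hγ using hA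
    refine ⟨fun t => γ t t, h0 0, fun t ht => ?_⟩
    have hev : ∀ᶠ r in 𝓝 t, |r| < A r ∧ |r| < A t :=
      ((continuous_abs.tendsto t).eventually_lt (hAc t ht).tendsto (hB t ht)).and
        ((continuous_abs.tendsto t).eventually_lt_const (hB t ht))
    refine (hγ t t (abs_lt.1 (hB t ht))).congr_of_eventuallyEq ?_
    filter_upwards [hev] with r hr
    have hpos : 0 < min (A r) (A t) := (abs_nonneg r).trans_lt (lt_min hr.1 hr.2)
    refine integralCurve_eqOn_Ioo hZ (a := -min (A r) (A t)) (b := min (A r) (A t)) (t₀ := 0)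
      ⟨by linarith, hpos⟩ (fun u hu => hγ r u ?_) (fun u hu => hγ t u ?_)
      ((h0 r).trans (h0 t).symm) (abs_lt.1 (lt_min hr.1 hr.2))
    · rw [mem_Ioo, ← abs_lt] at hu ⊢
      exact hu.trans_le (min_le_left _ _)
    · rw [mem_Ioo, ← abs_lt] at hu ⊢
      exact hu.trans_le (min_le_right _ _)
  by_cases hb : BddAbove s
  swap
  · have hall : ∀ a, a ∈ s := by
      intro a
      rw [not_bddAbove_iff] at hb
      obtain ⟨b, hbs, hab⟩ := hb a
      exact hmono b hbs a hab.le
    obtain ⟨γ, h0, hγ⟩ := hglue (fun t => |t| + 1) (fun t => hall _) univ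
      (fun t _ => by fun_prop) (fun t _ => by simp)
    exact ⟨γ, h0, fun t => hγ t trivial⟩
  exfalso
  obtain ⟨ε₀, hε₀, h₀⟩ := exists_uniform_time hZ (isCompact_singleton (x := y))
  have hpos0 : ε₀ ∈ s := by
    obtain ⟨α, hα0, hα⟩ := h₀ y rfl 0
    exact ⟨α, hα0, fun t ht => hα t (by simpa using ht)⟩
  set T := sSup s with hT
  have hTpos : 0 < T := hε₀.trans_le (le_csSup hb hpos0)
  have hlt : ∀ a < T, a ∈ s := fun a ha => by
    obtain ⟨b, hbs, hab⟩ := exists_lt_of_lt_csSup ⟨_, hpos0⟩ ha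
    exact hmono b hbs a hab.le
  have hAc : ∀ t ∈ Ioo (-T) T, ContinuousAt (fun t => if |t| < T then (|t| + T) / 2 else 0) t := by
    intro t ht
    have h1 : ContinuousAt (fun t : ℝ => (|t| + T) / 2) t := by fun_prop
    refine h1.congr ?_
    filter_upwards [Ioo_mem_nhds ht.1 ht.2] with r hr
    rw [if_pos (abs_lt.2 hr)]
  obtain ⟨γ, h0, hγ⟩ := hglue _ (fun t => hlt _ (by split_ifs <;> linarith)) (Ioo (-T) T) hAc
    (fun t ht => by
      have := abs_lt.2 ht
      rw [if_pos this]
      linarith)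
  have hbd := H T hTpos γ h0 hγ
  obtain ⟨ε, hε, hα⟩ := exists_uniform_time hZ hbd.isCompact_closure
  set δ := min (ε / 2) (T / 2) with hδ
  have hδpos : 0 < δ := lt_min (by linarith) (by linarith)
  have hδε : δ < ε := (min_le_left _ _).trans_lt (by linarith)
  have hδT : δ < T := (min_le_right _ _).trans_lt (by linarith)
  have hm1 : T - δ ∈ Ioo (-T) T := ⟨by linarith, by linarith⟩
  have hm2 : -(T - δ) ∈ Ioo (-T) T := ⟨by linarith, by linarith⟩
  obtain ⟨α, hα0, hα1⟩ := hα (γ (T - δ)) (subset_closure (mem_image_of_mem γ hm1)) (T - δ)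
  obtain ⟨β, hβ0, hβ1⟩ := hα (γ (-(T - δ))) (subset_closure (mem_image_of_mem γ hm2)) (-(T - δ))
  obtain ⟨k, hk1, hk2⟩ := integralCurve_glue hZ hm1 ⟨by linarith, by linarith⟩ hγ hα1 hα0.symm
  have hm3 : -(T - δ) ∈ Ioo (min (-T) (T - δ - ε)) (max T (T - δ + ε)) :=
    ⟨(min_le_left _ _).trans_lt (by linarith), lt_of_lt_of_le (by linarith) (le_max_left _ _)⟩
  obtain ⟨k', hk1', hk2'⟩ := integralCurve_glue hZ hm3 ⟨by linarith, by linarith⟩ hk2 hβ1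
    ((hk1 hm2).trans hβ0.symm)
  have hmem : T + (ε - δ) ∈ s := by
    refine ⟨k', ?_, fun t ht => hk2' t ⟨?_, ?_⟩⟩
    · rw [hk1' ⟨(min_le_left _ _).trans_lt (by linarith), lt_of_lt_of_le hTpos (le_max_left _ _)⟩,
        hk1 ⟨by linarith, hTpos⟩, h0]
    · exact (min_le_right _ _).trans_lt (by linarith [ht.1])
    · exact lt_of_lt_of_le (by linarith [ht.2]) ((le_max_right _ _).trans (le_max_left _ _))
  linarith [le_csSup hb hmem]

end ODE

section Flow

lemma HasDerivAt.fst_comp {E F : Type*} [NormedAddCommGroup E] [NormedSpace ℝ E]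
    [NormedAddCommGroup F] [NormedSpace ℝ F] {f : ℝ → E × F} {f' : E × F} {t : ℝ}
    (h : HasDerivAt f f' t) : HasDerivAt (fun s => (f s).1) f'.1 t :=
  (hasFDerivAt_fst (p := f t)).comp_hasDerivAt t h

lemma HasDerivAt.snd_comp {E F : Type*} [NormedAddCommGroup E] [NormedSpace ℝ E]
    [NormedAddCommGroup F] [NormedSpace ℝ F] {f : ℝ → E × F} {f' : E × F} {t : ℝ}
    (h : HasDerivAt f f' t) : HasDerivAt (fun s => (f s).2) f'.2 t :=
  (hasFDerivAt_snd (p := f t)).comp_hasDerivAt t h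

/-- Two-sided Gronwall inequality. -/
lemma norm_le_gronwallBound_abs {F : Type*} [NormedAddCommGroup F] [NormedSpace ℝ F]
    {f f' : ℝ → F} {T K ε : ℝ} (hf : ∀ t ∈ Ioo (-T) T, HasDerivAt f (f' t) t)
    (hb : ∀ t ∈ Ioo (-T) T, ‖f' t‖ ≤ K * ‖f t‖ + ε) :
    ∀ t ∈ Ioo (-T) T, ‖f t‖ ≤ gronwallBound ‖f 0‖ K ε |t| := by
  have key : ∀ g g' : ℝ → F, g 0 = f 0 → (∀ t ∈ Ioo (-T) T, HasDerivAt g (g' t) t) →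
      (∀ t ∈ Ioo (-T) T, ‖g' t‖ ≤ K * ‖g t‖ + ε) → ∀ t ∈ Ioo (-T) T, 0 ≤ t →
      ‖g t‖ ≤ gronwallBound ‖f 0‖ K ε t := by
    intro g g' h0 hg hb t ht h0t
    have hsub : Icc 0 t ⊆ Ioo (-T) T := fun s hs => ⟨by linarith [hs.1, ht.2], by linarith [hs.2, ht.2]⟩
    have := norm_le_gronwallBound_of_norm_deriv_right_le (f := g) (f' := g') (a := 0) (b := t)
      (δ := ‖f 0‖) (K := K) (ε := ε)
      (fun s hs => (hg s (hsub hs)).continuousAt.continuousWithinAt)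
      (fun s hs => (hg s (hsub (Ico_subset_Icc_self hs))).hasDerivWithinAt) (by rw [h0])
      (fun s hs => hb s (hsub (Ico_subset_Icc_self hs))) t ⟨h0t, le_rfl⟩
    simpa using this
  intro t ht
  rcases le_total 0 t with h | h
  · rw [abs_of_nonneg h]
    exact key f f' rfl hf hb t ht h
  · rw [abs_of_nonpos h]
    have hneg : ∀ s ∈ Ioo (-T) T, -s ∈ Ioo (-T) T := fun s hs =>
      ⟨by linarith [hs.2], by linarith [hs.1]⟩
    have := key (fun s => f (-s)) (fun s => -f' (-s)) (by simp) (fun s hs => ?_) (fun s hs => ?_)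
      (-t) (hneg t ht) (by linarith)
    · simpa using this
    · have := (hf (-s) (hneg s hs)).scomp s (hasDerivAt_neg s)
      simpa [Function.comp_def] using this
    · simpa using hb (-s) (hneg s hs)

variable {E : Type*} [NormedAddCommGroup E] [NormedSpace ℝ E] [FiniteDimensional ℝ E]

/-- `Φ` is a globally defined flow of the vector field `Z`. -/
structure IsFlow (Z : E → E) (Φ : ℝ → E → E) : Prop where
  zero : ∀ y, Φ 0 y = y
  deriv : ∀ y t, HasDerivAt (fun s => Φ s y) (Z (Φ t y)) t

lemma IsFlow.group {Z : E → E} {Φ : ℝ → E → E} (h : IsFlow Z Φ) (hZ : ContDiff ℝ 1 Z)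
    (s t : ℝ) (y : E) : Φ t (Φ s y) = Φ (s + t) y := by
  have := integralCurve_eq hZ (f := fun r => Φ r (Φ s y)) (g := fun r => Φ (s + r) y) 0
    (fun r => h.deriv _ _) (fun r => (h.deriv y (s + r)).comp_const_add s r) (by simp [h.zero])
  exact congrFun this t

lemma IsFlow.unique {Z : E → E} {Φ : ℝ → E → E} (h : IsFlow Z Φ) (hZ : ContDiff ℝ 1 Z)
    {f : ℝ → E} (hf : ∀ t, HasDerivAt f (Z (f t)) t) (t : ℝ) : f t = Φ t (f 0) := by
  have := integralCurve_eq hZ (f := f) (g := fun r => Φ r (f 0)) 0 hf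
    (fun r => h.deriv _ _) (by simp [h.zero])
  exact congrFun this t

lemma exists_isFlow {Z : E → E} (hZ : ContDiff ℝ 1 Z)
    (H : ∀ y, ∀ T > (0 : ℝ), ∀ γ : ℝ → E, γ 0 = y →
      (∀ t ∈ Ioo (-T) T, HasDerivAt γ (Z (γ t)) t) → Bornology.IsBounded (γ '' Ioo (-T) T)) :
    ∃ Φ, IsFlow Z Φ := by
  choose γ h0 hγ using fun y => exists_global_integralCurve hZ y (H y)
  exact ⟨fun t y => γ y t, h0, hγ⟩

omit [FiniteDimensional ℝ E] in
/-- Lipschitz dependence on initial values, when the field is Lipschitz on a set. -/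
lemma dist_integralCurve_le {Z : E → E} {S : Set E} {K : ℝ≥0} (hK : LipschitzOnWith K Z S)
    {T : ℝ} {f g : ℝ → E} (hf : ∀ t ∈ Ioo (-T) T, HasDerivAt f (Z (f t)) t)
    (hg : ∀ t ∈ Ioo (-T) T, HasDerivAt g (Z (g t)) t)
    (hfS : ∀ t ∈ Ioo (-T) T, f t ∈ S) (hgS : ∀ t ∈ Ioo (-T) T, g t ∈ S) :
    ∀ t ∈ Ioo (-T) T, ‖f t - g t‖ ≤ ‖f 0 - g 0‖ * Real.exp (K * |t|) := by
  intro t ht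
  rw [← gronwallBound_ε0]
  refine norm_le_gronwallBound_abs (f := fun t => f t - g t) (f' := fun t => Z (f t) - Z (g t))
    (fun t ht => (hf t ht).sub (hg t ht)) (fun t ht => ?_) t ht
  rw [add_zero]
  exact hK.norm_sub_le (hfS t ht) (hgS t ht)

/-- Uniform Lipschitz dependence of the flow on the initial value over bounded times. -/
lemma IsFlow.local_lipschitz {Z : E → E} {Φ : ℝ → E → E} (h : IsFlow Z Φ) (hZ : ContDiff ℝ 1 Z)
    (y : E) (T : ℝ) : ∃ δ > 0, ∃ C R : ℝ, ∀ z, ‖z - y‖ < δ → ∀ t ∈ Ioo (-T) T,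
      ‖Φ t z - Φ t y‖ ≤ ‖z - y‖ * C ∧ ‖Φ t z‖ ≤ R ∧ ‖Φ t y‖ ≤ R := by
  have : ProperSpace E := FiniteDimensional.proper_real E
  have hcont : Continuous fun t => Φ t y :=
    continuous_iff_continuousAt.2 fun t => (h.deriv y t).continuousAt
  obtain ⟨R, hR⟩ := (isCompact_Icc (a := -T) (b := T)).exists_bound_of_continuousOn
    hcont.continuousOn
  let χ : ContDiffBump (0 : E) :=
    { rIn := |R| + 1, rOut := |R| + 2, rIn_pos := by positivity, rIn_lt_rOut := by linarith }
  let Z' : E → E := fun x => χ x • Z x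
  have hZ' : ContDiff ℝ 1 Z' := χ.contDiff.smul hZ
  have hcs : HasCompactSupport Z' := χ.hasCompactSupport.smul_right
  obtain ⟨K, hK⟩ := hZ'.lipschitzWith_of_hasCompactSupport hcs one_ne_zero
  obtain ⟨B, hB⟩ := hcs.exists_bound_of_continuous hZ'.continuous
  have hZZ : ∀ x, ‖x‖ ≤ |R| + 1 → Z' x = Z x := fun x hx => by
    have : χ x = 1 := χ.one_of_mem_closedBall (by simpa [χ] using hx)
    simp [Z', this]
  obtain ⟨Ψ, hΨ⟩ := exists_isFlow hZ' (by
    intro y T hT γ h0 hγ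
    refine isBounded_iff_forall_norm_le.2 ⟨gronwallBound ‖γ 0‖ 0 B T, ?_⟩
    rintro _ ⟨t, ht, rfl⟩
    have hBn : 0 ≤ B := (norm_nonneg _).trans (hB 0)
    refine (norm_le_gronwallBound_abs (K := 0) (ε := B) hγ (fun t _ => by simpa using hB _) t ht).trans ?_
    exact gronwallBound_mono (norm_nonneg _) hBn le_rfl (abs_lt.2 ht).le)
  set C := Real.exp (K * |T|)
  have hC : 0 < C := Real.exp_pos _
  refine ⟨C⁻¹, inv_pos.2 hC, C, |R| + 1, fun z hz t ht => ?_⟩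
  have hy : ∀ s ∈ Ioo (-T) T, ‖Φ s y‖ ≤ |R| := fun s hs =>
    (hR s (Ioo_subset_Icc_self hs)).trans (le_abs_self R)
  have hest : ∀ s ∈ Ioo (-T) T, ‖Ψ s z - Φ s y‖ ≤ ‖z - y‖ * C := by
    intro s hs
    have := dist_integralCurve_le (Z := Z') (S := univ) hK.lipschitzOnWith (T := T)
      (f := fun s => Ψ s z) (g := fun s => Φ s y) (fun s _ => hΨ.deriv z s)
      (fun s hs => by rw [hZZ _ ((hy s hs).trans (by linarith))]; exact h.deriv y s)
      (fun _ _ => trivial) (fun _ _ => trivial) s hs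
    simp only [hΨ.zero, h.zero] at this
    refine this.trans ?_
    have := (abs_lt.2 hs).le.trans (le_abs_self T)
    exact mul_le_mul_of_nonneg_left (Real.exp_le_exp.2 (by gcongr)) (norm_nonneg _)
  have hlt : ‖z - y‖ * C ≤ 1 := by
    rw [← inv_mul_cancel₀ hC.ne']
    gcongr
  have hΨb : ∀ s ∈ Ioo (-T) T, ‖Ψ s z‖ ≤ |R| + 1 := fun s hs => by
    have h1 : Ψ s z = (Ψ s z - Φ s y) + Φ s y := by abel
    rw [h1]
    refine (norm_add_le _ _).trans ?_
    linarith [hest s hs, hy s hs]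
  have heq : ∀ s ∈ Ioo (-T) T, Ψ s z = Φ s z := by
    intro s hs
    have hT : 0 < T := by linarith [hs.1, hs.2]
    exact integralCurve_eqOn_Ioo hZ (f := fun s => Ψ s z) (g := fun s => Φ s z) (t₀ := 0)
      (a := -T) (b := T) ⟨by linarith, hT⟩
      (fun s hs => by rw [← hZZ _ (hΨb s hs)]; exact hΨ.deriv z s)
      (fun s _ => h.deriv z s) (by simp [h.zero, hΨ.zero]) hs
  rw [← heq t ht]
  exact ⟨hest t ht, hΨb t ht, (hy t ht).trans (by linarith)⟩

lemma IsFlow.continuous {Z : E → E} {Φ : ℝ → E → E} (h : IsFlow Z Φ) (hZ : ContDiff ℝ 1 Z) :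
    Continuous fun q : ℝ × E => Φ q.1 q.2 := by
  rw [continuous_iff_continuousAt]
  rintro ⟨t, y⟩
  obtain ⟨δ, hδ, C, R, hC⟩ := h.local_lipschitz hZ y (|t| + 1)
  have h1 : Tendsto (fun q : ℝ × E => Φ q.1 y) (𝓝 (t, y)) (𝓝 (Φ t y)) :=
    ((h.deriv y t).continuousAt.tendsto).comp continuous_fst.continuousAt.tendsto
  have h2 : Tendsto (fun q : ℝ × E => Φ q.1 q.2 - Φ q.1 y) (𝓝 (t, y)) (𝓝 0) := by
    have h3 : Tendsto (fun q : ℝ × E => ‖q.2 - y‖ * C) (𝓝 (t, y)) (𝓝 0) := by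
      have : Continuous fun q : ℝ × E => ‖q.2 - y‖ * C := by fun_prop
      simpa using this.tendsto (t, y)
    refine squeeze_zero_norm' ?_ h3
    have e1 : ∀ᶠ q : ℝ × E in 𝓝 (t, y), ‖q.2 - y‖ < δ := by
      have : Continuous fun q : ℝ × E => ‖q.2 - y‖ := by fun_prop
      exact (this.tendsto (t, y)).eventually_lt_const (by simpa using hδ)
    have e2 : ∀ᶠ q : ℝ × E in 𝓝 (t, y), |q.1| < |t| + 1 := by
      have : Continuous fun q : ℝ × E => |q.1| := by fun_prop
      exact (this.tendsto (t, y)).eventually_lt_const (by simp)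
    filter_upwards [e1, e2] with q hq1 hq2
    exact (hC q.2 hq1 q.1 (abs_lt.1 hq2)).1
  have := h2.add h1
  simpa [ContinuousAt] using this

/-- A linear skew product over a complete flow is complete. -/
lemma IsFlow.exists_skew {F : Type*} [NormedAddCommGroup F] [NormedSpace ℝ F]
    [FiniteDimensional ℝ F] {Z : E → E} {Φ : ℝ → E → E} (h : IsFlow Z Φ) (hZ : ContDiff ℝ 1 Z)
    {L : E → F →L[ℝ] F} (hL : ContDiff ℝ 1 L) :
    ∃ W : ℝ → E × F → F, IsFlow (fun q : E × F => (Z q.1, L q.1 q.2))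
      (fun t q => (Φ t q.1, W t q)) := by
  have hZ2 : ContDiff ℝ 1 (fun q : E × F => (Z q.1, L q.1 q.2)) :=
    (hZ.comp contDiff_fst).prodMk ((hL.comp contDiff_fst).clm_apply contDiff_snd)
  obtain ⟨Ψ, hΨ⟩ := exists_isFlow hZ2 (by
    intro y T hT γ h0 hγ
    have hγ1 : ∀ t ∈ Ioo (-T) T, HasDerivAt (fun t => (γ t).1) (Z (γ t).1) t := fun t ht =>
      (hγ t ht).fst_comp
    have hγ2 : ∀ t ∈ Ioo (-T) T, HasDerivAt (fun t => (γ t).2) (L (γ t).1 (γ t).2) t :=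
      fun t ht => (hγ t ht).snd_comp
    have e1 : ∀ t ∈ Ioo (-T) T, (γ t).1 = Φ t y.1 :=
      integralCurve_eqOn_Ioo hZ (t₀ := 0) ⟨by linarith, hT⟩ hγ1 (fun t _ => h.deriv _ _)
        (by simp [h.zero, h0])
    have hcont : Continuous fun t => Φ t y.1 :=
      continuous_iff_continuousAt.2 fun t => (h.deriv _ t).continuousAt
    obtain ⟨R, hR⟩ := (isCompact_Icc (a := -T) (b := T)).exists_bound_of_continuousOn
      hcont.continuousOn
    obtain ⟨K, hK⟩ := (isCompact_Icc (a := -T) (b := T)).exists_bound_of_continuousOn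
      (hL.continuous.comp hcont).continuousOn
    refine isBounded_iff_forall_norm_le.2 ⟨max R (gronwallBound ‖(γ 0).2‖ (max K 0) 0 T), ?_⟩
    rintro _ ⟨t, ht, rfl⟩
    refine max_le_max ?_ ?_
    · rw [e1 t ht]; exact hR t (Ioo_subset_Icc_self ht)
    · refine (norm_le_gronwallBound_abs (K := max K 0) (ε := 0) hγ2 (fun t ht => ?_) t ht).trans ?_
      · rw [add_zero]
        refine (ContinuousLinearMap.le_opNorm _ _).trans ?_
        gcongr
        rw [e1 t ht]
        exact (hK t (Ioo_subset_Icc_self ht)).trans (le_max_left _ _)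
      · exact gronwallBound_mono (norm_nonneg _) le_rfl (le_max_right _ _) (abs_lt.2 ht).le)
  refine ⟨fun t q => (Ψ t q).2, ⟨fun q => ?_, fun q t => ?_⟩⟩
  · simp [h.zero, hΨ.zero]
  · have e : ∀ t, (Ψ t q).1 = Φ t q.1 := fun t => by
      have := h.unique hZ (f := fun t => (Ψ t q).1)
        (fun t => (hΨ.deriv q t).fst_comp) t
      simpa [hΨ.zero] using this
    simp only [← e]
    exact hΨ.deriv q t

/-- The flow of a `C²` field is `C¹` in the initial value, and its derivative solves the
variational equation. -/
theorem IsFlow.exists_fderiv {Z : E → E} {Φ : ℝ → E → E} (h : IsFlow Z Φ) (hZ : ContDiff ℝ 2 Z) :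
    ∃ W : ℝ → E → E →L[ℝ] E, (∀ y, W 0 y = ContinuousLinearMap.id ℝ E) ∧
      (∀ y t, HasDerivAt (fun s => W s y) ((fderiv ℝ Z (Φ t y)).comp (W t y)) t) ∧
      (∀ y t, HasFDerivAt (Φ t) (W t y) y) ∧ ∀ t, Continuous (W t) := by
  have hZ1 : ContDiff ℝ 1 Z := hZ.of_le (by norm_num)
  have hdZ : ContDiff ℝ 1 (fderiv ℝ Z) := hZ.fderiv_right (by norm_num)
  let c : (E →L[ℝ] E) →L[ℝ] (E →L[ℝ] E) →L[ℝ] (E →L[ℝ] E) := ContinuousLinearMap.compL ℝ E E E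
  have hL : ContDiff ℝ 1 fun y => c (fderiv ℝ Z y) := contDiff_const.clm_apply hdZ
  obtain ⟨W', hW'⟩ := h.exists_skew hZ1 hL
  have hZ2 : ContDiff ℝ 1 (fun q : E × (E →L[ℝ] E) => (Z q.1, c (fderiv ℝ Z q.1) q.2)) :=
    (hZ1.comp contDiff_fst).prodMk ((hL.comp contDiff_fst).clm_apply contDiff_snd)
  let W : ℝ → E → E →L[ℝ] E := fun t y => W' t (y, ContinuousLinearMap.id ℝ E)
  have h0 : ∀ y, W 0 y = ContinuousLinearMap.id ℝ E := fun y =>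
    congrArg Prod.snd (hW'.zero (y, ContinuousLinearMap.id ℝ E))
  have hd : ∀ y t, HasDerivAt (fun s => W s y) ((fderiv ℝ Z (Φ t y)).comp (W t y)) t := fun y t =>
    (hW'.deriv (y, ContinuousLinearMap.id ℝ E) t).snd_comp
  refine ⟨W, h0, hd, fun y t => ?_, fun t => ?_⟩
  · obtain ⟨δ, hδ, C, R, hC⟩ := h.local_lipschitz hZ1 y (|t| + 1)
    obtain ⟨K, hK⟩ := lipschitzOn_closedBall hZ1 R
    obtain ⟨M, hM⟩ := lipschitzOn_closedBall hdZ R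
    have hfb : ∀ x ∈ Metric.ball (0 : E) (R + 1), True := fun _ _ => trivial
    have ht : t ∈ Ioo (-(|t| + 1)) (|t| + 1) := abs_lt.1 (by linarith)
    have : ProperSpace E := FiniteDimensional.proper_real E
    obtain ⟨K', hK'⟩ := (isCompact_closedBall (0 : E) R).exists_bound_of_continuousOn
      hdZ.continuous.continuousOn
    -- second order remainder
    have hrem : ∀ z, ‖z - y‖ < δ → ‖Φ t z - Φ t y - W t y (z - y)‖ ≤
        gronwallBound 0 (max K' 0) (M * (‖z - y‖ * C) * (‖z - y‖ * C)) |t| := by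
      intro z hz
      have hg := norm_le_gronwallBound_abs (f := fun s => Φ s z - Φ s y - W s y (z - y))
        (f' := fun s => Z (Φ s z) - Z (Φ s y) - fderiv ℝ Z (Φ s y) (W s y (z - y)))
        (K := max K' 0) (ε := M * (‖z - y‖ * C) * (‖z - y‖ * C))
        (T := |t| + 1) (fun s hs => ((h.deriv z s).sub (h.deriv y s)).sub
          ((hd y s).clm_apply (hasDerivAt_const s (z - y)) |>.congr_deriv (by simp))) ?_ t ht
      · simpa [h.zero, h0] using hg
      intro s hs
      obtain ⟨h1, h2, h3⟩ := hC z hz s hs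
      have hfy : ‖fderiv ℝ Z (Φ s y)‖ ≤ max K' 0 :=
        (hK' _ (by simpa using h3)).trans (le_max_left _ _)
      have hseg : segment ℝ (Φ s y) (Φ s z) ⊆ Metric.closedBall (0 : E) R :=
        (convex_closedBall _ _).segment_subset (by simpa using h3) (by simpa using h2)
      have hmv := (convex_segment (Φ s y) (Φ s z)).norm_image_sub_le_of_norm_hasFDerivWithin_le
        (f := fun x => Z x - fderiv ℝ Z (Φ s y) x)
        (f' := fun x => fderiv ℝ Z x - fderiv ℝ Z (Φ s y)) (C := M * (‖z - y‖ * C))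
        (fun x _ => (((hZ1.differentiable one_ne_zero x).hasFDerivAt.sub
          (fderiv ℝ Z (Φ s y)).hasFDerivAt)).hasFDerivWithinAt)
        (fun x hx => ?_) (left_mem_segment ℝ _ _) (right_mem_segment ℝ _ _)
      · have e : Z (Φ s z) - Z (Φ s y) - fderiv ℝ Z (Φ s y) (W s y (z - y)) =
            fderiv ℝ Z (Φ s y) (Φ s z - Φ s y - W s y (z - y)) +
            ((Z (Φ s z) - fderiv ℝ Z (Φ s y) (Φ s z)) - (Z (Φ s y) - fderiv ℝ Z (Φ s y) (Φ s y))) := by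
          simp only [map_sub]; abel
        rw [e]
        refine (norm_add_le _ _).trans (add_le_add ?_ (hmv.trans ?_))
        · exact (ContinuousLinearMap.le_opNorm _ _).trans (by gcongr)
        · have : 0 ≤ ‖z - y‖ * C := (norm_nonneg _).trans h1
          gcongr
      · have := hM.norm_sub_le (hseg hx) (hseg (left_mem_segment ℝ _ _))
        refine this.trans ?_
        gcongr
        have h4 := norm_sub_le_of_mem_segment hx
        exact h4.trans h1
    rw [hasFDerivAt_iff_isLittleO]
    have hbd : (fun z => Φ t z - Φ t y - W t y (z - y)) =O[𝓝 y] fun z => ‖z - y‖ ^ 2 := by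
      refine Asymptotics.IsBigO.of_bound (gronwallBound 0 (max K' 0) (M * C * C) |t|) ?_
      filter_upwards [Metric.ball_mem_nhds y hδ] with z hz
      rw [Metric.mem_ball, dist_eq_norm] at hz
      refine (hrem z hz).trans (le_of_eq ?_)
      rw [norm_pow, norm_norm]
      unfold gronwallBound
      split_ifs <;> ring
    refine hbd.trans_isLittleO ?_
    have h5 : (fun z : E => ‖z - y‖ ^ 2) =o[𝓝 y] fun z => ‖z - y‖ ^ 1 := by
      have := (Asymptotics.isLittleO_pow_pow (𝕜 := ℝ) (m := 1) (n := 2) (by norm_num))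
      have h6 : Tendsto (fun z : E => ‖z - y‖) (𝓝 y) (𝓝 0) := by
        have : Continuous fun z : E => ‖z - y‖ := by fun_prop
        simpa using this.tendsto y
      exact this.comp_tendsto h6
    simpa using h5
  · have := (hW'.continuous hZ2)
    have h2 : Continuous fun y : E => (Φ t y, W t y) :=
      this.comp (continuous_const.prodMk (continuous_id.prodMk continuous_const))
    exact continuous_snd.comp h2

end Flow

end

noncomputable section

open scoped Topology ContDiff

/-- Coordinate partial derivative. -/
noncomputable def pd (i : Fin 2) (f : V2 → ℝ) (p : V2) : ℝ := fderiv ℝ f p (Pi.single i 1)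

lemma hasDerivAt_comp_pd {f : V2 → ℝ} {x : ℝ → V2} {x' : V2} {t : ℝ}
    (hf : DifferentiableAt ℝ f (x t)) (hx : HasDerivAt x x' t) :
    HasDerivAt (fun s => f (x s)) (x' 0 * pd 0 f (x t) + x' 1 * pd 1 f (x t)) t := by
  have h := hf.hasFDerivAt.comp_hasDerivAt t hx
  refine h.congr_deriv ?_
  have e : x' = x' 0 • (Pi.single 0 1 : V2) + x' 1 • (Pi.single 1 1 : V2) := by
    ext i; fin_cases i <;> simp
  have e2 := congrArg (fderiv ℝ f (x t)) e
  rw [e2]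
  simp [pd]

lemma hasDerivAt_line (p v : V2) (s : ℝ) : HasDerivAt (fun s : ℝ => p + s • v) v s := by
  simpa using ((hasDerivAt_id s).smul_const v).const_add p

lemma hasDerivAt_pd_line {f : V2 → ℝ} {p : V2} (hf : DifferentiableAt ℝ f p) (i : Fin 2) :
    HasDerivAt (fun s : ℝ => f (p + s • (Pi.single i 1 : V2))) (pd i f p) 0 := by
  have h := hasDerivAt_comp_pd (f := f) (x := fun s : ℝ => p + s • (Pi.single i 1 : V2)) (t := 0)
    (by simpa using hf) (hasDerivAt_line p _ 0)
  convert h using 1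
  fin_cases i <;> simp

lemma contDiff_pd {f : V2 → ℝ} (hf : ContDiff ℝ ∞ f) (i : Fin 2) : ContDiff ℝ ∞ (pd i f) :=
  (hf.fderiv_right (m := ∞) (by simp)).clm_apply contDiff_const

lemma pd_comm {f : V2 → ℝ} (hf : ContDiff ℝ ∞ f) (i j : Fin 2) (p : V2) :
    pd i (pd j f) p = pd j (pd i f) p := by
  have hs : IsSymmSndFDerivAt ℝ f p := (hf.contDiffAt (x := p)).isSymmSndFDerivAt
    (by simpa using WithTop.coe_le_coe.2 (le_top : (2 : ℕ∞) ≤ ⊤))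
  have h1 : ∀ k : Fin 2, ∀ w, fderiv ℝ (pd k f) p w = fderiv ℝ (fderiv ℝ f) p w (Pi.single k 1) := by
    intro k w
    have hd : DifferentiableAt ℝ (fderiv ℝ f) p :=
      ((hf.fderiv_right (m := ∞) (by simp)).differentiable (by simp)) p
    have := (hd.hasFDerivAt.clm_apply (hasFDerivAt_const (Pi.single k 1 : V2) p)).fderiv
    have e : pd k f = fun y => (fderiv ℝ f y) (Pi.single k 1) := rfl
    rw [e, this]
    simp
  rw [pd, pd, h1, h1]
  exact hs _ _

namespace RMetric

variable (M : RMetric)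

/-- Density of the Riemannian area. -/
def rho (p : V2) : ℝ := √(M.g p).det
/-- First coordinate of the first frame vector. -/
def fa (p : V2) : ℝ := (√(M.g p 0 0))⁻¹
/-- First coordinate of the second frame vector. -/
def fb (p : V2) : ℝ := -M.g p 0 1 / (√(M.g p 0 0) * M.rho p)
/-- Second coordinate of the second frame vector. -/
def fd (p : V2) : ℝ := √(M.g p 0 0) / M.rho p
/-- Connection form on the second frame vector. -/
def c2 (p : V2) : ℝ := -(M.fa p * pd 0 M.fd p) / M.fd p
/-- Connection form on the first frame vector. -/
def c1 (p : V2) : ℝ :=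
  -(M.fa p * pd 0 M.fb p - M.fb p * pd 0 M.fa p - M.fd p * pd 1 M.fa p) / M.fa p +
    M.fb p * pd 0 M.fd p / M.fd p

lemma g00_pos (p : V2) : 0 < M.g p 0 0 := (M.posDef p).diag_pos

lemma det_pos (p : V2) : 0 < (M.g p).det := (M.posDef p).det_pos

lemma g10 (p : V2) : M.g p 1 0 = M.g p 0 1 := (M.symm p).apply 0 1

lemma det_eq (p : V2) : (M.g p).det = M.g p 0 0 * M.g p 1 1 - M.g p 0 1 ^ 2 := by
  rw [Matrix.det_fin_two, g10]; ring

lemma rho_pos (p : V2) : 0 < M.rho p := Real.sqrt_pos.2 (M.det_pos p)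

lemma fa_pos (p : V2) : 0 < M.fa p := inv_pos.2 (Real.sqrt_pos.2 (M.g00_pos p))

lemma fd_pos (p : V2) : 0 < M.fd p := div_pos (Real.sqrt_pos.2 (M.g00_pos p)) (M.rho_pos p)

lemma contDiff_det : ContDiff ℝ ∞ fun p => (M.g p).det := by
  have h := M.smooth
  have : (fun p => (M.g p).det) = fun p => M.g p 0 0 * M.g p 1 1 - M.g p 0 1 ^ 2 :=
    funext M.det_eq
  rw [this]
  exact ((h 0 0).mul (h 1 1)).sub ((h 0 1).pow 2)

lemma contDiff_rho : ContDiff ℝ ∞ M.rho := M.contDiff_det.sqrt fun p => (M.det_pos p).ne'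

lemma contDiff_sqrt00 : ContDiff ℝ ∞ fun p => √(M.g p 0 0) :=
  (M.smooth 0 0).sqrt fun p => (M.g00_pos p).ne'

lemma sqrt00_ne (p : V2) : √(M.g p 0 0) ≠ 0 := (Real.sqrt_pos.2 (M.g00_pos p)).ne'

lemma contDiff_fa : ContDiff ℝ ∞ M.fa := M.contDiff_sqrt00.inv M.sqrt00_ne

lemma contDiff_fd : ContDiff ℝ ∞ M.fd := M.contDiff_sqrt00.div M.contDiff_rho fun p => (M.rho_pos p).ne'

lemma contDiff_fb : ContDiff ℝ ∞ M.fb := (M.smooth 0 1).neg.div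
  (M.contDiff_sqrt00.mul M.contDiff_rho) fun p => mul_ne_zero (M.sqrt00_ne p) (M.rho_pos p).ne'

lemma contDiff_c2 : ContDiff ℝ ∞ M.c2 :=
  (M.contDiff_fa.mul (contDiff_pd M.contDiff_fd 0)).neg.div M.contDiff_fd fun p => (M.fd_pos p).ne'

lemma contDiff_c1 : ContDiff ℝ ∞ M.c1 :=
  (((((M.contDiff_fa.mul (contDiff_pd M.contDiff_fb 0)).sub
    (M.contDiff_fb.mul (contDiff_pd M.contDiff_fa 0))).sub
    (M.contDiff_fd.mul (contDiff_pd M.contDiff_fa 1))).neg).div M.contDiff_fa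
      fun p => (M.fa_pos p).ne').add
  ((M.contDiff_fb.mul (contDiff_pd M.contDiff_fd 0)).div M.contDiff_fd fun p => (M.fd_pos p).ne')

lemma rho_eq (p : V2) : M.rho p = 1 / (M.fa p * M.fd p) := by
  have h1 := M.sqrt00_ne p
  have h2 := (M.rho_pos p).ne'
  unfold fa fd
  field_simp

lemma g00_eq (p : V2) : M.g p 0 0 = 1 / M.fa p ^ 2 := by
  unfold fa
  rw [inv_pow, Real.sq_sqrt (M.g00_pos p).le]
  simp

lemma g01_eq (p : V2) : M.g p 0 1 = -M.fb p / (M.fa p ^ 2 * M.fd p) := by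
  have h1 := M.sqrt00_ne p
  have h2 := (M.rho_pos p).ne'
  unfold fa fb fd
  field_simp

lemma g11_eq (p : V2) : M.g p 1 1 = (M.fa p ^ 2 + M.fb p ^ 2) / (M.fa p ^ 2 * M.fd p ^ 2) := by
  have h1 := M.sqrt00_ne p
  have h2 := (M.rho_pos p).ne'
  have h3 : √(M.g p 0 0) ^ 2 = M.g p 0 0 := Real.sq_sqrt (M.g00_pos p).le
  have h4 : M.rho p ^ 2 = (M.g p).det := Real.sq_sqrt (M.det_pos p).le
  rw [M.det_eq] at h4
  have h5 := (M.g00_pos p).ne'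
  unfold fa fb fd
  field_simp
  rw [h4, h3]
  ring

lemma inv_eq (p : V2) : (M.g p)⁻¹ =
    !![M.fa p ^ 2 + M.fb p ^ 2, M.fb p * M.fd p; M.fb p * M.fd p, M.fd p ^ 2] := by
  have h1 := (M.fa_pos p).ne'
  have h2 := (M.fd_pos p).ne'
  refine Matrix.inv_eq_right_inv ?_
  ext i j
  fin_cases i <;> fin_cases j <;>
    simp [Matrix.mul_apply, Fin.sum_univ_two, M.g10, M.g00_eq, M.g01_eq, M.g11_eq] <;>
    field_simp <;> ring

lemma dg_eq_of {f : V2 → ℝ} {i j k : Fin 2} {c : ℝ} {p : V2} (h : ∀ q, M.g q i j = f q)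
    (hf : HasDerivAt (fun s : ℝ => f (p + s • (Pi.single k 1 : V2))) c 0) : M.dg k i j p = c := by
  unfold dg
  simp only [h]
  exact hf.deriv

lemma dg00 (k : Fin 2) (p : V2) : M.dg k 0 0 p = -2 * pd k M.fa p / M.fa p ^ 3 := by
  have h1 := (M.fa_pos p).ne'
  have ha := hasDerivAt_pd_line (M.contDiff_fa.differentiable (by simp) p) k
  refine M.dg_eq_of M.g00_eq (((hasDerivAt_const (0 : ℝ) (1 : ℝ)).div (ha.pow 2)
    (by simpa using h1)).congr_deriv ?_)
  simp
  field_simp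

lemma dg01 (k : Fin 2) (p : V2) : M.dg k 0 1 p = -pd k M.fb p / (M.fa p ^ 2 * M.fd p) +
    2 * M.fb p * pd k M.fa p / (M.fa p ^ 3 * M.fd p) +
    M.fb p * pd k M.fd p / (M.fa p ^ 2 * M.fd p ^ 2) := by
  have h1 := (M.fa_pos p).ne'
  have h2 := (M.fd_pos p).ne'
  have ha := hasDerivAt_pd_line (M.contDiff_fa.differentiable (by simp) p) k
  have hb := hasDerivAt_pd_line (M.contDiff_fb.differentiable (by simp) p) k
  have hd := hasDerivAt_pd_line (M.contDiff_fd.differentiable (by simp) p) k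
  refine M.dg_eq_of M.g01_eq ((hb.neg.div ((ha.pow 2).mul hd)
    (by simpa using ⟨h1, h2⟩)).congr_deriv ?_)
  simp
  field_simp
  ring

lemma dg10 (k : Fin 2) (p : V2) : M.dg k 1 0 p = M.dg k 0 1 p := by
  unfold dg
  simp only [M.g10]

lemma dg11 (k : Fin 2) (p : V2) : M.dg k 1 1 p =
    (2 * M.fa p * pd k M.fa p + 2 * M.fb p * pd k M.fb p) / (M.fa p ^ 2 * M.fd p ^ 2) -
    2 * (M.fa p ^ 2 + M.fb p ^ 2) * pd k M.fa p / (M.fa p ^ 3 * M.fd p ^ 2) -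
    2 * (M.fa p ^ 2 + M.fb p ^ 2) * pd k M.fd p / (M.fa p ^ 2 * M.fd p ^ 3) := by
  have h1 := (M.fa_pos p).ne'
  have h2 := (M.fd_pos p).ne'
  have ha := hasDerivAt_pd_line (M.contDiff_fa.differentiable (by simp) p) k
  have hb := hasDerivAt_pd_line (M.contDiff_fb.differentiable (by simp) p) k
  have hd := hasDerivAt_pd_line (M.contDiff_fd.differentiable (by simp) p) k
  refine M.dg_eq_of M.g11_eq ((((ha.pow 2).add (hb.pow 2)).div ((ha.pow 2).mul (hd.pow 2))
    (by simpa using ⟨h1, h2⟩)).congr_deriv ?_)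
  simp
  field_simp
  ring

/-- Coordinates of the connection form. -/
def w0 (p : V2) : ℝ := M.c1 p / M.fa p
/-- Coordinates of the connection form. -/
def w1 (p : V2) : ℝ := (M.c2 p - M.fb p * M.w0 p) / M.fd p

/-- The frame as a matrix: `fr k a` is the `k`-th coordinate of the `a`-th frame vector. -/
def fr (k a : Fin 2) (p : V2) : ℝ := !![M.fa p, M.fb p; 0, M.fd p] k a

/-- The coordinates of the connection form. -/
def wf (i : Fin 2) (p : V2) : ℝ := ![M.w0 p, M.w1 p] i

lemma pd_zero (i : Fin 2) (p : V2) : pd i (fun _ => (0 : ℝ)) p = 0 := by simp [pd]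

lemma structure_one (i k : Fin 2) (p : V2) :
    pd i (M.fr k 0) p + ∑ m, M.Γ k i m p * M.fr m 0 p = M.wf i p * M.fr k 1 p := by
  have h1 := (M.fa_pos p).ne'
  have h2 := (M.fd_pos p).ne'
  have e1 : M.fr 0 0 = M.fa := rfl
  have e2 : M.fr 1 0 = fun _ => 0 := rfl
  have e3 : M.fr 0 1 = M.fb := rfl
  have e4 : M.fr 1 1 = M.fd := rfl
  fin_cases i <;> fin_cases k <;>
    simp [Fin.sum_univ_two, e1, e2, e3, e4, wf, w0, w1, c1, c2, Γ, M.inv_eq, M.dg10, M.dg00, M.dg01,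
      M.dg11, pd_zero] <;>
    field_simp <;> ring

lemma structure_two (i k : Fin 2) (p : V2) :
    pd i (M.fr k 1) p + ∑ m, M.Γ k i m p * M.fr m 1 p = -(M.wf i p * M.fr k 0 p) := by
  have h1 := (M.fa_pos p).ne'
  have h2 := (M.fd_pos p).ne'
  have e1 : M.fr 0 0 = M.fa := rfl
  have e2 : M.fr 1 0 = fun _ => 0 := rfl
  have e3 : M.fr 0 1 = M.fb := rfl
  have e4 : M.fr 1 1 = M.fd := rfl
  fin_cases i <;> fin_cases k <;>
    simp [Fin.sum_univ_two, e1, e2, e3, e4, wf, w0, w1, c1, c2, Γ, M.inv_eq, M.dg10, M.dg00, M.dg01,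
      M.dg11] <;>
    field_simp <;> ring

lemma contDiff_fr (k a : Fin 2) : ContDiff ℝ ∞ (M.fr k a) := by
  fin_cases k <;> fin_cases a
  · exact M.contDiff_fa
  · exact M.contDiff_fb
  · exact contDiff_const
  · exact M.contDiff_fd

lemma contDiff_w0 : ContDiff ℝ ∞ M.w0 := M.contDiff_c1.div M.contDiff_fa fun p => (M.fa_pos p).ne'

lemma contDiff_w1 : ContDiff ℝ ∞ M.w1 :=
  (M.contDiff_c2.sub (M.contDiff_fb.mul M.contDiff_w0)).div M.contDiff_fd fun p => (M.fd_pos p).ne'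

lemma contDiff_wf (i : Fin 2) : ContDiff ℝ ∞ (M.wf i) := by
  fin_cases i
  · exact M.contDiff_w0
  · exact M.contDiff_w1

lemma dg_eq_pd (k i j : Fin 2) : M.dg k i j = pd k fun p => M.g p i j :=
  funext fun p => (hasDerivAt_pd_line ((M.smooth i j).differentiable (by simp) p) k).deriv

lemma contDiff_inv (i j : Fin 2) : ContDiff ℝ ∞ fun p => (M.g p)⁻¹ i j := by
  have ha := M.contDiff_fa
  have hb := M.contDiff_fb
  have hd := M.contDiff_fd
  simp only [M.inv_eq]
  fin_cases i <;> fin_cases j <;> simp <;> fun_prop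

lemma contDiff_Γ (k i j : Fin 2) : ContDiff ℝ ∞ (M.Γ k i j) := by
  have h1 : ∀ k i j, ContDiff ℝ ∞ (M.dg k i j) := fun k i j => by
    rw [dg_eq_pd]
    exact contDiff_pd (M.smooth i j) k
  exact contDiff_const.mul (ContDiff.sum fun l _ =>
    (M.contDiff_inv k l).mul (((h1 _ _ _).add (h1 _ _ _)).sub (h1 _ _ _)))

lemma dΓ_eq_pd (d k i j : Fin 2) (p : V2) : M.dΓ d k i j p = pd d (M.Γ k i j) p :=
  (hasDerivAt_pd_line ((M.contDiff_Γ k i j).differentiable (by simp) p) d).deriv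

/-- Curvature operator of the first two coordinate directions. -/
def curvOp (l m : Fin 2) (p : V2) : ℝ := M.dΓ 0 l 1 m p - M.dΓ 1 l 0 m p +
  ∑ n, (M.Γ l 0 n p * M.Γ n 1 m p - M.Γ l 1 n p * M.Γ n 0 m p)

lemma pd_eq_of_line {f : V2 → ℝ} {p : V2} {i : Fin 2} {c : ℝ} (hf : DifferentiableAt ℝ f p)
    (h : HasDerivAt (fun s : ℝ => f (p + s • (Pi.single i 1 : V2))) c 0) : pd i f p = c :=
  (hasDerivAt_pd_line hf i).unique h

lemma pd_structure {F G : V2 → ℝ} {A B : V2 → ℝ} {C D : V2 → ℝ} (hF : ContDiff ℝ ∞ F)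
    (hG : ContDiff ℝ ∞ G) (hA : ContDiff ℝ ∞ A) (hB : ContDiff ℝ ∞ B) (hC : ContDiff ℝ ∞ C)
    (hD : ContDiff ℝ ∞ D) {U : V2 → ℝ} (hU : ContDiff ℝ ∞ U)
    (i j : Fin 2) (h : ∀ p, pd i U p = F p * G p - (A p * B p + C p * D p)) (p : V2) :
    pd j (pd i U) p = pd j F p * G p + F p * pd j G p - (pd j A p * B p + A p * pd j B p +
      (pd j C p * D p + C p * pd j D p)) := by
  refine pd_eq_of_line ((contDiff_pd hU i).differentiable (by simp) p) ?_
  have L : ∀ {f : V2 → ℝ}, ContDiff ℝ ∞ f →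
      HasDerivAt (fun s : ℝ => f (p + s • (Pi.single j 1 : V2))) (pd j f p) 0 := fun hf =>
    hasDerivAt_pd_line (hf.differentiable (by simp) p) j
  simp only [h]
  exact (((L hF).mul (L hG)).sub (((L hA).mul (L hB)).add ((L hC).mul (L hD)))).congr_deriv
    (by simp)

lemma curv_one (k : Fin 2) (p : V2) :
    (pd 0 (M.wf 1) p - pd 1 (M.wf 0) p) * M.fr k 1 p = ∑ m, M.curvOp k m p * M.fr m 0 p := by
  have s1 : ∀ i k p, pd i (M.fr k 0) p = M.wf i p * M.fr k 1 p -
      (M.Γ k i 0 p * M.fr 0 0 p + M.Γ k i 1 p * M.fr 1 0 p) := fun i k p => by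
    have := M.structure_one i k p
    rw [Fin.sum_univ_two] at this
    linarith
  have s2 : ∀ i k p, pd i (M.fr k 1) p = -(M.wf i p * M.fr k 0 p) -
      (M.Γ k i 0 p * M.fr 0 1 p + M.Γ k i 1 p * M.fr 1 1 p) := fun i k p => by
    have := M.structure_two i k p
    rw [Fin.sum_univ_two] at this
    linarith
  have h := fun i j => pd_structure (M.contDiff_wf i) (M.contDiff_fr k 1) (M.contDiff_Γ k i 0)
    (M.contDiff_fr 0 0) (M.contDiff_Γ k i 1) (M.contDiff_fr 1 0)
    (M.contDiff_fr k 0) i j (s1 i k) p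
  have h01 := h 1 0
  have h10 := h 0 1
  rw [pd_comm (M.contDiff_fr k 0) 0 1 p, h10] at h01
  simp only [s1, s2] at h01
  simp only [curvOp, dΓ_eq_pd, Fin.sum_univ_two]
  linear_combination -h01

lemma curv_two (k : Fin 2) (p : V2) :
    -(pd 0 (M.wf 1) p - pd 1 (M.wf 0) p) * M.fr k 0 p = ∑ m, M.curvOp k m p * M.fr m 1 p := by
  have s1 : ∀ i k p, pd i (M.fr k 0) p = M.wf i p * M.fr k 1 p -
      (M.Γ k i 0 p * M.fr 0 0 p + M.Γ k i 1 p * M.fr 1 0 p) := fun i k p => by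
    have := M.structure_one i k p
    rw [Fin.sum_univ_two] at this
    linarith
  have s2 : ∀ i k p, pd i (M.fr k 1) p = -(M.wf i p * M.fr k 0 p) -
      (M.Γ k i 0 p * M.fr 0 1 p + M.Γ k i 1 p * M.fr 1 1 p) := fun i k p => by
    have := M.structure_two i k p
    rw [Fin.sum_univ_two] at this
    linarith
  have hneg : ∀ i, ContDiff ℝ ∞ fun p => -M.wf i p := fun i => (M.contDiff_wf i).neg
  have h := fun i j => pd_structure (hneg i) (M.contDiff_fr k 0) (M.contDiff_Γ k i 0)
    (M.contDiff_fr 0 1) (M.contDiff_Γ k i 1) (M.contDiff_fr 1 1)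
    (M.contDiff_fr k 1) i j
    (fun p => by rw [s2 i k p]; ring) p
  have hn : ∀ i j, pd j (fun p => -M.wf i p) p = -pd j (M.wf i) p := fun i j => by
    simp [pd, fderiv_fun_neg]
  have h01 := h 1 0
  have h10 := h 0 1
  rw [pd_comm (M.contDiff_fr k 1) 0 1 p, h10] at h01
  simp only [s1, s2, hn] at h01
  simp only [curvOp, dΓ_eq_pd, Fin.sum_univ_two]
  linear_combination -h01

/-- Second structure equation. -/
lemma structure_curv (p : V2) : pd 0 (M.wf 1) p - pd 1 (M.wf 0) p = -(M.K p * M.rho p) := by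
  have h1 := (M.fa_pos p).ne'
  have h2 := (M.fd_pos p).ne'
  have hK : M.K p = (∑ l, M.g p 0 l * M.curvOp l 1 p) / (M.g p).det := rfl
  have hdet : (M.g p).det = M.rho p ^ 2 := (Real.sq_sqrt (M.det_pos p).le).symm
  have e1 : M.fr 0 0 = M.fa := rfl
  have e2 : M.fr 1 0 = fun _ => 0 := rfl
  have e3 : M.fr 0 1 = M.fb := rfl
  have e4 : M.fr 1 1 = M.fd := rfl
  have a0 := M.curv_one 0 p
  have a1 := M.curv_one 1 p
  have b0 := M.curv_two 0 p
  have b1 := M.curv_two 1 p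
  simp only [Fin.sum_univ_two, e1, e2, e3, e4, mul_zero, add_zero] at a0 a1 b0 b1
  set Ω := pd 0 (M.wf 1) p - pd 1 (M.wf 0) p
  have r00 : M.curvOp 0 0 p = Ω * M.fb p / M.fa p := by rw [eq_div_iff h1]; linarith
  have r10 : M.curvOp 1 0 p = Ω * M.fd p / M.fa p := by rw [eq_div_iff h1]; linarith
  have r01 : M.curvOp 0 1 p = (-Ω * M.fa p - M.curvOp 0 0 p * M.fb p) / M.fd p := by
    rw [eq_div_iff h2]; linarith
  have r11 : M.curvOp 1 1 p = (- M.curvOp 1 0 p * M.fb p) / M.fd p := by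
    rw [eq_div_iff h2]; linarith
  rw [hK, Fin.sum_univ_two, r11, r01, r00, r10, M.g00_eq, M.g01_eq, hdet, M.rho_eq]
  field_simp
  ring

/-- Second structure equation, in the frame. -/
lemma structure_curv_frame (p : V2) :
    M.fa p * pd 0 M.c2 p - (M.fb p * pd 0 M.c1 p + M.fd p * pd 1 M.c1 p) + M.c1 p ^ 2 + M.c2 p ^ 2
      = -M.K p := by
  have h1 := (M.fa_pos p).ne'
  have h2 := (M.fd_pos p).ne'
  have L : ∀ {f : V2 → ℝ} (j : Fin 2), ContDiff ℝ ∞ f →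
      HasDerivAt (fun s : ℝ => f (p + s • (Pi.single j 1 : V2))) (pd j f p) 0 := fun j hf =>
    hasDerivAt_pd_line (hf.differentiable (by simp) p) j
  have hd : ∀ {f : V2 → ℝ}, ContDiff ℝ ∞ f → DifferentiableAt ℝ f p := fun hf =>
    hf.differentiable (by simp) p
  have e1 : ∀ j, pd j M.c1 p = pd j M.w0 p * M.fa p + M.w0 p * pd j M.fa p := fun j => by
    refine pd_eq_of_line (hd M.contDiff_c1) ?_
    have : ∀ q, M.c1 q = M.w0 q * M.fa q := fun q => by
      rw [w0, div_mul_cancel₀ _ (M.fa_pos q).ne']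
    simp only [this]
    exact ((L j M.contDiff_w0).mul (L j M.contDiff_fa)).congr_deriv (by simp)
  have hc2 : ∀ q, M.c2 q = M.w1 q * M.fd q + M.fb q * M.w0 q := fun q => by
    rw [w1, div_mul_cancel₀ _ (M.fd_pos q).ne']; ring
  have e2 : ∀ j, pd j M.c2 p = pd j M.w1 p * M.fd p + M.w1 p * pd j M.fd p +
      (pd j M.fb p * M.w0 p + M.fb p * pd j M.w0 p) := fun j => by
    refine pd_eq_of_line (hd M.contDiff_c2) ?_
    simp only [hc2]
    exact (((L j M.contDiff_w1).mul (L j M.contDiff_fd)).add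
      ((L j M.contDiff_fb).mul (L j M.contDiff_w0))).congr_deriv (by simp)
  have hC := M.structure_curv p
  have f0 : M.wf 0 = M.w0 := rfl
  have f1 : M.wf 1 = M.w1 := rfl
  rw [f0, f1, M.rho_eq] at hC
  have hK : M.K p = -(pd 0 M.w1 p - pd 1 M.w0 p) * (M.fa p * M.fd p) := by
    rw [hC]; field_simp
  have t2 : M.c2 p * M.fd p = -(M.fa p * pd 0 M.fd p) := by
    rw [c2, div_mul_cancel₀ _ h2]
  have t1 : M.c1 p * M.fa p + M.c2 p * M.fb p = -(M.fa p * pd 0 M.fb p - M.fb p * pd 0 M.fa p -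
      M.fd p * pd 1 M.fa p) := by
    rw [c1, c2]; field_simp; ring
  have hw0 : M.w0 p * M.fa p = M.c1 p := by rw [w0, div_mul_cancel₀ _ h1]
  have hw1 := hc2 p
  rw [hK, e2, e1, e1]
  linear_combination M.w1 p * t2 + M.w0 p * t1 + M.c2 p * hw1 - M.c1 p * hw0

lemma torsion_zero (p : V2) : M.fa p * pd 0 M.fb p - M.fb p * pd 0 M.fa p - M.fd p * pd 1 M.fa p =
    -(M.c1 p * M.fa p + M.c2 p * M.fb p) := by
  have h1 := (M.fa_pos p).ne'
  have h2 := (M.fd_pos p).ne'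
  rw [c1, c2]; field_simp; ring

lemma torsion_one (p : V2) : M.fa p * pd 0 M.fd p = -(M.c2 p * M.fd p) := by
  rw [c2, div_mul_cancel₀ _ (M.fd_pos p).ne', neg_neg]

lemma continuous_K : Continuous M.K := by
  have : M.K = fun p => -(M.fa p * pd 0 M.c2 p - (M.fb p * pd 0 M.c1 p + M.fd p * pd 1 M.c1 p) +
      M.c1 p ^ 2 + M.c2 p ^ 2) := funext fun p => by rw [M.structure_curv_frame]; ring
  rw [this]
  have := M.contDiff_fa.continuous
  have := M.contDiff_fb.continuous
  have := M.contDiff_fd.continuous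
  have := M.contDiff_c1.continuous
  have := M.contDiff_c2.continuous
  have := (contDiff_pd M.contDiff_c2 0).continuous
  have := (contDiff_pd M.contDiff_c1 0).continuous
  have := (contDiff_pd M.contDiff_c1 1).continuous
  fun_prop

lemma contDiff_K : ContDiff ℝ ∞ M.K := by
  have : M.K = fun p => -(M.fa p * pd 0 M.c2 p - (M.fb p * pd 0 M.c1 p + M.fd p * pd 1 M.c1 p) +
      M.c1 p ^ 2 + M.c2 p ^ 2) := funext fun p => by rw [M.structure_curv_frame]; ring
  rw [this]
  have := M.contDiff_fa
  have := M.contDiff_fb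
  have := M.contDiff_fd
  have := M.contDiff_c1
  have := M.contDiff_c2
  have := contDiff_pd M.contDiff_c2 0
  have := contDiff_pd M.contDiff_c1 0
  have := contDiff_pd M.contDiff_c1 1
  fun_prop

end RMetric

/-- Rotation by a right angle in frame coordinates. -/
def rot (v : V2) : V2 := ![-v 1, v 0]

/-- Squared Euclidean norm. -/
def nsq (v : V2) : ℝ := v 0 ^ 2 + v 1 ^ 2

@[simp] lemma rot_zero_apply (v : V2) : rot v 0 = -v 1 := rfl
@[simp] lemma rot_one_apply (v : V2) : rot v 1 = v 0 := rfl

lemma nsq_nonneg (v : V2) : 0 ≤ nsq v := by unfold nsq; positivity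

lemma nsq_eq_zero {v : V2} : nsq v = 0 ↔ v = 0 := by
  unfold nsq
  constructor
  · intro h
    ext i
    fin_cases i
    · simp; nlinarith [sq_nonneg (v 0), sq_nonneg (v 1)]
    · simp; nlinarith [sq_nonneg (v 0), sq_nonneg (v 1)]
  · rintro rfl; simp

lemma nsq_pos {v : V2} (h : v ≠ 0) : 0 < nsq v :=
  (nsq_nonneg v).lt_of_ne fun h0 => h (nsq_eq_zero.1 h0.symm)

lemma nsq_smul (c : ℝ) (v : V2) : nsq (c • v) = c ^ 2 * nsq v := by simp [nsq]; ring

@[fun_prop] lemma contDiff_nsq : ContDiff ℝ ∞ nsq := by unfold nsq; fun_prop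

@[fun_prop] lemma continuous_nsq : Continuous nsq := contDiff_nsq.continuous

lemma hasDerivAt_vec2 {f : ℝ → V2} {f' : V2} {t : ℝ} (h0 : HasDerivAt (fun s => f s 0) (f' 0) t)
    (h1 : HasDerivAt (fun s => f s 1) (f' 1) t) : HasDerivAt f f' t := by
  rw [hasDerivAt_pi]
  intro i
  fin_cases i
  · exact h0
  · exact h1

lemma HasDerivAt.coord {f : ℝ → V2} {f' : V2} {t : ℝ} (h : HasDerivAt f f' t) (i : Fin 2) :
    HasDerivAt (fun s => f s i) (f' i) t := (hasDerivAt_pi.1 h) i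

lemma contDiff_vec2 {E : Type*} [NormedAddCommGroup E] [NormedSpace ℝ E] {n : WithTop ℕ∞}
    {f : E → V2} (h0 : ContDiff ℝ n fun s => f s 0) (h1 : ContDiff ℝ n fun s => f s 1) :
    ContDiff ℝ n f := by
  rw [contDiff_pi]
  intro i
  fin_cases i
  · exact h0
  · exact h1

lemma HasDerivAt.rot {v : ℝ → V2} {v' : V2} {t : ℝ} (hv : HasDerivAt v v' t) :
    HasDerivAt (fun s => rot (v s)) (rot v') t :=
  hasDerivAt_vec2 (hv.coord 1).neg (hv.coord 0)

@[fun_prop] lemma contDiff_rot : ContDiff ℝ ∞ rot :=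
  contDiff_vec2 (f := rot) (by simp only [rot_zero_apply]; fun_prop)
    (by simp only [rot_one_apply]; fun_prop)

namespace RMetric

variable (M : RMetric)

/-- The tangent vector with frame components `w`. -/
def ev (x w : V2) : V2 := ![w 0 * M.fa x + w 1 * M.fb x, w 1 * M.fd x]

/-- Value of the connection form (up to sign) on the vector with frame components `w`. -/
def cf (x w : V2) : ℝ := -(M.c1 x * w 0 + M.c2 x * w 1)

/-- Horizontal lift of the vector with frame components `w`. -/
def fld (x v w : V2) : V2 × V2 := (M.ev x w, M.cf x w • rot v)

/-- The geodesic spray in frame coordinates. -/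
def spray (y : V2 × V2) : V2 × V2 := M.fld y.1 y.2 y.2

/-- The horizontal normal field. -/
def horiz (y : V2 × V2) : V2 × V2 := M.fld y.1 y.2 (rot y.2)

/-- The vertical rotation field. -/
def vert (y : V2 × V2) : V2 × V2 := ((0 : V2), rot y.2)

lemma met_ev (x v w : V2) : M.met x (M.ev x v) (M.ev x w) = v 0 * w 0 + v 1 * w 1 := by
  have h1 := (M.fa_pos x).ne'
  have h2 := (M.fd_pos x).ne'
  simp [met, ev, Fin.sum_univ_two, M.g10, M.g00_eq, M.g01_eq, M.g11_eq]
  field_simp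
  ring

lemma met_ev_self (x w : V2) : M.met x (M.ev x w) (M.ev x w) = nsq w := by
  rw [met_ev, nsq]; ring

lemma ev_surj (x u : V2) : ∃ w, M.ev x w = u := by
  have h1 := (M.fa_pos x).ne'
  have h2 := (M.fd_pos x).ne'
  refine ⟨![(u 0 - u 1 / M.fd x * M.fb x) / M.fa x, u 1 / M.fd x], ?_⟩
  ext i
  fin_cases i
  · simp [ev]; field_simp; ring
  · simp [ev]; field_simp

lemma met_nonneg (x u : V2) : 0 ≤ M.met x u u := by
  obtain ⟨w, rfl⟩ := M.ev_surj x u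
  rw [met_ev_self]
  exact nsq_nonneg w

lemma ev_inj {x w : V2} (h : M.ev x w = 0) : w = 0 := by
  have := M.met_ev_self x w
  rw [h] at this
  rw [← nsq_eq_zero, ← this]
  simp [met]

lemma ev_add (x w w' : V2) : M.ev x (w + w') = M.ev x w + M.ev x w' := by
  ext i; fin_cases i <;> simp [ev] <;> ring

lemma ev_smul (x w : V2) (c : ℝ) : M.ev x (c • w) = c • M.ev x w := by
  ext i; fin_cases i <;> simp [ev] <;> ring

lemma cf_add (x w w' : V2) : M.cf x (w + w') = M.cf x w + M.cf x w' := by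
  simp [cf]; ring

lemma cf_smul (x w : V2) (c : ℝ) : M.cf x (c • w) = c * M.cf x w := by
  simp [cf]; ring

lemma contDiff_ev : ContDiff ℝ ∞ fun q : V2 × V2 => M.ev q.1 q.2 := by
  have := M.contDiff_fa
  have := M.contDiff_fb
  have := M.contDiff_fd
  refine contDiff_vec2 ?_ ?_
  · change ContDiff ℝ ∞ fun q : V2 × V2 => q.2 0 * M.fa q.1 + q.2 1 * M.fb q.1
    fun_prop
  · change ContDiff ℝ ∞ fun q : V2 × V2 => q.2 1 * M.fd q.1
    fun_prop

lemma contDiff_cf : ContDiff ℝ ∞ fun q : V2 × V2 => M.cf q.1 q.2 := by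
  have := M.contDiff_c1
  have := M.contDiff_c2
  unfold cf
  fun_prop

lemma contDiff_spray : ContDiff ℝ ∞ M.spray :=
  M.contDiff_ev.prodMk (M.contDiff_cf.smul (contDiff_rot.comp contDiff_snd))

lemma hasDerivAt_ev {x w : ℝ → V2} {x' w' : V2} {t : ℝ} (hx : HasDerivAt x x' t)
    (hw : HasDerivAt w w' t) : HasDerivAt (fun s => M.ev (x s) (w s))
      (M.ev (x t) w' + ![w t 0 * (x' 0 * pd 0 M.fa (x t) + x' 1 * pd 1 M.fa (x t)) +
        w t 1 * (x' 0 * pd 0 M.fb (x t) + x' 1 * pd 1 M.fb (x t)),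
        w t 1 * (x' 0 * pd 0 M.fd (x t) + x' 1 * pd 1 M.fd (x t))]) t := by
  have ha := hasDerivAt_comp_pd (M.contDiff_fa.differentiable (by simp) (x t)) hx
  have hb := hasDerivAt_comp_pd (M.contDiff_fb.differentiable (by simp) (x t)) hx
  have hd := hasDerivAt_comp_pd (M.contDiff_fd.differentiable (by simp) (x t)) hx
  refine hasDerivAt_vec2 ?_ ?_
  · refine (((hw.coord 0).mul ha).add ((hw.coord 1).mul hb)).congr_deriv ?_
    simp [ev]; ring
  · refine ((hw.coord 1).mul hd).congr_deriv ?_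
    simp [ev]

lemma hasDerivAt_cf {x w : ℝ → V2} {x' w' : V2} {t : ℝ} (hx : HasDerivAt x x' t)
    (hw : HasDerivAt w w' t) : HasDerivAt (fun s => M.cf (x s) (w s))
      (M.cf (x t) w' - ((x' 0 * pd 0 M.c1 (x t) + x' 1 * pd 1 M.c1 (x t)) * w t 0 +
        (x' 0 * pd 0 M.c2 (x t) + x' 1 * pd 1 M.c2 (x t)) * w t 1)) t := by
  have ha := hasDerivAt_comp_pd (M.contDiff_c1.differentiable (by simp) (x t)) hx
  have hb := hasDerivAt_comp_pd (M.contDiff_c2.differentiable (by simp) (x t)) hx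
  refine ((ha.mul (hw.coord 0)).add (hb.mul (hw.coord 1))).neg.congr_deriv ?_
  simp [cf]; ring

/-- Derivative of `fld` along curves. -/
lemma hasDerivAt_fld {x v w : ℝ → V2} {x' v' w' : V2} {t : ℝ} (hx : HasDerivAt x x' t)
    (hv : HasDerivAt v v' t) (hw : HasDerivAt w w' t) :
    HasDerivAt (fun s => M.fld (x s) (v s) (w s))
      (M.ev (x t) w' + ![w t 0 * (x' 0 * pd 0 M.fa (x t) + x' 1 * pd 1 M.fa (x t)) +
        w t 1 * (x' 0 * pd 0 M.fb (x t) + x' 1 * pd 1 M.fb (x t)),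
        w t 1 * (x' 0 * pd 0 M.fd (x t) + x' 1 * pd 1 M.fd (x t))],
      (M.cf (x t) w' - ((x' 0 * pd 0 M.c1 (x t) + x' 1 * pd 1 M.c1 (x t)) * w t 0 +
        (x' 0 * pd 0 M.c2 (x t) + x' 1 * pd 1 M.c2 (x t)) * w t 1)) • rot (v t) +
        M.cf (x t) (w t) • rot v') t := by
  refine (M.hasDerivAt_ev hx hw).prodMk (((M.hasDerivAt_cf hx hw).smul hv.rot).congr_deriv ?_)
  exact add_comm _ _

lemma fderiv_spray (y u : V2 × V2) : fderiv ℝ M.spray y u =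
      (M.ev y.1 u.2 + ![y.2 0 * (u.1 0 * pd 0 M.fa y.1 + u.1 1 * pd 1 M.fa y.1) +
        y.2 1 * (u.1 0 * pd 0 M.fb y.1 + u.1 1 * pd 1 M.fb y.1),
        y.2 1 * (u.1 0 * pd 0 M.fd y.1 + u.1 1 * pd 1 M.fd y.1)],
      (M.cf y.1 u.2 - ((u.1 0 * pd 0 M.c1 y.1 + u.1 1 * pd 1 M.c1 y.1) * y.2 0 +
        (u.1 0 * pd 0 M.c2 y.1 + u.1 1 * pd 1 M.c2 y.1) * y.2 1)) • rot y.2 +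
        M.cf y.1 y.2 • rot u.2) := by
  have hl : HasDerivAt (fun s : ℝ => y + s • u) u 0 := by
    simpa using ((hasDerivAt_id (0 : ℝ)).smul_const u).const_add y
  have h1 := M.hasDerivAt_fld hl.fst_comp hl.snd_comp hl.snd_comp
  have h2 := ((M.contDiff_spray.differentiable (by simp)) (y + (0 : ℝ) • u)).hasFDerivAt.comp_hasDerivAt
    0 hl
  have := h2.unique h1
  simpa using this

variable {M} {y : ℝ → V2 × V2} {t : ℝ}

lemma hasDerivAt_vert (h : HasDerivAt y (M.spray (y t)) t) :
    HasDerivAt (fun s => vert (y s)) (fderiv ℝ M.spray (y t) (vert (y t)) - M.horiz (y t)) t := by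
  refine ((hasDerivAt_const t (0 : V2)).prodMk h.snd_comp.rot).congr_deriv ?_
  rw [fderiv_spray]
  ext i
  · fin_cases i <;> simp [vert, horiz, fld, ev]
  · fin_cases i <;> simp [vert, horiz, fld, cf, spray]

lemma hasDerivAt_horiz (h : HasDerivAt y (M.spray (y t)) t) :
    HasDerivAt (fun s => M.horiz (y s)) (fderiv ℝ M.spray (y t) (M.horiz (y t)) +
      (M.K (y t).1 * nsq (y t).2) • vert (y t)) t := by
  refine (M.hasDerivAt_fld h.fst_comp h.snd_comp h.snd_comp.rot).congr_deriv ?_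
  rw [fderiv_spray]
  generalize y t = z
  obtain ⟨x, v⟩ := z
  have t0 := M.torsion_zero x
  have t1 := M.torsion_one x
  have hK : M.K x = -(M.fa x * pd 0 M.c2 x - (M.fb x * pd 0 M.c1 x + M.fd x * pd 1 M.c1 x) +
    M.c1 x ^ 2 + M.c2 x ^ 2) := by rw [M.structure_curv_frame]; ring
  ext i
  · fin_cases i
    · simp [vert, horiz, fld, cf, spray, ev]
      linear_combination (v 0 ^ 2 + v 1 ^ 2) * t0
    · simp [vert, horiz, fld, cf, spray, ev]
      linear_combination (v 0 ^ 2 + v 1 ^ 2) * t1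
  · fin_cases i
    · simp [vert, horiz, fld, cf, spray, ev, hK, nsq]
      ring
    · simp [vert, horiz, fld, cf, spray, ev, hK, nsq]
      ring

/-- Jacobi fields solve the variational equation of the spray. -/
lemma hasDerivAt_jacobi (h : HasDerivAt y (M.spray (y t)) t) {j k : ℝ → ℝ}
    (hj : HasDerivAt j (k t) t)
    (hk : HasDerivAt k (-(nsq (y t).2 * M.K (y t).1) * j t) t) :
    HasDerivAt (fun s => j s • M.horiz (y s) + k s • vert (y s))
      (fderiv ℝ M.spray (y t) (j t • M.horiz (y t) + k t • vert (y t))) t := by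
  refine ((hj.smul (hasDerivAt_horiz h)).add (hk.smul (hasDerivAt_vert h))).congr_deriv ?_
  rw [map_add, map_smul, map_smul]
  module

lemma hasDerivAt_spray (h : HasDerivAt y (M.spray (y t)) t) :
    HasDerivAt (fun s => M.spray (y s)) (fderiv ℝ M.spray (y t) (M.spray (y t))) t :=
  ((M.contDiff_spray.differentiable (by simp)) (y t)).hasFDerivAt.comp_hasDerivAt t h

/-- The variation field of scaling the initial velocity. -/
lemma hasDerivAt_scaling (h : HasDerivAt y (M.spray (y t)) t) :
    HasDerivAt (fun s => ((0 : V2), (y s).2) + s • M.spray (y s))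
      (fderiv ℝ M.spray (y t) (((0 : V2), (y t).2) + t • M.spray (y t))) t := by
  refine (((hasDerivAt_const t (0 : V2)).prodMk h.snd_comp).add
    ((hasDerivAt_id t).smul (hasDerivAt_spray h))).congr_deriv ?_
  rw [map_add, map_smul]
  have : fderiv ℝ M.spray (y t) ((0 : V2), (y t).2) = ((0 : V2), (M.spray (y t)).2) + M.spray (y t) := by
    rw [fderiv_spray]
    ext i
    · fin_cases i <;> simp [spray, fld, ev]
    · fin_cases i <;> simp [spray, fld, cf]
  rw [this]
  simp
  abel

lemma hasDerivAt_nsq (h : HasDerivAt y (M.spray (y t)) t) :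
    HasDerivAt (fun s => nsq (y s).2) 0 t := by
  refine (((h.snd_comp.coord 0).pow 2).add ((h.snd_comp.coord 1).pow 2)).congr_deriv ?_
  simp [spray, fld]
  ring

end RMetric

lemma vel_eq {γ : ℝ → V2} {γ' : V2} {t : ℝ} (h : HasDerivAt γ γ' t) : vel γ t = γ' := by
  ext i
  exact (h.coord i).deriv

lemma hasDerivAt_vel {γ : ℝ → V2} (h : ContDiff ℝ 1 γ) (t : ℝ) : HasDerivAt γ (vel γ t) t := by
  have := (h.differentiable (by simp) t).hasDerivAt
  rwa [vel_eq this]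

lemma continuous_vel {γ : ℝ → V2} (h : ContDiff ℝ 1 γ) : Continuous (vel γ) := by
  have : vel γ = deriv γ := by
    ext t : 1
    exact vel_eq (h.differentiable (by simp) t).hasDerivAt
  rw [this]
  exact h.continuous_deriv (by simp)

namespace RMetric

variable {M : RMetric}

lemma ev_apply (x w : V2) (k : Fin 2) :
    M.ev x w k = w 0 * M.fr k 0 x + w 1 * M.fr k 1 x := by
  fin_cases k <;> simp [ev, fr]

lemma cf_eq (x w : V2) : M.cf x w = -∑ i, M.wf i x * M.ev x w i := by
  have h1 := (M.fa_pos x).ne'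
  have h2 := (M.fd_pos x).ne'
  simp [cf, ev, wf, w0, w1, Fin.sum_univ_two]
  field_simp
  ring

lemma continuous_ev_apply {X : Type*} [TopologicalSpace X] {x w : X → V2} (hx : Continuous x)
    (hw : Continuous w) : Continuous fun s => M.ev (x s) (w s) :=
  M.contDiff_ev.continuous.comp (hx.prodMk hw)

/-- Projections of integral curves of the spray are geodesics. -/
lemma isGeodesic_of_spray {y : ℝ → V2 × V2} (h : ∀ t, HasDerivAt y (M.spray (y t)) t) :
    M.IsGeodesic fun t => (y t).1 := by
  have hv : vel (fun t => (y t).1) = fun t => M.ev (y t).1 (y t).2 := by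
    ext t : 1
    exact vel_eq (h t).fst_comp
  constructor
  · have h1 : ContDiff ℝ 1 y := by
      rw [contDiff_one_iff_deriv]
      have : deriv y = fun t => M.spray (y t) := funext fun t => (h t).deriv
      refine ⟨fun t => (h t).differentiableAt, ?_⟩
      rw [this]
      exact M.contDiff_spray.continuous.comp (continuous_iff_continuousAt.2 fun t =>
        (h t).continuousAt)
    have h2 : ContDiff ℝ 2 y := by
      rw [show (2 : WithTop ℕ∞) = 1 + 1 by norm_num, contDiff_succ_iff_deriv]
      have : deriv y = fun t => M.spray (y t) := funext fun t => (h t).deriv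
      refine ⟨fun t => (h t).differentiableAt, by simp, ?_⟩
      rw [this]
      exact (M.contDiff_spray.of_le (by exact_mod_cast le_top)).comp h1
    exact contDiff_fst.comp h2
  · intro t k
    have hx := (h t).fst_comp
    have hw := (h t).snd_comp
    have hD := ((hw.coord 0).mul (hasDerivAt_comp_pd
        ((M.contDiff_fr k 0).differentiable (by simp) _) hx)).add ((hw.coord 1).mul
        (hasDerivAt_comp_pd ((M.contDiff_fr k 1).differentiable (by simp) _) hx))
    have hacc : acc (fun t => (y t).1) t k = deriv (fun s => (y s).2 0 * M.fr k 0 (y s).1 +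
        (y s).2 1 * M.fr k 1 (y s).1) t := by
      unfold acc
      rw [hv]
      simp only [ev_apply]
    rw [show deriv (fun s => (y s).2 0 * M.fr k 0 (y s).1 +
        (y s).2 1 * M.fr k 1 (y s).1) t = _ from hD.deriv] at hacc
    rw [hacc, hv]
    have s1 := fun i => M.structure_one i k (y t).1
    have s2 := fun i => M.structure_two i k (y t).1
    simp only [Fin.sum_univ_two] at s1 s2 ⊢
    have hc := cf_eq (M := M) (y t).1 (y t).2
    rw [Fin.sum_univ_two] at hc
    have e0 : (M.spray (y t)).1 = M.ev (y t).1 (y t).2 := rfl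
    have e1 : (M.spray (y t)).2 0 = -(M.cf (y t).1 (y t).2 * (y t).2 1) := by
      simp [spray, fld]
    have e2 : (M.spray (y t)).2 1 = M.cf (y t).1 (y t).2 * (y t).2 0 := by
      simp [spray, fld]
    rw [e0, e1, e2, hc]
    have a1 := ev_apply (M := M) (y t).1 (y t).2 0
    have a2 := ev_apply (M := M) (y t).1 (y t).2 1
    generalize M.ev (y t).1 (y t).2 = u at *
    linear_combination (y t).2 0 * u 0 * s1 0 + (y t).2 0 * u 1 * s1 1 +
      (y t).2 1 * u 0 * s2 0 + (y t).2 1 * u 1 * s2 1 +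
      (u 0 * M.Γ k 0 0 (y t).1 + u 1 * M.Γ k 1 0 (y t).1) * a1 +
      (u 0 * M.Γ k 0 1 (y t).1 + u 1 * M.Γ k 1 1 (y t).1) * a2

lemma continuous_sqrt_met {γ : ℝ → V2} (hγ : ContDiff ℝ 1 γ) :
    Continuous fun t => √(M.met (γ t) (vel γ t) (vel γ t)) := by
  have hv := continuous_vel hγ
  have hc := hγ.continuous
  have : ∀ i j, Continuous fun t => M.g (γ t) i j := fun i j => (M.smooth i j).continuous.comp hc
  unfold met
  fun_prop

lemma curveLen_nonneg (γ : ℝ → V2) : 0 ≤ M.curveLen γ 0 1 :=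
  intervalIntegral.integral_nonneg zero_le_one fun _ _ => Real.sqrt_nonneg _

lemma dist_le_curveLen {γ : ℝ → V2} (hγ : ContDiff ℝ 1 γ) :
    M.dist (γ 0) (γ 1) ≤ M.curveLen γ 0 1 := by
  refine csInf_le ⟨0, ?_⟩ ⟨γ, hγ, rfl, rfl, rfl⟩
  rintro _ ⟨γ, -, -, -, rfl⟩
  exact curveLen_nonneg γ

lemma le_dist {p q : V2} {a : ℝ} (h : ∀ γ : ℝ → V2, ContDiff ℝ 1 γ → γ 0 = p → γ 1 = q →
    a ≤ M.curveLen γ 0 1) : a ≤ M.dist p q := by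
  refine le_csInf ⟨_, fun t => p + t • (q - p), by fun_prop, by simp, by simp, rfl⟩ ?_
  rintro _ ⟨γ, h1, h2, h3, rfl⟩
  exact h γ h1 h2 h3

/-- A function whose derivative along a curve is bounded by the speed changes at most by a
multiple of the length. -/
lemma sub_le_curveLen {γ : ℝ → V2} (hγ : ContDiff ℝ 1 γ) {f f' : ℝ → ℝ}
    (hf : ∀ t ∈ Icc (0 : ℝ) 1, HasDerivAt f (f' t) t) {C : ℝ}
    (hC : ∀ t ∈ Icc (0 : ℝ) 1, f' t ≤ C * √(M.met (γ t) (vel γ t) (vel γ t))) :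
    f 1 - f 0 ≤ C * M.curveLen γ 0 1 := by
  have hcont := continuous_sqrt_met (M := M) hγ
  have hI : ∀ t, HasDerivAt (fun s => C * ∫ r in (0 : ℝ)..s,
      √(M.met (γ r) (vel γ r) (vel γ r))) (C * √(M.met (γ t) (vel γ t) (vel γ t))) t := fun t =>
    (intervalIntegral.integral_hasDerivAt_right (hcont.intervalIntegrable _ _)
      (hcont.stronglyMeasurableAtFilter _ _) hcont.continuousAt).const_mul C
  have := image_le_of_deriv_right_le_deriv_boundary (f := fun t => f t - f 0) (f' := f')
    (a := 0) (b := 1) (fun t ht => ((hf t ht).sub_const _).continuousAt.continuousWithinAt)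
    (fun t ht => ((hf t (Ico_subset_Icc_self ht)).sub_const _).hasDerivWithinAt)
    (B := fun s => C * ∫ r in (0 : ℝ)..s, √(M.met (γ r) (vel γ r) (vel γ r)))
    (by simp) (fun t _ => (hI t).continuousAt.continuousWithinAt)
    (fun t _ => (hI t).hasDerivWithinAt) (fun t ht => hC t (Ico_subset_Icc_self ht))
    (right_mem_Icc.2 zero_le_one)
  exact this

lemma norm_le_sqrt_met (x u : V2) :
    ‖u‖ ≤ (|M.fa x| + |M.fb x| + |M.fd x|) * √(M.met x u u) := by
  obtain ⟨w, rfl⟩ := M.ev_surj x u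
  rw [met_ev_self]
  have h0 : |w 0| ≤ √(nsq w) := Real.abs_le_sqrt (by unfold nsq; nlinarith [sq_nonneg (w 1)])
  have h1 : |w 1| ≤ √(nsq w) := Real.abs_le_sqrt (by unfold nsq; nlinarith [sq_nonneg (w 0)])
  have ha := mul_le_mul_of_nonneg_left h0 (abs_nonneg (M.fa x))
  have hb := mul_le_mul_of_nonneg_left h1 (abs_nonneg (M.fb x))
  have hd := mul_le_mul_of_nonneg_left h1 (abs_nonneg (M.fd x))
  have hs := Real.sqrt_nonneg (nsq w)
  rw [pi_norm_le_iff_of_nonneg (by positivity)]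
  intro i
  fin_cases i
  · simp only [ev, Fin.zero_eta, Matrix.cons_val_zero, Real.norm_eq_abs]
    refine (abs_add_le _ _).trans ?_
    rw [abs_mul, abs_mul]
    nlinarith [mul_nonneg (abs_nonneg (M.fd x)) hs]
  · simp only [ev, Fin.mk_one, Matrix.cons_val_one, Matrix.cons_val_fin_one, Real.norm_eq_abs]
    rw [abs_mul]
    nlinarith [mul_nonneg (abs_nonneg (M.fa x)) hs, mul_nonneg (abs_nonneg (M.fb x)) hs]

/-- Points at small Riemannian distance from `p` lie in the unit ball around `p`. -/
lemma exists_dist_lt_imp (M : RMetric) (p : V2) :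
    ∃ δ > 0, ∀ q, M.dist q p < δ → ‖q - p‖ < 1 := by
  let f : ContDiffBump p := ⟨1 / 2, 1, by norm_num, by norm_num⟩
  have hf : ContDiff ℝ 1 f := f.contDiff
  have hcf := M.contDiff_fa.continuous
  have hcb := M.contDiff_fb.continuous
  have hcd := M.contDiff_fd.continuous
  have hdc : Continuous (fderiv ℝ f) := hf.continuous_fderiv (by simp)
  have hcs : HasCompactSupport fun x => ‖fderiv ℝ f x‖ * (|M.fa x| + |M.fb x| + |M.fd x|) :=
    ((f.hasCompactSupport.fderiv (𝕜 := ℝ)).norm).mul_right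
  obtain ⟨C, hC⟩ := hcs.exists_bound_of_continuous (by fun_prop)
  have hC0 : 0 ≤ C := (norm_nonneg _).trans (hC p)
  refine ⟨1 / (C + 1), by positivity, fun q hq => ?_⟩
  by_contra! hn
  refine absurd hq (not_lt.2 (le_dist fun γ hγ h0 h1 => ?_))
  have := sub_le_curveLen (M := M) hγ (f := fun t => f (γ t))
    (f' := fun t => fderiv ℝ f (γ t) (vel γ t)) (C := C + 1)
    (fun t _ => ((hf.differentiable (by simp)) (γ t)).hasFDerivAt.comp_hasDerivAt t
      (hasDerivAt_vel hγ t)) (fun t _ => ?_)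
  · rw [h0, h1, f.one_of_mem_closedBall (by simp; exact f.rIn_pos.le),
      f.zero_of_le_dist (by rw [dist_eq_norm]; exact hn)] at this
    rw [div_le_iff₀ (by positivity)]
    linarith
  · refine (le_abs_self _).trans (((fderiv ℝ f (γ t)).le_opNorm _).trans ?_)
    have h1 := mul_le_mul_of_nonneg_left (norm_le_sqrt_met (M := M) (γ t) (vel γ t))
      (norm_nonneg (fderiv ℝ f (γ t)))
    have h2 := (le_abs_self _).trans (hC (γ t))
    have h3 := Real.sqrt_nonneg (M.met (γ t) (vel γ t) (vel γ t))
    nlinarith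

lemma nsq_eqOn_Ioo {y : ℝ → V2 × V2} {T : ℝ} (hT : 0 < T)
    (hy : ∀ t ∈ Ioo (-T) T, HasDerivAt y (M.spray (y t)) t) :
    ∀ r ∈ Ioo (-T) T, nsq (y r).2 = nsq (y 0).2 := by
  intro r hr
  refine (convex_Ioo (-T) T).is_const_of_fderivWithin_eq_zero (𝕜 := ℝ)
    (f := fun r => nsq (y r).2)
    (fun z hz => (hasDerivAt_nsq (hy z hz)).differentiableAt.differentiableWithinAt)
    (fun z hz => ?_) hr ⟨by linarith, hT⟩
  rw [fderivWithin_of_isOpen isOpen_Ioo hz]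
  ext
  simpa using (hasDerivAt_nsq (hy z hz)).deriv

/-- Distance between points on a (local) geodesic. -/
lemma exists_dist_geodesic_le : ∃ c : ℝ, 0 ≤ c ∧ ∀ (M : RMetric) (y : ℝ → V2 × V2) (T : ℝ),
    0 < T → (∀ t ∈ Ioo (-T) T, HasDerivAt y (M.spray (y t)) t) → ∀ s ∈ Ioo (-T) T,
    ∀ t ∈ Ioo (-T) T, M.dist (y s).1 (y t).1 ≤ c * √(nsq (y 0).2) * |t - s| := by
  have hσ : ContDiff ℝ 1 Real.smoothTransition := Real.smoothTransition.contDiff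
  have hσ' : Continuous (deriv Real.smoothTransition) := hσ.continuous_deriv (by simp)
  refine ⟨∫ u in (0 : ℝ)..1, |deriv Real.smoothTransition u|,
    intervalIntegral.integral_nonneg zero_le_one fun _ _ => abs_nonneg _, ?_⟩
  intro M y T hT hy s hs t ht
  have hmem : ∀ u, s + (t - s) * Real.smoothTransition u ∈ Ioo (-T) T := by
    intro u
    have h0 := Real.smoothTransition.nonneg u
    have h1 := Real.smoothTransition.le_one u
    have := (convex_Ioo (-T) T).add_smul_sub_mem hs ht ⟨h0, h1⟩
    rwa [smul_eq_mul, mul_comm] at this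
  have hnsq := nsq_eqOn_Ioo hT hy
  let γ : ℝ → V2 := fun u => (y (s + (t - s) * Real.smoothTransition u)).1
  have hd : ∀ u, HasDerivAt γ (((t - s) * deriv Real.smoothTransition u) •
      M.ev (γ u) (y (s + (t - s) * Real.smoothTransition u)).2) u := by
    intro u
    have h1 := (((hσ.differentiable (by simp) u).hasDerivAt.const_mul (t - s)).const_add s)
    exact (HasDerivAt.scomp u (hy _ (hmem u)) h1).fst_comp
  have hcy : Continuous fun u => y (s + (t - s) * Real.smoothTransition u) :=
    continuous_iff_continuousAt.2 fun u => by
      have h1 : ContinuousAt (fun u => s + (t - s) * Real.smoothTransition u) u := by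
        have := hσ.continuous
        fun_prop
      exact ContinuousAt.comp (g := y) (hy _ (hmem u)).continuousAt h1
  have hγ : ContDiff ℝ 1 γ := by
    rw [contDiff_one_iff_deriv]
    refine ⟨fun u => (hd u).differentiableAt, ?_⟩
    rw [show deriv γ = _ from funext fun u => (hd u).deriv]
    exact (continuous_const.mul hσ').smul
      (continuous_ev_apply (continuous_fst.comp hcy) (continuous_snd.comp hcy))
  have hlen : M.curveLen γ 0 1 = ∫ u in (0 : ℝ)..1, |deriv Real.smoothTransition u| *
      (√(nsq (y 0).2) * |t - s|) := by
    unfold curveLen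
    congr 1
    ext u
    rw [vel_eq (hd u), ← ev_smul, met_ev_self, nsq_smul, hnsq _ (hmem u),
      Real.sqrt_mul (sq_nonneg _), Real.sqrt_sq_eq_abs, abs_mul]
    ring
  have := dist_le_curveLen (M := M) hγ
  rw [hlen, intervalIntegral.integral_mul_const] at this
  simp only [γ, Real.smoothTransition.zero, Real.smoothTransition.one, mul_zero, add_zero,
    mul_one, add_sub_cancel] at this
  linarith

/-- On a complete plane, the geodesic flow is complete. -/
theorem exists_geodesicFlow (hcomp : M.Complete) : ∃ Φ, IsFlow M.spray Φ := by
  refine exists_isFlow (M.contDiff_spray.of_le (by exact_mod_cast le_top)) ?_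
  intro y₀ T hT y h0 hy
  have hnsq := nsq_eqOn_Ioo hT hy
  obtain ⟨c, hc, hdist⟩ := exists_dist_geodesic_le
  have hx : ∃ R, ∀ t ∈ Ioo (-T) T, ‖(y t).1‖ ≤ R := by
    by_contra! hn
    choose τ hτ hτn using fun n : ℕ => hn n
    obtain ⟨a, -, φ, hφ, hlim⟩ := (isCompact_Icc (a := -T) (b := T)).tendsto_subseq
      (fun n => Ioo_subset_Icc_self (hτ n))
    obtain ⟨p, hp⟩ := hcomp (fun n => (y (τ (φ n))).1) (by
      intro ε hε
      obtain ⟨N, hN⟩ := Metric.cauchySeq_iff.1 hlim.cauchySeq (ε / (c * √(nsq (y 0).2) + 1))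
        (by positivity)
      refine ⟨N, fun m hm n hn => ?_⟩
      have h1 := hdist M y T hT hy _ (hτ (φ m)) _ (hτ (φ n))
      have h2 := hN n hn m hm
      rw [lt_div_iff₀ (by positivity)] at h2
      simp only [Real.dist_eq, Function.comp] at h2
      have := abs_nonneg (τ (φ n) - τ (φ m))
      nlinarith)
    obtain ⟨δ, hδ, hd⟩ := M.exists_dist_lt_imp p
    have h1 := hp.eventually_lt_const hδ
    obtain ⟨n, hn1, hn2⟩ := (h1.and (hφ.tendsto_atTop.eventually_ge_atTop
      ⌈‖p‖ + 1⌉₊)).exists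
    have h2 := hd _ hn1
    have h3 := hτn (φ n)
    have h4 : ‖p‖ + 1 ≤ (φ n : ℝ) := (Nat.le_ceil _).trans (by exact_mod_cast hn2)
    have h5 := norm_sub_norm_le (y (τ (φ n))).1 p
    linarith
  obtain ⟨R, hR⟩ := hx
  refine isBounded_iff_forall_norm_le.2 ⟨max R √(nsq (y 0).2), ?_⟩
  rintro _ ⟨t, ht, rfl⟩
  refine max_le_max (hR t ht) ?_
  rw [pi_norm_le_iff_of_nonneg (Real.sqrt_nonneg _)]
  intro i
  rw [Real.norm_eq_abs, ← hnsq t ht]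
  refine Real.abs_le_sqrt ?_
  unfold nsq
  fin_cases i
  · simp; positivity
  · simp; positivity

end RMetric

section FlowSmooth

variable {E : Type*} [NormedAddCommGroup E] [NormedSpace ℝ E] [FiniteDimensional ℝ E]

lemma IsFlow.contDiff_one {Z : E → E} {Φ : ℝ → E → E} (h : IsFlow Z Φ) (hZ : ContDiff ℝ 2 Z)
    (t : ℝ) : ContDiff ℝ 1 (Φ t) := by
  obtain ⟨W, -, -, hW, hc⟩ := h.exists_fderiv hZ
  rw [contDiff_one_iff_fderiv]
  refine ⟨fun y => (hW y t).differentiableAt, ?_⟩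
  rw [show fderiv ℝ (Φ t) = W t from funext fun y => (hW y t).fderiv]
  exact hc t

/-- The flow of a `C³` field is `C²` in the initial value. -/
lemma IsFlow.contDiff_two {Z : E → E} {Φ : ℝ → E → E} (h : IsFlow Z Φ) (hZ : ContDiff ℝ 3 Z)
    (t : ℝ) : ContDiff ℝ 2 (Φ t) := by
  obtain ⟨W, h0, hd, hW, -⟩ := h.exists_fderiv (hZ.of_le (by norm_num))
  have hdZ : ContDiff ℝ 2 (fderiv ℝ Z) := hZ.fderiv_right (by norm_num)
  have hF : IsFlow (fun q : E × (E →L[ℝ] E) => (Z q.1, (fderiv ℝ Z q.1).comp q.2))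
      (fun t q => (Φ t q.1, (W t q.1).comp q.2)) := by
    refine ⟨fun q => ?_, fun q t => ?_⟩
    · simp [h.zero, h0]
    · refine (h.deriv q.1 t).prodMk ?_
      have := (ContinuousLinearMap.compL ℝ E E E).flip q.2 |>.hasFDerivAt.comp_hasDerivAt t
        (hd q.1 t)
      exact this
  have h1 := hF.contDiff_one (((hZ.of_le (by norm_num)).comp contDiff_fst).prodMk
    ((hdZ.comp contDiff_fst).clm_comp contDiff_snd)) t
  have h2 : ContDiff ℝ 1 (W t) :=
    contDiff_snd.comp (h1.comp (contDiff_id.prodMk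
      (contDiff_const (c := ContinuousLinearMap.id ℝ E))))
  rw [show (2 : WithTop ℕ∞) = 1 + 1 by norm_num, contDiff_succ_iff_fderiv]
  refine ⟨fun y => (hW y t).differentiableAt, by simp, ?_⟩
  rwa [show fderiv ℝ (Φ t) = W t from funext fun y => (hW y t).fderiv]

end FlowSmooth

/-- The geodesic flow together with the fundamental solutions of the Jacobi equation. -/
structure GeoFlow (M : RMetric) where
  Φ : ℝ → V2 × V2 → V2 × V2
  flow : IsFlow M.spray Φ
  s : ℝ → V2 × V2 → ℝ
  ds : ℝ → V2 × V2 → ℝ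
  c : ℝ → V2 × V2 → ℝ
  dc : ℝ → V2 × V2 → ℝ
  s_zero : ∀ y, s 0 y = 0
  ds_zero : ∀ y, ds 0 y = 1
  c_zero : ∀ y, c 0 y = 1
  dc_zero : ∀ y, dc 0 y = 0
  hasDerivAt_s : ∀ y t, HasDerivAt (fun r => s r y) (ds t y) t
  hasDerivAt_ds : ∀ y t, HasDerivAt (fun r => ds r y)
    (-(nsq (Φ t y).2 * M.K (Φ t y).1) * s t y) t
  hasDerivAt_c : ∀ y t, HasDerivAt (fun r => c r y) (dc t y) t
  hasDerivAt_dc : ∀ y t, HasDerivAt (fun r => dc r y)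
    (-(nsq (Φ t y).2 * M.K (Φ t y).1) * c t y) t
  continuous_s : Continuous fun q : ℝ × (V2 × V2) => s q.1 q.2
  continuous_ds : Continuous fun q : ℝ × (V2 × V2) => ds q.1 q.2
  continuous_c : Continuous fun q : ℝ × (V2 × V2) => c q.1 q.2
  continuous_dc : Continuous fun q : ℝ × (V2 × V2) => dc q.1 q.2

namespace RMetric

variable (M : RMetric)

/-- The first order system of the Jacobi equation. -/
def jacL (y : V2 × V2) : ℝ × ℝ →L[ℝ] ℝ × ℝ :=
  (ContinuousLinearMap.snd ℝ ℝ ℝ).prod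
    ((-(nsq y.2 * M.K y.1)) • ContinuousLinearMap.fst ℝ ℝ ℝ)

lemma jacL_apply (y : V2 × V2) (q : ℝ × ℝ) :
    M.jacL y q = (q.2, -(nsq y.2 * M.K y.1) * q.1) := rfl

lemma contDiff_jacL : ContDiff ℝ ∞ M.jacL := by
  have h1 : ContDiff ℝ ∞ fun y : V2 × V2 => -(nsq y.2 * M.K y.1) := by
    have := M.contDiff_K
    fun_prop
  have h2 : M.jacL = fun y => (ContinuousLinearMap.inl ℝ ℝ ℝ).comp (ContinuousLinearMap.snd ℝ ℝ ℝ)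
      + (-(nsq y.2 * M.K y.1)) • ((ContinuousLinearMap.inr ℝ ℝ ℝ).comp
        (ContinuousLinearMap.fst ℝ ℝ ℝ)) := by
    ext y <;> simp [jacL]
  rw [h2]
  fun_prop

/-- The spray together with the Jacobi equation. -/
def jacSpray (q : (V2 × V2) × (ℝ × ℝ)) : (V2 × V2) × (ℝ × ℝ) := (M.spray q.1, M.jacL q.1 q.2)

lemma contDiff_jacSpray : ContDiff ℝ ∞ M.jacSpray :=
  (M.contDiff_spray.comp contDiff_fst).prodMk
    ((M.contDiff_jacL.comp contDiff_fst).clm_apply contDiff_snd)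

theorem exists_geoFlow (hcomp : M.Complete) : Nonempty (GeoFlow M) := by
  obtain ⟨Φ, hΦ⟩ := exists_geodesicFlow hcomp
  obtain ⟨W, hW⟩ := hΦ.exists_skew (M.contDiff_spray.of_le (by exact_mod_cast le_top))
    (M.contDiff_jacL.of_le (by exact_mod_cast le_top))
  have hW' : IsFlow M.jacSpray (fun t q => (Φ t q.1, W t q)) := hW
  have hd : ∀ q t, HasDerivAt (fun s => W s q) (M.jacL (Φ t q.1) (W t q)) t := fun q t =>
    (hW.deriv q t).snd_comp
  have h0 : ∀ q, W 0 q = q.2 := fun q => congrArg Prod.snd (hW.zero q)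
  have hc : Continuous fun q : ℝ × ((V2 × V2) × (ℝ × ℝ)) => W q.1 q.2 :=
    continuous_snd.comp (hW'.continuous (M.contDiff_jacSpray.of_le (by exact_mod_cast le_top)))
  have hc1 : ∀ a : ℝ × ℝ, Continuous fun q : ℝ × (V2 × V2) => W q.1 (q.2, a) := fun a =>
    hc.comp (continuous_fst.prodMk (continuous_snd.prodMk continuous_const))
  exact ⟨{
    Φ := Φ
    flow := hΦ
    s := fun t y => (W t (y, (0, 1))).1
    ds := fun t y => (W t (y, (0, 1))).2
    c := fun t y => (W t (y, (1, 0))).1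
    dc := fun t y => (W t (y, (1, 0))).2
    s_zero := fun y => by simp [h0]
    ds_zero := fun y => by simp [h0]
    c_zero := fun y => by simp [h0]
    dc_zero := fun y => by simp [h0]
    hasDerivAt_s := fun y t => (hd (y, (0, 1)) t).fst_comp
    hasDerivAt_ds := fun y t => (hd (y, (0, 1)) t).snd_comp
    hasDerivAt_c := fun y t => (hd (y, (1, 0)) t).fst_comp
    hasDerivAt_dc := fun y t => (hd (y, (1, 0)) t).snd_comp
    continuous_s := continuous_fst.comp (hc1 _)
    continuous_ds := continuous_snd.comp (hc1 _)
    continuous_c := continuous_fst.comp (hc1 _)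
    continuous_dc := continuous_snd.comp (hc1 _) }⟩

end RMetric

namespace GeoFlow

variable {M : RMetric} (G : GeoFlow M)

lemma contDiff_spray_one : ContDiff ℝ 1 M.spray := M.contDiff_spray.of_le (by exact_mod_cast le_top)

lemma continuous_Φ : Continuous fun q : ℝ × (V2 × V2) => G.Φ q.1 q.2 :=
  G.flow.continuous contDiff_spray_one

lemma Φ_zero (y : V2 × V2) : G.Φ 0 y = y := G.flow.zero y

lemma Φ_add (s t : ℝ) (y : V2 × V2) : G.Φ t (G.Φ s y) = G.Φ (s + t) y :=
  G.flow.group contDiff_spray_one s t y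

lemma hasDerivAt_Φ (y : V2 × V2) (t : ℝ) : HasDerivAt (fun s => G.Φ s y) (M.spray (G.Φ t y)) t :=
  G.flow.deriv y t

lemma nsq_Φ (t : ℝ) (y : V2 × V2) : nsq (G.Φ t y).2 = nsq y.2 := by
  have := RMetric.nsq_eqOn_Ioo (M := M) (y := fun t => G.Φ t y) (T := |t| + 1) (by positivity)
    (fun t _ => G.hasDerivAt_Φ y t) t (abs_lt.1 (by linarith))
  simpa [Φ_zero] using this

/-- Solutions of the Jacobi equation are determined by their initial values. -/
lemma jacobi_eq {y : V2 × V2} {h k : ℝ → ℝ} (hh : ∀ t, HasDerivAt h (k t) t)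
    (hk : ∀ t, HasDerivAt k (-(nsq (G.Φ t y).2 * M.K (G.Φ t y).1) * h t) t) (t : ℝ) :
    h t = h 0 * G.c t y + k 0 * G.s t y ∧ k t = h 0 * G.dc t y + k 0 * G.ds t y := by
  have := integralCurve_eq (M.contDiff_jacSpray.of_le (by exact_mod_cast le_top))
    (f := fun t => (G.Φ t y, (h t, k t)))
    (g := fun t => (G.Φ t y, (h 0 * G.c t y + k 0 * G.s t y, h 0 * G.dc t y + k 0 * G.ds t y)))
    0 (fun t => (G.hasDerivAt_Φ y t).prodMk ((hh t).prodMk (hk t)))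
    (fun t => (G.hasDerivAt_Φ y t).prodMk ((((G.hasDerivAt_c y t).const_mul _).add
      ((G.hasDerivAt_s y t).const_mul _)).prodMk
      ((((G.hasDerivAt_dc y t).const_mul _).add ((G.hasDerivAt_ds y t).const_mul _)).congr_deriv
        (by
          change _ = -(nsq (G.Φ t y).2 * M.K (G.Φ t y).1) * (h 0 * G.c t y + k 0 * G.s t y)
          ring))))
    (by simp [G.s_zero, G.c_zero, G.ds_zero, G.dc_zero])
  have := congrFun this t
  simp only [Prod.mk.injEq, true_and] at this
  exact this

lemma wronskian (t : ℝ) (y : V2 × V2) : G.c t y * G.ds t y - G.dc t y * G.s t y = 1 := by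
  have hd : ∀ t, HasDerivAt (fun t => G.c t y * G.ds t y - G.dc t y * G.s t y) 0 t := fun t =>
    (((G.hasDerivAt_c y t).mul (G.hasDerivAt_ds y t)).sub
      ((G.hasDerivAt_dc y t).mul (G.hasDerivAt_s y t))).congr_deriv (by ring)
  have := is_const_of_deriv_eq_zero (fun t => (hd t).differentiableAt) (fun t => (hd t).deriv) t 0
  rw [this]
  simp [G.s_zero, G.c_zero, G.ds_zero]

lemma solution_shift {y : V2 × V2} {h k : ℝ → ℝ} (hh : ∀ t, HasDerivAt h (k t) t)
    (hk : ∀ t, HasDerivAt k (-(nsq (G.Φ t y).2 * M.K (G.Φ t y).1) * h t) t) (r t : ℝ) :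
    h (r + t) = h r * G.c t (G.Φ r y) + k r * G.s t (G.Φ r y) := by
  have := (G.jacobi_eq (y := G.Φ r y) (h := fun t => h (r + t)) (k := fun t => k (r + t))
    (fun t => (hh (r + t)).comp_const_add r t) (fun t => by
      rw [G.Φ_add]
      exact (hk (r + t)).comp_const_add r t) t).1
  simpa using this

lemma Φ_smul (x v : V2) (a t : ℝ) :
    G.Φ t (x, a • v) = ((G.Φ (a * t) (x, v)).1, a • (G.Φ (a * t) (x, v)).2) := by
  have := G.flow.unique contDiff_spray_one
    (f := fun t => ((G.Φ (a * t) (x, v)).1, a • (G.Φ (a * t) (x, v)).2)) (fun t => by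
      have h1 : HasDerivAt (fun t => G.Φ (a * t) (x, v)) (a • M.spray (G.Φ (a * t) (x, v))) t := by
        have h2 : HasDerivAt (fun t : ℝ => a * t) a t := by
          simpa using (hasDerivAt_id t).const_mul a
        exact HasDerivAt.scomp t (G.hasDerivAt_Φ (x, v) (a * t)) h2
      refine (h1.fst_comp.prodMk (h1.snd_comp.const_smul a)).congr_deriv ?_
      ext i
      · simp [RMetric.spray, RMetric.fld, M.ev_smul]
      · fin_cases i <;> simp [RMetric.spray, RMetric.fld, M.cf_smul] <;> ring) t
  simpa [Φ_zero] using this.symm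

lemma s_smul (x v : V2) (a t : ℝ) : a * G.s t (x, a • v) = G.s (a * t) (x, v) := by
  have ha : ∀ t, HasDerivAt (fun t : ℝ => a * t) a t := fun t => by
    simpa using (hasDerivAt_id t).const_mul a
  have := (G.jacobi_eq (y := (x, a • v)) (h := fun t => G.s (a * t) (x, v))
    (k := fun t => a * G.ds (a * t) (x, v))
    (fun t => ((G.hasDerivAt_s (x, v) (a * t)).comp t (ha t)).congr_deriv (by ring))
    (fun t => (((G.hasDerivAt_ds (x, v) (a * t)).comp t (ha t)).const_mul a).congr_deriv (by
      rw [Φ_smul]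
      simp only [nsq_smul]
      ring)) t).1
  simpa [G.s_zero, G.ds_zero] using this.symm

lemma s_zero_vec (x : V2) (t : ℝ) : G.s t (x, 0) = t := by
  have := (G.jacobi_eq (y := (x, 0)) (h := fun t => t) (k := fun _ => 1)
    (fun t => hasDerivAt_id t) (fun t => (hasDerivAt_const t (1 : ℝ)).congr_deriv (by
      rw [G.nsq_Φ]; simp [nsq])) t).1
  simpa using this.symm

lemma s_ne_zero (hconj : M.NoConjugatePoints) {t : ℝ} (ht : t ≠ 0) (y : V2 × V2) :
    G.s t y ≠ 0 := by
  obtain ⟨x, v⟩ := y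
  by_cases hv : v = 0
  · rw [hv, s_zero_vec]
    exact ht
  have ha : 0 < √(nsq v) := Real.sqrt_pos.2 (nsq_pos hv)
  set a := √(nsq v) with haa
  have hav : a • a⁻¹ • v = v := by rw [smul_smul, mul_inv_cancel₀ ha.ne', one_smul]
  have hn : nsq (a⁻¹ • v) = 1 := by
    rw [nsq_smul, inv_pow, haa, Real.sq_sqrt (nsq_nonneg v)]
    exact inv_mul_cancel₀ (nsq_pos hv).ne'
  set y : V2 × V2 := (x, a⁻¹ • v) with hy
  have hs := G.s_smul x (a⁻¹ • v) a t
  rw [hav] at hs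
  intro h0
  rw [h0, mul_zero] at hs
  have hgeo := RMetric.isGeodesic_of_spray (M := M) (y := fun t => G.Φ t y)
    (fun t => G.hasDerivAt_Φ y t)
  have hunit : M.UnitSpeed fun t => (G.Φ t y).1 := by
    intro t
    rw [vel_eq (G.hasDerivAt_Φ y t).fst_comp]
    change M.met _ (M.ev _ _) (M.ev _ _) = 1
    rw [M.met_ev_self, G.nsq_Φ, hn]
  have hd1 : deriv (fun r => G.s r y) = fun r => G.ds r y :=
    funext fun r => (G.hasDerivAt_s y r).deriv
  have hd2 : deriv (fun r => G.ds r y) = fun r =>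
      -(nsq (G.Φ r y).2 * M.K (G.Φ r y).1) * G.s r y :=
    funext fun r => (G.hasDerivAt_ds y r).deriv
  have hcy : ∀ {X : Type} [TopologicalSpace X] {f : ℝ × (V2 × V2) → X}, Continuous f →
      Continuous fun r => f (r, y) := fun hf => hf.comp (by fun_prop)
  have hC2 : ContDiff ℝ 2 fun r => G.s r y := by
    rw [show (2 : WithTop ℕ∞) = 1 + 1 by norm_num, contDiff_succ_iff_deriv]
    refine ⟨fun r => (G.hasDerivAt_s y r).differentiableAt, by simp, ?_⟩
    rw [hd1, contDiff_one_iff_deriv]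
    refine ⟨fun r => (G.hasDerivAt_ds y r).differentiableAt, ?_⟩
    rw [hd2]
    have h1 := hcy G.continuous_Φ
    have h2 := hcy G.continuous_s
    have h3 := M.continuous_K
    exact ((continuous_nsq.comp (continuous_snd.comp h1)).mul
      (h3.comp (continuous_fst.comp h1))).neg.mul h2
  have hne : ∃ t₀, G.s t₀ y ≠ 0 := by
    by_contra! hz
    have h1 := G.hasDerivAt_s y 0
    rw [show (fun r => G.s r y) = fun _ => 0 from funext hz, G.ds_zero] at h1
    exact one_ne_zero (h1.unique (hasDerivAt_const 0 (0 : ℝ)))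
  refine hconj _ hgeo hunit (fun r => G.s r y) hC2 (fun r => ?_) hne 0 (G.s_zero y) (a * t)
    (mul_ne_zero ha.ne' ht) hs.symm
  rw [hd1, hd2]
  simp only
  rw [G.nsq_Φ, hn]
  ring

lemma continuous_s_left (y : V2 × V2) : Continuous fun t => G.s t y :=
  continuous_iff_continuousAt.2 fun t => (G.hasDerivAt_s y t).continuousAt

lemma div_s_pos (hconj : M.NoConjugatePoints) {t : ℝ} (ht : t ≠ 0) (y : V2 × V2) :
    0 < t * G.s t y := by
  -- the continuous extension of `s / t` has no zero and is positive at the origin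
  have hc : Continuous (dslope (fun t => G.s t y) 0) := by
    rw [← continuousOn_univ, continuousOn_dslope univ_mem]
    exact ⟨(G.continuous_s_left y).continuousOn, (G.hasDerivAt_s y 0).differentiableAt⟩
  have hne : ∀ r, dslope (fun t => G.s t y) 0 r ≠ 0 := by
    intro r
    by_cases hr : r = 0
    · rw [hr, dslope_same, (G.hasDerivAt_s y 0).deriv, G.ds_zero]
      exact one_ne_zero
    · rw [dslope_of_ne _ hr, slope_def_field, G.s_zero]
      simpa using ⟨G.s_ne_zero hconj hr y, hr⟩
  have h0 : 0 < dslope (fun t => G.s t y) 0 0 := by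
    rw [dslope_same, (G.hasDerivAt_s y 0).deriv, G.ds_zero]
    exact one_pos
  have hpos : 0 < dslope (fun t => G.s t y) 0 t := by
    by_contra! hneg
    obtain ⟨r, -, hr⟩ := (isPreconnected_univ (α := ℝ)).intermediate_value (mem_univ t)
      (mem_univ 0) hc.continuousOn ⟨hneg, h0.le⟩
    exact hne r hr
  rw [dslope_of_ne _ ht, slope_def_field, G.s_zero, sub_zero, sub_zero] at hpos
  have : t * G.s t y = G.s t y / t * t ^ 2 := by field_simp
  rw [this]
  positivity

lemma s_pos (hconj : M.NoConjugatePoints) {t : ℝ} (ht : 0 < t) (y : V2 × V2) : 0 < G.s t y :=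
  pos_of_mul_pos_right (G.div_s_pos hconj ht.ne' y) ht.le

lemma s_neg (hconj : M.NoConjugatePoints) {t : ℝ} (ht : t < 0) (y : V2 × V2) : G.s t y < 0 := by
  have := G.div_s_pos hconj ht.ne y
  by_contra! h
  nlinarith

end GeoFlow

/-- Solutions of the variational equation are transported by the derivative of the flow. -/
lemma IsFlow.fderiv_apply_eq {E : Type*} [NormedAddCommGroup E] [NormedSpace ℝ E]
    [FiniteDimensional ℝ E] {Z : E → E} {Φ : ℝ → E → E} (h : IsFlow Z Φ) (hZ : ContDiff ℝ 2 Z)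
    {y : E} {X : ℝ → E} (hX : ∀ t, HasDerivAt X (fderiv ℝ Z (Φ t y) (X t)) t) (t : ℝ) :
    fderiv ℝ (Φ t) y (X 0) = X t := by
  obtain ⟨W, h0, hd, hW, -⟩ := h.exists_fderiv hZ
  have hdZ : ContDiff ℝ 1 (fderiv ℝ Z) := hZ.fderiv_right (by norm_num)
  have := integralCurve_eq (Z := fun q : E × E => (Z q.1, fderiv ℝ Z q.1 q.2))
    (((hZ.of_le (by norm_num)).comp contDiff_fst).prodMk
      ((hdZ.comp contDiff_fst).clm_apply contDiff_snd))
    (f := fun t => (Φ t y, W t y (X 0))) (g := fun t => (Φ t y, X t)) 0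
    (fun t => (h.deriv y t).prodMk ((ContinuousLinearMap.apply ℝ E (X 0)).hasFDerivAt.comp_hasDerivAt t (hd y t)))
    (fun t => (h.deriv y t).prodMk (hX t)) (by simp [h0])
  rw [(hW y t).fderiv]
  exact congrArg Prod.snd (congrFun this t)

lemma exists_eq_smul_add_rot {v : V2} (hv : v ≠ 0) (h : V2) : ∃ a b : ℝ, h = a • v + b • rot v := by
  have hn := (nsq_pos hv).ne'
  refine ⟨(h 0 * v 0 + h 1 * v 1) / nsq v, (h 1 * v 0 - h 0 * v 1) / nsq v, ?_⟩
  ext i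
  fin_cases i
  · simp
    field_simp
    simp [nsq]
    ring
  · simp
    field_simp
    simp [nsq]
    ring

lemma nsq_smul_add_rot (v : V2) (a b : ℝ) :
    nsq (a • v + b • rot v) = (a ^ 2 + b ^ 2) * nsq v := by
  simp [nsq]; ring

namespace GeoFlow

variable {M : RMetric} (G : GeoFlow M)

lemma contDiff_spray_two : ContDiff ℝ 2 M.spray := contDiff_infty.1 M.contDiff_spray 2

lemma contDiff_Φ (t : ℝ) : ContDiff ℝ 2 (G.Φ t) :=
  G.flow.contDiff_two (contDiff_infty.1 M.contDiff_spray 3) t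

lemma hasFDerivAt_Φ (t : ℝ) (y : V2 × V2) : HasFDerivAt (G.Φ t) (fderiv ℝ (G.Φ t) y) y :=
  ((G.contDiff_Φ t).differentiable (by simp) y).hasFDerivAt

lemma fderiv_Φ_vert (t : ℝ) (y : V2 × V2) : fderiv ℝ (G.Φ t) y (RMetric.vert y) =
    G.s t y • M.horiz (G.Φ t y) + G.ds t y • RMetric.vert (G.Φ t y) := by
  have := G.flow.fderiv_apply_eq contDiff_spray_two
    (fun t => RMetric.hasDerivAt_jacobi (G.hasDerivAt_Φ y t) (G.hasDerivAt_s y t)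
      (G.hasDerivAt_ds y t)) t
  simpa [G.s_zero, G.ds_zero, G.Φ_zero] using this

lemma fderiv_Φ_horiz (t : ℝ) (y : V2 × V2) : fderiv ℝ (G.Φ t) y (M.horiz y) =
    G.c t y • M.horiz (G.Φ t y) + G.dc t y • RMetric.vert (G.Φ t y) := by
  have := G.flow.fderiv_apply_eq contDiff_spray_two
    (fun t => RMetric.hasDerivAt_jacobi (G.hasDerivAt_Φ y t) (G.hasDerivAt_c y t)
      (G.hasDerivAt_dc y t)) t
  simpa [G.c_zero, G.dc_zero, G.Φ_zero] using this

lemma fderiv_Φ_spray (t : ℝ) (y : V2 × V2) :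
    fderiv ℝ (G.Φ t) y (M.spray y) = M.spray (G.Φ t y) := by
  have := G.flow.fderiv_apply_eq contDiff_spray_two
    (fun t => RMetric.hasDerivAt_spray (G.hasDerivAt_Φ y t)) t
  simpa [G.Φ_zero] using this

lemma fderiv_Φ_scaling (t : ℝ) (y : V2 × V2) : fderiv ℝ (G.Φ t) y ((0 : V2), y.2) =
    ((0 : V2), (G.Φ t y).2) + t • M.spray (G.Φ t y) := by
  have := G.flow.fderiv_apply_eq contDiff_spray_two
    (fun t => RMetric.hasDerivAt_scaling (G.hasDerivAt_Φ y t)) t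
  simpa [G.Φ_zero] using this

/-- The exponential map at `p` in frame coordinates. -/
def exp (p v : V2) : V2 := (G.Φ 1 (p, v)).1

lemma exp_smul (p v : V2) (t : ℝ) : G.exp p (t • v) = (G.Φ t (p, v)).1 := by
  rw [exp, Φ_smul, mul_one]

lemma exp_zero (p : V2) : G.exp p 0 = p := by
  have := G.exp_smul p 0 0
  rw [smul_zero] at this
  rw [this, G.Φ_zero]

lemma contDiff_exp (p : V2) : ContDiff ℝ 2 (G.exp p) :=
  contDiff_fst.comp ((G.contDiff_Φ 1).comp (contDiff_const.prodMk contDiff_id))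

lemma hasFDerivAt_exp (p v : V2) : HasFDerivAt (G.exp p) (fderiv ℝ (G.exp p) v) v :=
  ((G.contDiff_exp p).differentiable (by simp) v).hasFDerivAt

lemma fderiv_exp_eq (p v h : V2) :
    fderiv ℝ (G.exp p) v h = (fderiv ℝ (G.Φ 1) (p, v) ((0 : V2), h)).1 := by
  have h1 : HasFDerivAt (fun v : V2 => (p, v)) (ContinuousLinearMap.inr ℝ V2 V2) v :=
    hasFDerivAt_prodMk_right p v
  have h2 := ((G.hasFDerivAt_Φ 1 (p, v)).comp v h1).fst
  have h3 : HasFDerivAt (G.exp p) _ v := h2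
  rw [h3.fderiv]
  rfl

lemma fderiv_exp_zero (p h : V2) : fderiv ℝ (G.exp p) 0 h = M.ev p h := by
  have h1 : HasDerivAt (fun t : ℝ => G.exp p (t • h)) (M.ev p h) 0 := by
    simp only [exp_smul]
    have := (G.hasDerivAt_Φ (p, h) 0).fst_comp
    rwa [G.Φ_zero] at this
  have h2 : HasDerivAt (fun t : ℝ => t • h) h 0 := by
    simpa using (hasDerivAt_id (0 : ℝ)).smul_const h
  have h3 := (G.hasFDerivAt_exp p ((0 : ℝ) • h)).comp_hasDerivAt (0 : ℝ) h2
  rw [zero_smul] at h3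
  exact h3.unique h1

lemma fderiv_exp_smul_add_rot (p v : V2) (a b : ℝ) :
    fderiv ℝ (G.exp p) v (a • v + b • rot v) =
      M.ev (G.exp p v) (a • (G.Φ 1 (p, v)).2 + (b * G.s 1 (p, v)) • rot (G.Φ 1 (p, v)).2) := by
  rw [map_add, map_smul, map_smul, fderiv_exp_eq, fderiv_exp_eq]
  have h1 := G.fderiv_Φ_scaling 1 (p, v)
  have h2 := G.fderiv_Φ_vert 1 (p, v)
  simp only [RMetric.vert] at h1 h2
  rw [h1, h2]
  simp [RMetric.horiz, RMetric.spray, RMetric.fld, M.ev_add, M.ev_smul, exp, smul_smul]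

/-- The Gauss lemma. -/
lemma gauss (p v h : V2) : (v 0 * h 0 + v 1 * h 1) ^ 2 ≤ nsq v *
    M.met (G.exp p v) (fderiv ℝ (G.exp p) v h) (fderiv ℝ (G.exp p) v h) := by
  by_cases hv : v = 0
  · simp [hv, nsq]
  obtain ⟨a, b, rfl⟩ := exists_eq_smul_add_rot hv h
  rw [fderiv_exp_smul_add_rot, M.met_ev_self, nsq_smul_add_rot, G.nsq_Φ]
  have h1 : v 0 * (a • v + b • rot v) 0 + v 1 * (a • v + b • rot v) 1 = a * nsq v := by
    simp [nsq]; ring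
  rw [h1]
  have := mul_nonneg (sq_nonneg (b * G.s 1 (p, v))) (sq_nonneg (nsq v))
  nlinarith

lemma fderiv_exp_injective (hconj : M.NoConjugatePoints) (p v : V2) :
    Function.Injective (fderiv ℝ (G.exp p) v) := by
  rw [injective_iff_map_eq_zero]
  intro h hh
  by_cases hv : v = 0
  · rw [hv, fderiv_exp_zero] at hh
    exact M.ev_inj hh
  obtain ⟨a, b, rfl⟩ := exists_eq_smul_add_rot hv h
  rw [fderiv_exp_smul_add_rot] at hh
  have h1 := M.ev_inj hh
  have hs := G.s_ne_zero hconj one_ne_zero (p, v)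
  have hn := nsq_pos hv
  rw [← nsq_eq_zero, nsq_smul_add_rot, G.nsq_Φ] at h1
  have h2 : a ^ 2 + (b * G.s 1 (p, v)) ^ 2 = 0 := by
    rcases mul_eq_zero.1 h1 with h | h
    · exact h
    · exact absurd h hn.ne'
  have ha : a = 0 := by nlinarith [sq_nonneg a, sq_nonneg (b * G.s 1 (p, v))]
  have hb : b * G.s 1 (p, v) = 0 := by nlinarith [sq_nonneg a, sq_nonneg (b * G.s 1 (p, v))]
  rw [ha, (mul_eq_zero.1 hb).resolve_right hs]
  simp

/-- The derivative of the exponential map as an equivalence. -/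
def dexp (hconj : M.NoConjugatePoints) (p v : V2) : V2 ≃L[ℝ] V2 :=
  (LinearEquiv.ofInjectiveEndo (fderiv ℝ (G.exp p) v : V2 →ₗ[ℝ] V2)
    (G.fderiv_exp_injective hconj p v)).toContinuousLinearEquiv

lemma coe_dexp (hconj : M.NoConjugatePoints) (p v : V2) :
    (G.dexp hconj p v : V2 →L[ℝ] V2) = fderiv ℝ (G.exp p) v := by
  ext x : 1
  rfl

lemma hasDerivAt_sqrt_nsq {w : ℝ → V2} {w' : V2} {t e : ℝ} (he : 0 < e)
    (hw : HasDerivAt w w' t) : HasDerivAt (fun t => √(e + nsq (w t)))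
      ((w t 0 * w' 0 + w t 1 * w' 1) / √(e + nsq (w t))) t := by
  have h1 : 0 < e + nsq (w t) := by have := nsq_nonneg (w t); positivity
  have h2 : HasDerivAt (fun t => e + nsq (w t)) (2 * (w t 0 * w' 0 + w t 1 * w' 1)) t :=
    ((((hw.coord 0).pow 2).add ((hw.coord 1).pow 2)).const_add e).congr_deriv (by simp; ring)
  refine (h2.sqrt h1.ne').congr_deriv ?_
  field_simp

/-- Radial speed in the exponential chart is bounded by the Riemannian speed. -/
lemma radial_speed_le (p w h : V2) {e : ℝ} (he : 0 < e) :
    |(w 0 * h 0 + w 1 * h 1) / √(e + nsq w)| ≤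
      √(M.met (G.exp p w) (fderiv ℝ (G.exp p) w h) (fderiv ℝ (G.exp p) w h)) := by
  have hn := nsq_nonneg w
  have hs : 0 < √(e + nsq w) := Real.sqrt_pos.2 (by positivity)
  rw [abs_div, abs_of_pos hs, div_le_iff₀ hs, ← Real.sqrt_mul (M.met_nonneg _ _)]
  refine Real.abs_le_sqrt ((G.gauss p w h).trans ?_)
  have := mul_nonneg he.le (M.met_nonneg (G.exp p w) (fderiv ℝ (G.exp p) w h))
  nlinarith

lemma norm_le_sqrt_nsq (w : V2) : ‖w‖ ≤ √(1 + nsq w) := by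
  rw [pi_norm_le_iff_of_nonneg (Real.sqrt_nonneg _)]
  intro i
  rw [Real.norm_eq_abs]
  refine Real.abs_le_sqrt ?_
  unfold nsq
  fin_cases i
  · simp; nlinarith [sq_nonneg (w 1)]
  · simp; nlinarith [sq_nonneg (w 0)]

/-- Without conjugate points the exponential map has a continuous global inverse. -/
theorem exists_log (hconj : M.NoConjugatePoints) (p : V2) :
    ∃ L : V2 → V2, Continuous L ∧ (∀ q, G.exp p (L q) = q) ∧ ∀ v, L (G.exp p v) = v := by
  -- lift straight lines by solving an ordinary differential equation
  let B : V2 → V2 →L[ℝ] V2 := fun w => (fderiv ℝ (G.exp p) w).inverse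
  have hB : ∀ w u, fderiv ℝ (G.exp p) w (B w u) = u := by
    intro w u
    simp only [B, ← G.coe_dexp hconj p w, ContinuousLinearMap.inverse_equiv]
    simp
  have hBc : ContDiff ℝ 1 B := by
    rw [contDiff_iff_contDiffAt]
    intro w
    have h1 := contDiffAt_map_inverse (𝕜 := ℝ) (n := 1) (G.dexp hconj p w)
    rw [coe_dexp] at h1
    exact h1.comp w ((G.contDiff_exp p).fderiv_right (m := 1) (by norm_num)).contDiffAt
  let Z : V2 × V2 → V2 × V2 := fun q => (B q.1 q.2, 0)
  have hZ : ContDiff ℝ 1 Z := ((hBc.comp contDiff_fst).clm_apply contDiff_snd).prodMk contDiff_const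
  have hlift : ∀ (γ : ℝ → V2 × V2) (T : ℝ), 0 < T →
      (∀ t ∈ Ioo (-T) T, HasDerivAt γ (Z (γ t)) t) → ∀ t ∈ Ioo (-T) T, (γ t).2 = (γ 0).2 ∧
        G.exp p (γ t).1 = G.exp p (γ 0).1 + t • (γ 0).2 := by
    intro γ T hT hγ
    have hconst : ∀ {f : ℝ → V2}, (∀ t ∈ Ioo (-T) T, HasDerivAt f 0 t) →
        ∀ t ∈ Ioo (-T) T, f t = f 0 := by
      intro f hf t ht
      have := Convex.norm_image_sub_le_of_norm_hasDerivWithin_le (C := 0) (f' := fun _ => 0)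
        (fun t ht => (hf t ht).hasDerivWithinAt) (by simp) (convex_Ioo (-T) T)
        (show (0 : ℝ) ∈ Ioo (-T) T from ⟨by linarith, hT⟩) ht
      rw [zero_mul] at this
      exact sub_eq_zero.1 (norm_le_zero_iff.1 this)
    have h2 : ∀ t ∈ Ioo (-T) T, (γ t).2 = (γ 0).2 :=
      hconst fun t ht => (hγ t ht).snd_comp
    refine fun t ht => ⟨h2 t ht, ?_⟩
    have := hconst (f := fun t => G.exp p (γ t).1 - t • (γ 0).2) (fun t ht => by
      have h3 := (G.hasFDerivAt_exp p (γ t).1).comp_hasDerivAt t (hγ t ht).fst_comp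
      have h4 := h3.sub ((hasDerivAt_id t).smul_const (γ 0).2)
      refine h4.congr_deriv ?_
      simp only [Z]
      rw [hB, h2 t ht]
      simp) t ht
    simp only [zero_smul, sub_zero] at this
    rw [← this]
    abel
  obtain ⟨Ψ, hΨ⟩ := exists_isFlow hZ (by
    intro y T hT γ h0 hγ
    have hl := hlift γ T hT hγ
    -- the speed of the projected curve is bounded
    have hspeed : ∃ C, ∀ t ∈ Icc (-T) T, √(M.met (G.exp p y.1 + t • y.2) y.2 y.2) ≤ C := by
      have hc : Continuous fun t : ℝ => √(M.met (G.exp p y.1 + t • y.2) y.2 y.2) := by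
        have : ∀ i j, Continuous fun t : ℝ => M.g (G.exp p y.1 + t • y.2) i j := fun i j =>
          (M.smooth i j).continuous.comp (by fun_prop)
        unfold RMetric.met
        fun_prop
      obtain ⟨C, hC⟩ := (isCompact_Icc (a := -T) (b := T)).exists_bound_of_continuousOn
        hc.continuousOn
      exact ⟨C, fun t ht => (le_abs_self _).trans (hC t ht)⟩
    obtain ⟨C, hC⟩ := hspeed
    refine isBounded_iff_forall_norm_le.2 ⟨max (√(1 + nsq y.1) + C * T) ‖y.2‖, ?_⟩
    rintro _ ⟨t, ht, rfl⟩
    refine max_le_max ?_ (by rw [(hl t ht).1, h0])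
    refine (norm_le_sqrt_nsq _).trans ?_
    have h1 := Convex.norm_image_sub_le_of_norm_hasDerivWithin_le (C := C)
      (f := fun t => √(1 + nsq (γ t).1))
      (fun t ht => (hasDerivAt_sqrt_nsq one_pos (hγ t ht).fst_comp).hasDerivWithinAt)
      (fun t ht => by
        refine (G.radial_speed_le p (γ t).1 _ one_pos).trans ?_
        simp only [Z]
        rw [hB, (hl t ht).1, (hl t ht).2, h0]
        exact hC t (Ioo_subset_Icc_self ht)) (convex_Ioo (-T) T)
        (show (0 : ℝ) ∈ Ioo (-T) T from ⟨by linarith, hT⟩) ht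
    rw [h0, sub_zero, Real.norm_eq_abs, Real.norm_eq_abs] at h1
    have h2 := le_abs_self (√(1 + nsq (γ t).1) - √(1 + nsq y.1))
    have hC0 : 0 ≤ C := (Real.sqrt_nonneg _).trans (hC 0 ⟨by linarith, hT.le⟩)
    have h3 := mul_le_mul_of_nonneg_left (abs_lt.2 ht).le hC0
    linarith)
  let L : V2 → V2 := fun q => (Ψ 1 (0, q - p)).1
  have hL : Continuous L := continuous_fst.comp ((hΨ.continuous hZ).comp
    (continuous_const.prodMk (continuous_const.prodMk (continuous_id.sub continuous_const))))
  have hEL : ∀ q, G.exp p (L q) = q := by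
    intro q
    have := (hlift (fun t => Ψ t (0, q - p)) 2 two_pos (fun t _ => hΨ.deriv _ t) 1
      ⟨by norm_num, by norm_num⟩).2
    rw [hΨ.zero] at this
    simpa [exp_zero] using this
  refine ⟨L, hL, hEL, fun v => ?_⟩
  have hinj : IsLocallyInjective (G.exp p) := by
    rw [isLocallyInjective_iff_nhds]
    intro w
    have h1 : HasStrictFDerivAt (G.exp p) (G.dexp hconj p w : V2 →L[ℝ] V2) w := by
      rw [coe_dexp]
      exact (G.contDiff_exp p).contDiffAt.hasStrictFDerivAt (by simp)
    refine ⟨_, h1.eventually_left_inverse, ?_⟩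
    intro a ha b hb hab
    rw [← show _ = a from ha, ← show _ = b from hb, hab]
  have hL0 : L (G.exp p 0) = 0 := by
    simp only [L, exp_zero, sub_self]
    have := hΨ.unique hZ (f := fun _ => 0) (fun t =>
      (hasDerivAt_const t (0 : V2 × V2)).congr_deriv (by simp [Z]; rfl)) 1
    simp only [← Prod.zero_eq_mk] at this ⊢
    rw [← this]
    rfl
  have := (T2Space.isSeparatedMap (G.exp p)).eq_of_comp_eq hinj (g₁ := fun v => L (G.exp p v))
    (g₂ := id) (hL.comp (G.contDiff_exp p).continuous) continuous_id
    (funext fun v => hEL _) 0 hL0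
  exact congrFun this v

end GeoFlow

namespace GeoFlow

variable {M : RMetric} (G : GeoFlow M) (hconj : M.NoConjugatePoints)

/-- The inverse of the exponential map. -/
def log (p : V2) : V2 → V2 := (G.exists_log hconj p).choose

lemma continuous_log (p : V2) : Continuous (G.log hconj p) := (G.exists_log hconj p).choose_spec.1

lemma exp_log (p q : V2) : G.exp p (G.log hconj p q) = q :=
  (G.exists_log hconj p).choose_spec.2.1 q

lemma log_exp (p v : V2) : G.log hconj p (G.exp p v) = v :=
  (G.exists_log hconj p).choose_spec.2.2 v

/-- The radial coordinate of normal coordinates. -/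
def rad (p q : V2) : ℝ := √(nsq (G.log hconj p q))

lemma continuous_rad (p : V2) : Continuous (G.rad hconj p) :=
  (continuous_nsq.comp (G.continuous_log hconj p)).sqrt

lemma rad_nonneg (p q : V2) : 0 ≤ G.rad hconj p q := Real.sqrt_nonneg _

lemma rad_exp (p v : V2) : G.rad hconj p (G.exp p v) = √(nsq v) := by rw [rad, log_exp]

lemma hasFDerivAt_log (p q : V2) : HasFDerivAt (G.log hconj p)
    ((G.dexp hconj p (G.log hconj p q)).symm : V2 →L[ℝ] V2) q := by
  refine HasFDerivAt.of_local_left_inverse (f := G.exp p) (G.continuous_log hconj p).continuousAt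
    ?_ (Eventually.of_forall fun x => G.exp_log hconj p x)
  rw [coe_dexp]
  exact G.hasFDerivAt_exp p _

lemma rad_sub_le_dist (p q q' : V2) : G.rad hconj p q' - G.rad hconj p q ≤ M.dist q q' := by
  refine RMetric.le_dist fun γ hγ h0 h1 => ?_
  have key : ∀ e : ℝ, 0 < e → √(e + nsq (G.log hconj p q')) - √(e + nsq (G.log hconj p q)) ≤
      M.curveLen γ 0 1 := by
    intro e he
    have h := RMetric.sub_le_curveLen (M := M) hγ (C := 1) (fun t _ => hasDerivAt_sqrt_nsq he
      ((G.hasFDerivAt_log hconj p (γ t)).comp_hasDerivAt t (hasDerivAt_vel hγ t))) (by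
        intro t _
        rw [one_mul]
        refine (le_abs_self _).trans ((G.radial_speed_le p _ _ he).trans ?_)
        rw [← G.coe_dexp hconj]
        simp [exp_log])
    simpa [h0, h1] using h
  have ht : Tendsto (fun e : ℝ => √(e + nsq (G.log hconj p q')) - √(e + nsq (G.log hconj p q)))
      (𝓝[>] 0) (𝓝 (G.rad hconj p q' - G.rad hconj p q)) := by
    have : Continuous (fun e : ℝ =>
      √(e + nsq (G.log hconj p q')) - √(e + nsq (G.log hconj p q))) := by fun_prop
    have h2 := (this.tendsto 0).mono_left (nhdsWithin_le_nhds (s := Ioi 0))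
    simpa [rad] using h2
  exact le_of_tendsto ht (by filter_upwards [self_mem_nhdsWithin] with e he using key e he)

lemma dist_exp_le (p v : V2) : M.dist p (G.exp p v) ≤ √(nsq v) := by
  have hd : ∀ t, HasDerivAt (fun t => (G.Φ t (p, v)).1)
      (M.ev (G.Φ t (p, v)).1 (G.Φ t (p, v)).2) t := fun t => (G.hasDerivAt_Φ (p, v) t).fst_comp
  have hc : Continuous fun t => G.Φ t (p, v) :=
    continuous_iff_continuousAt.2 fun t => (G.hasDerivAt_Φ (p, v) t).continuousAt
  have hγ : ContDiff ℝ 1 (fun t => (G.Φ t (p, v)).1) := by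
    rw [contDiff_one_iff_deriv]
    refine ⟨fun t => (hd t).differentiableAt, ?_⟩
    rw [show deriv _ = _ from funext fun t => (hd t).deriv]
    exact RMetric.continuous_ev_apply hc.fst hc.snd
  refine (show M.dist p (G.exp p v) = M.dist (G.Φ 0 (p, v)).1 (G.Φ 1 (p, v)).1 by
    rw [G.Φ_zero]; rfl).trans_le ((RMetric.dist_le_curveLen hγ).trans ?_)
  unfold RMetric.curveLen
  simp_rw [vel_eq (hd _), M.met_ev_self, G.nsq_Φ]
  simp

lemma dist_eq_rad (p q : V2) : M.dist p q = G.rad hconj p q := by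
  apply le_antisymm
  · have := G.dist_exp_le p (G.log hconj p q)
    rwa [exp_log] at this
  · have := G.rad_sub_le_dist hconj p p q
    have h : G.rad hconj p p = 0 := by
      have := G.rad_exp hconj p 0
      rw [exp_zero] at this
      rw [this]; simp [nsq]
    linarith

lemma rad_Φ_le (p : V2) (t : ℝ) (y : V2 × V2) :
    G.rad hconj p (G.Φ t y).1 - G.rad hconj p y.1 ≤ |t| * √(nsq y.2) := by
  refine (G.rad_sub_le_dist hconj p _ _).trans ?_
  have := G.dist_exp_le y.1 (t • y.2)
  rw [exp_smul, nsq_smul, Real.sqrt_mul (sq_nonneg t), Real.sqrt_sq_eq_abs] at this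
  exact this

lemma abs_rad_Φ_sub_le (p : V2) (t : ℝ) (y : V2 × V2) :
    |G.rad hconj p (G.Φ t y).1 - G.rad hconj p y.1| ≤ |t| * √(nsq y.2) := by
  refine abs_sub_le_iff.2 ⟨G.rad_Φ_le hconj p t y, ?_⟩
  have := G.rad_Φ_le hconj p (-t) (G.Φ t y)
  rwa [G.Φ_add, add_neg_cancel, G.Φ_zero, abs_neg, G.nsq_Φ] at this

lemma ball_eq (p : V2) (R : ℝ) : M.ball p R = {q | G.rad hconj p q < R} := by
  ext q
  simp [RMetric.ball, G.dist_eq_rad hconj]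

lemma isCompact_rad_le (p : V2) (R : ℝ) : IsCompact {q | G.rad hconj p q ≤ R} := by
  have h1 : IsCompact (G.exp p '' (Metric.closedBall 0 (√(1 + R ^ 2)))) :=
    (isCompact_closedBall _ _).image (G.contDiff_exp p).continuous
  refine h1.of_isClosed_subset (isClosed_le (G.continuous_rad hconj p) continuous_const) ?_
  intro q hq
  refine ⟨G.log hconj p q, ?_, G.exp_log hconj p q⟩
  rw [mem_closedBall_zero_iff]
  refine (norm_le_sqrt_nsq _).trans (Real.sqrt_le_sqrt ?_)
  have h2 : G.rad hconj p q ≤ R := hq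
  have h3 : nsq (G.log hconj p q) = G.rad hconj p q ^ 2 := (Real.sq_sqrt (nsq_nonneg _)).symm
  rw [h3]
  have := G.rad_nonneg hconj p q
  gcongr

end GeoFlow

/-- The linear endomorphism of the plane with the given columns. -/
def linCols (u v : V2) : V2 →L[ℝ] V2 :=
  LinearMap.toContinuousLinearMap (Matrix.toLin' !![u 0, v 0; u 1, v 1])

lemma linCols_apply (u v h : V2) : linCols u v h = h 0 • u + h 1 • v := by
  ext i
  fin_cases i <;>
    simp [linCols, Matrix.mulVec, dotProduct, Fin.sum_univ_two] <;> ring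

lemma det_linCols (u v : V2) : (linCols u v).det = u 0 * v 1 - u 1 * v 0 := by
  have : (linCols u v).det = LinearMap.det (Matrix.toLin' !![u 0, v 0; u 1, v 1]) := rfl
  rw [this, LinearMap.det_toLin', Matrix.det_fin_two]
  simp
  ring

lemma det_comp_clm {E : Type*} [NormedAddCommGroup E] [NormedSpace ℝ E] (A B : E →L[ℝ] E) :
    (A.comp B).det = A.det * B.det :=
  LinearMap.det_comp (A : E →ₗ[ℝ] E) (B : E →ₗ[ℝ] E)

namespace RMetric

variable (M : RMetric)

/-- `RMetric.ev` as a linear map. -/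
def evL (x : V2) : V2 →L[ℝ] V2 := linCols (M.ev x ![1, 0]) (M.ev x ![0, 1])

lemma evL_apply (x w : V2) : M.evL x w = M.ev x w := by
  rw [evL, linCols_apply, ← ev_smul, ← ev_smul, ← ev_add]
  congr 1
  ext i
  fin_cases i <;> simp

lemma det_evL (x : V2) : (M.evL x).det * M.rho x = 1 := by
  have h1 := (M.fa_pos x).ne'
  have h2 := (M.fd_pos x).ne'
  rw [evL, det_linCols, rho_eq]
  simp [ev]
  field_simp

instance : IsLocallyFiniteMeasure M.area :=
   IsLocallyFiniteMeasure.withDensity_ofReal M.contDiff_rho.continuous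

end RMetric

namespace GeoFlow

variable {M : RMetric} (G : GeoFlow M) (hconj : M.NoConjugatePoints)

include hconj in
lemma abs_det_fderiv_exp (p v : V2) :
    |(fderiv ℝ (G.exp p) v).det| * M.rho (G.exp p v) = G.s 1 (p, v) := by
  suffices h : (fderiv ℝ (G.exp p) v).det * M.rho (G.exp p v) = G.s 1 (p, v) by
    have hs := G.s_pos hconj one_pos (p, v)
    rw [← abs_of_pos (M.rho_pos (G.exp p v)), ← abs_mul, h, abs_of_pos hs]
  by_cases hv : v = 0
  · subst hv
    have : fderiv ℝ (G.exp p) 0 = M.evL p := by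
      ext1 h
      rw [fderiv_exp_zero, M.evL_apply]
    rw [this, exp_zero, M.det_evL, s_zero_vec]
  set w := (G.Φ 1 (p, v)).2 with hw
  have hn : nsq w = nsq v := G.nsq_Φ 1 (p, v)
  have h : (fderiv ℝ (G.exp p) v).comp (linCols v (rot v)) =
      (M.evL (G.exp p v)).comp (linCols w (G.s 1 (p, v) • rot w)) := by
    ext1 h
    rw [ContinuousLinearMap.comp_apply, ContinuousLinearMap.comp_apply, linCols_apply,
      linCols_apply, fderiv_exp_smul_add_rot, M.evL_apply, smul_smul]
  have h2 := congrArg ContinuousLinearMap.det h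
  rw [det_comp_clm, det_comp_clm, det_linCols, det_linCols] at h2
  have h3 : v 0 * rot v 1 - v 1 * rot v 0 = nsq v := by simp [nsq]; ring
  have h4 : w 0 * (G.s 1 (p, v) • rot w) 1 - w 1 * (G.s 1 (p, v) • rot w) 0 =
      G.s 1 (p, v) * nsq v := by rw [← hn]; simp [nsq]; ring
  rw [h3, h4] at h2
  have h5 := M.det_evL (G.exp p v)
  have h6 := (nsq_pos hv).ne'
  apply mul_right_cancel₀ h6
  linear_combination M.rho (G.exp p v) * h2 + G.s 1 (p, v) * nsq v * h5

include hconj in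
lemma range_exp (p : V2) : G.exp p '' univ = univ := by
  rw [image_univ, range_eq_univ]
  exact fun q => ⟨_, G.exp_log hconj p q⟩

include hconj in
/-- Change of variables in normal coordinates. -/
lemma integral_area (p : V2) (F : V2 → ℝ) :
    ∫ q, F q ∂M.area = ∫ v, G.s 1 (p, v) * F (G.exp p v) := by
  have h1 : ∫ q, F q ∂M.area = ∫ q, M.rho q * F q := by
    have : M.area = volume.withDensity fun x => ((M.rho x).toNNReal : ℝ≥0∞) := rfl
    rw [this, integral_withDensity_eq_integral_smul
      M.contDiff_rho.continuous.measurable.real_toNNReal]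
    refine integral_congr_ae (Eventually.of_forall fun q => ?_)
    simp only [NNReal.smul_def, smul_eq_mul, Real.coe_toNNReal _ (M.rho_pos q).le]
  have h2 := integral_image_eq_integral_abs_det_fderiv_smul (volume : Measure V2) (s := univ)
    (f := G.exp p) (f' := fderiv ℝ (G.exp p)) MeasurableSet.univ
    (fun v _ => (G.hasFDerivAt_exp p v).hasFDerivWithinAt)
    (fun v _ w _ h => by rw [← G.log_exp hconj p v, h, log_exp]) (fun q => M.rho q * F q)
  rw [range_exp G hconj, Measure.restrict_univ] at h2
  rw [h1, h2]
  refine integral_congr_ae (Eventually.of_forall fun v => ?_)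
  simp only [smul_eq_mul]
  rw [← mul_assoc, G.abs_det_fderiv_exp hconj]

end GeoFlow

lemma integral_polar (φ : V2 → ℝ) :
    ∫ v, φ v = ∫ q in polarCoord.target, q.1 * φ (q.1 • ![cos q.2, sin q.2]) := by
  have h := (volume_preserving_finTwoArrow ℝ).symm.integral_comp
    (MeasurableEquiv.measurableEmbedding _) φ
  rw [← h, ← integral_comp_polarCoord_symm]
  refine integral_congr_ae (Eventually.of_forall fun q => ?_)
  simp only [smul_eq_mul]
  congr 2
  ext i
  fin_cases i <;> simp [polarCoord, MeasurableEquiv.finTwoArrow]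

/-- The unit vector of a given angle. -/
def unitDir (θ : ℝ) : V2 := ![cos θ, sin θ]

lemma nsq_unitDir (θ : ℝ) : nsq (unitDir θ) = 1 := by simp [nsq, unitDir]

lemma continuous_unitDir : Continuous unitDir := by
  refine continuous_pi fun i => ?_
  fin_cases i
  · exact continuous_cos
  · exact continuous_sin

namespace GeoFlow

variable {M : RMetric} (G : GeoFlow M) (hconj : M.NoConjugatePoints)

lemma measurableSet_ball (p : V2) (R : ℝ) : MeasurableSet {q | G.rad hconj p q < R} :=
  (isOpen_lt (G.continuous_rad hconj p) continuous_const).measurableSet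

lemma area_ball_lt_top (p : V2) (R : ℝ) : M.area {q | G.rad hconj p q < R} < ⊤ :=
  (measure_mono fun _ (h : _ < R) => h.le).trans_lt
    (G.isCompact_rad_le hconj p R).measure_lt_top

lemma integral_radial_jacobi (p : V2) (R θ : ℝ) :
    ∫ r in (0 : ℝ)..R, G.s r (p, unitDir θ) *
      ((R - r) ^ 2 / 2 * M.K (G.Φ r (p, unitDir θ)).1 + 1) = R ^ 2 / 2 := by
  have hd : ∀ r ∈ uIcc 0 R, HasDerivAt (fun r => -((R - r) ^ 2 / 2 * G.ds r (p, unitDir θ)) -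
      (R - r) * G.s r (p, unitDir θ)) (G.s r (p, unitDir θ) *
      ((R - r) ^ 2 / 2 * M.K (G.Φ r (p, unitDir θ)).1 + 1)) r := by
    intro r _
    have h0 : HasDerivAt (fun r : ℝ => R - r) (-1) r := (hasDerivAt_id r).const_sub R
    refine (((((h0.pow 2).div_const 2).mul (G.hasDerivAt_ds (p, unitDir θ) r)).neg).sub
      (h0.mul (G.hasDerivAt_s (p, unitDir θ) r))).congr_deriv ?_
    rw [G.nsq_Φ, nsq_unitDir]
    simp
    ring
  rw [intervalIntegral.integral_eq_sub_of_hasDerivAt hd]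
  · simp [G.s_zero, G.ds_zero]
  · refine Continuous.intervalIntegrable ?_ _ _
    have h1 := G.continuous_s_left (p, unitDir θ)
    have h2 : Continuous fun r => (G.Φ r (p, unitDir θ)).1 :=
      continuous_iff_continuousAt.2 fun t => (G.hasDerivAt_Φ _ t).fst_comp.continuousAt
    have h3 := M.continuous_K.comp h2
    simp only [Function.comp_def] at h3
    fun_prop

/-- Integrated second variation of the area of balls. -/
lemma integral_ball_curvature (p : V2) {R : ℝ} (hR : 0 < R) :
    ∫ q in {q | G.rad hconj p q < R}, ((R - G.rad hconj p q) ^ 2 / 2 * M.K q + 1) ∂M.area =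
      π * R ^ 2 := by
  set H : ℝ × ℝ → ℝ := fun q => G.s q.1 (p, unitDir q.2) *
    ((R - q.1) ^ 2 / 2 * M.K (G.Φ q.1 (p, unitDir q.2)).1 + 1) with hH
  have hHc : Continuous H := by
    have h0 := continuous_unitDir
    have h1 : Continuous fun q : ℝ × ℝ => (q.1, (p, unitDir q.2)) := by fun_prop
    have h2 := G.continuous_s.comp h1
    have h3 := M.continuous_K.comp (G.continuous_Φ.comp h1).fst
    simp only [Function.comp_def] at h2 h3
    fun_prop
  rw [← integral_indicator (G.measurableSet_ball hconj p R), G.integral_area hconj p,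
    integral_polar]
  have h1 : ∫ q in polarCoord.target, q.1 * (G.s 1 (p, q.1 • ![cos q.2, sin q.2]) *
      indicator {q | G.rad hconj p q < R}
        (fun q => (R - G.rad hconj p q) ^ 2 / 2 * M.K q + 1)
        (G.exp p (q.1 • ![cos q.2, sin q.2]))) =
      ∫ q in polarCoord.target, indicator {q : ℝ × ℝ | q.1 < R} H q := by
    refine setIntegral_congr_fun polarCoord.open_target.measurableSet fun q hq => ?_
    have hq0 : 0 < q.1 := hq.1
    have e1 : G.rad hconj p (G.exp p (q.1 • unitDir q.2)) = q.1 := by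
      rw [rad_exp, nsq_smul, nsq_unitDir, mul_one, Real.sqrt_sq hq0.le]
    change q.1 * (G.s 1 (p, q.1 • unitDir q.2) * indicator {q | G.rad hconj p q < R}
        (fun q => (R - G.rad hconj p q) ^ 2 / 2 * M.K q + 1)
        (G.exp p (q.1 • unitDir q.2))) = _
    rw [← mul_assoc, s_smul, mul_one]
    by_cases hqR : q.1 < R
    · rw [indicator_of_mem (show _ ∈ {q | G.rad hconj p q < R} by simpa [e1] using hqR),
        indicator_of_mem (show q ∈ {q : ℝ × ℝ | q.1 < R} from hqR), e1, exp_smul]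
    · rw [indicator_of_notMem (show _ ∉ {q | G.rad hconj p q < R} by simpa [e1] using hqR),
        indicator_of_notMem (show q ∉ {q : ℝ × ℝ | q.1 < R} from hqR), mul_zero]
  have h2 : polarCoord.target ∩ {q : ℝ × ℝ | q.1 < R} = Ioo 0 R ×ˢ Ioo (-π) π := by
    ext q
    simp [polarCoord_target]
    tauto
  rw [h1, setIntegral_indicator (measurableSet_lt measurable_fst measurable_const), h2,
    Measure.volume_eq_prod, ← setIntegral_prod_swap, setIntegral_prod]
  · have h3 : ∀ θ, ∫ r in Ioo 0 R, H (r, θ) = R ^ 2 / 2 := fun θ => by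
      rw [← integral_Ioc_eq_integral_Ioo, ← intervalIntegral.integral_of_le hR.le]
      exact G.integral_radial_jacobi p R θ
    simp only [Prod.swap_prod_mk, h3]
    simp [Real.pi_pos.le]
    ring
  · have h4 : IntegrableOn (fun z : ℝ × ℝ => H z.swap) (Icc (-π) π ×ˢ Icc 0 R)
        (volume.prod volume) :=
      (hHc.comp continuous_swap).continuousOn.integrableOn_compact (isCompact_Icc.prod isCompact_Icc)
    exact h4.mono_set (prod_mono Ioo_subset_Icc_self Ioo_subset_Icc_self)

lemma toReal_area_ball_flat (hK : ∀ q, M.K q = 0) (p : V2) {R : ℝ} (hR : 0 < R) :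
    (M.area {q | G.rad hconj p q < R}).toReal = π * R ^ 2 := by
  have := G.integral_ball_curvature hconj p hR
  simpa [hK, Measure.real] using this

end GeoFlow

lemma det_prodMap_clm (A B : V2 →L[ℝ] V2) : (A.prodMap B).det = A.det * B.det :=
  LinearMap.det_prodMap (A : V2 →ₗ[ℝ] V2) (B : V2 →ₗ[ℝ] V2)

lemma prodMap_clm_apply (A B : V2 →L[ℝ] V2) (q : V2 × V2) : A.prodMap B q = (A q.1, B q.2) := rfl

lemma det_id_clm {E : Type*} [NormedAddCommGroup E] [NormedSpace ℝ E] :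
    (ContinuousLinearMap.id ℝ E).det = 1 := LinearMap.det_id

/-- The shear of the product plane along a linear map. -/
def shear (C : V2 →L[ℝ] V2) : V2 × V2 →L[ℝ] V2 × V2 :=
  (ContinuousLinearMap.fst ℝ V2 V2).prod
    (C.comp (ContinuousLinearMap.fst ℝ V2 V2) + ContinuousLinearMap.snd ℝ V2 V2)

lemma shear_apply (C : V2 →L[ℝ] V2) (q : V2 × V2) : shear C q = (q.1, C q.1 + q.2) := rfl

lemma det_shear (C : V2 →L[ℝ] V2) : (shear C).det = 1 := by
  -- conjugating by a scaling of the second factor squares the shear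
  set P : V2 × V2 →L[ℝ] V2 × V2 :=
    (ContinuousLinearMap.id ℝ V2).prodMap ((2 : ℝ) • ContinuousLinearMap.id ℝ V2) with hP
  have hPd : P.det ≠ 0 := by
    have h2 : ((2 : ℝ) • ContinuousLinearMap.id ℝ V2) = linCols ![2, 0] ![0, 2] := by
      ext h i
      rw [linCols_apply]
      fin_cases i <;> simp <;> ring
    rw [hP, det_prodMap_clm, det_id_clm, h2, det_linCols]
    norm_num
  have h1 : P.comp (shear C) = (shear C).comp ((shear C).comp P) := by
    refine ContinuousLinearMap.ext fun q => ?_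
    simp only [ContinuousLinearMap.comp_apply, shear_apply, hP, prodMap_clm_apply]
    ext : 1
    · simp
    · simp [two_smul]
      abel
  have h0 : (shear C).comp (shear (-C)) = ContinuousLinearMap.id ℝ _ := by
    refine ContinuousLinearMap.ext fun q => ?_
    simp only [ContinuousLinearMap.comp_apply, shear_apply]
    simp
  have h3 := congrArg ContinuousLinearMap.det h1
  have h4 := congrArg ContinuousLinearMap.det h0
  simp only [det_comp_clm, det_id_clm] at h3 h4
  have h5 : (shear C).det ≠ 0 := left_ne_zero_of_mul_eq_one h4
  apply mul_left_cancel₀ (mul_ne_zero h5 hPd)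
  linear_combination -h3

/-- Regrouping of the coordinates of the product plane. -/
def regroup : V2 × V2 →L[ℝ] V2 × V2 :=
  LinearMap.toContinuousLinearMap
    { toFun := fun q => (![q.1 0, q.2 0], ![q.1 1, q.2 1])
      map_add' := fun q r => by
        ext i <;> fin_cases i <;> simp
      map_smul' := fun c q => by
        ext i <;> fin_cases i <;> simp }

lemma regroup_apply (q : V2 × V2) : regroup q = (![q.1 0, q.2 0], ![q.1 1, q.2 1]) := rfl

lemma det_regroup_ne_zero : regroup.det ≠ 0 := by
  have h0 : regroup.comp regroup = ContinuousLinearMap.id ℝ _ := by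
    refine ContinuousLinearMap.ext fun q => ?_
    simp only [ContinuousLinearMap.comp_apply, regroup_apply]
    ext i <;> fin_cases i <;> simp
  have h4 := congrArg ContinuousLinearMap.det h0
  rw [det_comp_clm, det_id_clm] at h4
  exact left_ne_zero_of_mul_eq_one h4

namespace RMetric

variable (M : RMetric)

/-- `v ↦ M.cf x v • rot v₀` as a linear map. -/
def cfL (x v : V2) : V2 →L[ℝ] V2 :=
  LinearMap.toContinuousLinearMap
    { toFun := fun w => M.cf x w • rot v
      map_add' := fun a b => by rw [cf_add, add_smul]
      map_smul' := fun a b => by rw [cf_smul, mul_smul]; rfl }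

lemma cfL_apply (x v w : V2) : M.cfL x v w = M.cf x w • rot v := rfl

/-- The moving frame of the tangent bundle given by the spray, the scaling field, the horizontal
normal field and the vertical field. -/
def frame (y : V2 × V2) : V2 × V2 →L[ℝ] V2 × V2 :=
  ((((M.evL y.1).prodMap (ContinuousLinearMap.id ℝ V2)).comp (shear (M.cfL y.1 y.2))).comp
    ((linCols y.2 (rot y.2)).prodMap (linCols y.2 (rot y.2)))).comp regroup

lemma frame_apply (y q : V2 × V2) : M.frame y q = q.1 0 • M.spray y + q.1 1 • ((0 : V2), y.2) +
    q.2 0 • M.horiz y + q.2 1 • vert y := by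
  simp only [frame, ContinuousLinearMap.comp_apply, regroup_apply,
    prodMap_clm_apply, shear_apply, linCols_apply, evL_apply,
    cfL_apply, ev_add, ev_smul, cf_add, cf_smul, add_smul, ContinuousLinearMap.id_apply]
  ext : 1
  · simp [spray, horiz, vert, fld]
  · simp [spray, horiz, vert, fld, mul_smul]
    abel

lemma det_frame (y : V2 × V2) :
    (M.frame y).det * M.rho y.1 = nsq y.2 ^ 2 * regroup.det := by
  have h3 : y.2 0 * rot y.2 1 - y.2 1 * rot y.2 0 = nsq y.2 := by simp [nsq]; ring
  simp only [frame, det_comp_clm, det_prodMap_clm, det_id_clm, det_shear, det_linCols, h3]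
  linear_combination nsq y.2 ^ 2 * regroup.det * M.det_evL y.1

/-- The Liouville measure on the tangent bundle in frame coordinates. -/
def liou : Measure (V2 × V2) := M.area.prod volume

lemma liou_eq : M.liou = (volume : Measure (V2 × V2)).withDensity
    fun y => ENNReal.ofReal (M.rho y.1) := by
  rw [liou, Measure.volume_eq_prod]
  exact prod_withDensity_left (M.contDiff_rho.continuous.measurable.ennreal_ofReal)

end RMetric

namespace GeoFlow

variable {M : RMetric} (G : GeoFlow M)

lemma det_fderiv_Φ_of_ne {y : V2 × V2} (hy : y.2 ≠ 0) (t : ℝ) :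
    (fderiv ℝ (G.Φ t) y).det * M.rho (G.Φ t y).1 = M.rho y.1 := by
  set B : V2 × V2 →L[ℝ] V2 × V2 := (linCols ![1, 0] ![t, 1]).prodMap
    (linCols ![G.c t y, G.dc t y] ![G.s t y, G.ds t y]) with hB
  have hBd : B.det = 1 := by
    rw [hB, det_prodMap_clm, det_linCols, det_linCols]
    simp
    linear_combination G.wronskian t y
  have h : (fderiv ℝ (G.Φ t) y).comp (M.frame y) = (M.frame (G.Φ t y)).comp B := by
    refine ContinuousLinearMap.ext fun q => ?_
    simp only [ContinuousLinearMap.comp_apply, M.frame_apply, map_add, map_smul, fderiv_Φ_spray,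
      fderiv_Φ_scaling, fderiv_Φ_horiz, fderiv_Φ_vert, hB, prodMap_clm_apply,
      linCols_apply]
    simp
    module
  have h1 := congrArg ContinuousLinearMap.det h
  rw [det_comp_clm, det_comp_clm, hBd] at h1
  have h2 := M.det_frame y
  have h3 := M.det_frame (G.Φ t y)
  rw [G.nsq_Φ] at h3
  have h4 : nsq y.2 ^ 2 * regroup.det ≠ 0 :=
    mul_ne_zero (pow_ne_zero 2 (nsq_pos hy).ne') det_regroup_ne_zero
  apply mul_right_cancel₀ h4
  linear_combination M.rho (G.Φ t y).1 * M.rho y.1 * h1 -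
    (fderiv ℝ (G.Φ t) y).det * M.rho (G.Φ t y).1 * h2 + M.rho y.1 * h3

lemma det_fderiv_Φ (y : V2 × V2) (t : ℝ) :
    (fderiv ℝ (G.Φ t) y).det * M.rho (G.Φ t y).1 = M.rho y.1 := by
  have hd : Dense {y : V2 × V2 | y.2 ≠ 0} := by
    have := (dense_univ (X := V2)).prod (dense_compl_singleton (0 : V2))
    convert this using 1
    ext y
    simp
  have hΦ : Continuous (G.Φ t) := (G.contDiff_Φ t).continuous
  have h1 : Continuous fun y => (fderiv ℝ (G.Φ t) y).det * M.rho (G.Φ t y).1 :=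
    (ContinuousLinearMap.continuous_det.comp ((G.contDiff_Φ t).continuous_fderiv (by simp))).mul
      (M.contDiff_rho.continuous.comp hΦ.fst)
  have h2 : Continuous fun y : V2 × V2 => M.rho y.1 :=
    M.contDiff_rho.continuous.comp continuous_fst
  exact congrFun (Continuous.ext_on hd h1 h2 fun y hy => G.det_fderiv_Φ_of_ne hy t) y

lemma Φ_neg_Φ (t : ℝ) (y : V2 × V2) : G.Φ (-t) (G.Φ t y) = y := by
  rw [G.Φ_add, add_neg_cancel, G.Φ_zero]

lemma Φ_Φ_neg (t : ℝ) (y : V2 × V2) : G.Φ t (G.Φ (-t) y) = y := by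
  rw [G.Φ_add, neg_add_cancel, G.Φ_zero]

/-- Liouville's theorem. -/
lemma measurePreserving_Φ (t : ℝ) : MeasurePreserving (G.Φ t) M.liou M.liou := by
  have hc : Continuous (G.Φ t) := (G.contDiff_Φ t).continuous
  refine ⟨hc.measurable, Measure.ext fun A hA => ?_⟩
  have hr : G.Φ t '' (G.Φ t ⁻¹' A) = A :=
    image_preimage_eq A fun y => ⟨_, G.Φ_Φ_neg t y⟩
  rw [Measure.map_apply hc.measurable hA, M.liou_eq, withDensity_apply _ (hc.measurable hA),
    withDensity_apply _ hA]
  have : (volume : Measure (V2 × V2)).IsAddHaarMeasure :=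
    Measure.prod.instIsAddHaarMeasure (volume : Measure V2) (volume : Measure V2)
  have h := lintegral_image_eq_lintegral_abs_det_fderiv_mul (volume : Measure (V2 × V2))
    (s := G.Φ t ⁻¹' A) (f := G.Φ t) (f' := fderiv ℝ (G.Φ t)) (hc.measurable hA)
    (fun y _ => (G.hasFDerivAt_Φ t y).hasFDerivWithinAt)
    (fun y _ z _ h => by rw [← G.Φ_neg_Φ t y, h, Φ_neg_Φ])
    (fun y => ENNReal.ofReal (M.rho y.1))
  rw [hr] at h
  rw [h]
  refine lintegral_congr fun y => ?_
  rw [← ENNReal.ofReal_mul (abs_nonneg _)]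
  congr 1
  rw [← abs_of_pos (M.rho_pos (G.Φ t y).1), ← abs_mul, G.det_fderiv_Φ, abs_of_pos (M.rho_pos _)]

end GeoFlow

namespace GeoFlow

variable {M : RMetric} (G : GeoFlow M)

/-- The initial slope of the Jacobi field with value one at time zero which vanishes at `T`. -/
def slp (T : ℝ) (y : V2 × V2) : ℝ := -G.c T y / G.s T y

/-- The Jacobi field with initial value one and initial slope `a`. -/
def jac (a : ℝ) (y : V2 × V2) (t : ℝ) : ℝ := G.c t y + a * G.s t y

/-- The derivative of `GeoFlow.jac`. -/
def djac (a : ℝ) (y : V2 × V2) (t : ℝ) : ℝ := G.dc t y + a * G.ds t y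

lemma jac_zero (a : ℝ) (y : V2 × V2) : G.jac a y 0 = 1 := by simp [jac, c_zero, s_zero]

lemma hasDerivAt_jac (a : ℝ) (y : V2 × V2) (t : ℝ) :
    HasDerivAt (G.jac a y) (G.djac a y t) t :=
  (G.hasDerivAt_c y t).add ((G.hasDerivAt_s y t).const_mul a)

lemma hasDerivAt_djac (a : ℝ) (y : V2 × V2) (t : ℝ) :
    HasDerivAt (G.djac a y) (-(nsq (G.Φ t y).2 * M.K (G.Φ t y).1) * G.jac a y t) t :=
  ((G.hasDerivAt_dc y t).add ((G.hasDerivAt_ds y t).const_mul a)).congr_deriv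
    (by rw [jac]; ring)

lemma jac_add (a : ℝ) (y : V2 × V2) (r t : ℝ) : G.jac a y (r + t) =
    G.jac a y r * G.c t (G.Φ r y) + G.djac a y r * G.s t (G.Φ r y) :=
  G.solution_shift (G.hasDerivAt_jac a y) (G.hasDerivAt_djac a y) r t

variable (hconj : M.NoConjugatePoints)
include hconj

lemma jac_slp {T : ℝ} (hT : T ≠ 0) (y : V2 × V2) : G.jac (G.slp T y) y T = 0 := by
  have := G.s_ne_zero hconj hT y
  rw [jac, slp]
  field_simp
  ring

lemma jac_slp_pos_of_lt {T t : ℝ} (hT : 0 < T) (ht : t < T) (y : V2 × V2) :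
    0 < G.jac (G.slp T y) y t := by
  have h0 := G.jac_slp hconj hT.ne' y
  have h1 := G.jac_add (G.slp T y) y T (-T)
  have h2 := G.jac_add (G.slp T y) y T (t - T)
  have h3 := G.s_neg hconj (t := -T) (by linarith) (G.Φ T y)
  have h4 := G.s_neg hconj (t := t - T) (by linarith) (G.Φ T y)
  rw [h0, add_neg_cancel, jac_zero] at h1
  rw [h0, add_sub_cancel] at h2
  rw [h2]
  have h5 : G.djac (G.slp T y) y T < 0 := by
    by_contra! h
    nlinarith
  nlinarith

lemma jac_slp_pos_of_gt {T t : ℝ} (hT : T < 0) (ht : T < t) (y : V2 × V2) :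
    0 < G.jac (G.slp T y) y t := by
  have h0 := G.jac_slp hconj hT.ne y
  have h1 := G.jac_add (G.slp T y) y T (-T)
  have h2 := G.jac_add (G.slp T y) y T (t - T)
  have h3 := G.s_pos hconj (t := -T) (by linarith) (G.Φ T y)
  have h4 := G.s_pos hconj (t := t - T) (by linarith) (G.Φ T y)
  rw [h0, add_neg_cancel, jac_zero] at h1
  rw [h0, add_sub_cancel] at h2
  rw [h2]
  have h5 : 0 < G.djac (G.slp T y) y T := by
    by_contra! h
    nlinarith
  nlinarith

lemma slp_lt_of_jac_pos {a t : ℝ} {y : V2 × V2} (ht : 0 < t) (h : 0 < G.jac a y t) :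
    G.slp t y < a := by
  rw [slp, div_lt_iff₀ (G.s_pos hconj ht y)]
  rw [jac] at h
  linarith

lemma lt_slp_of_jac_pos {a t : ℝ} {y : V2 × V2} (ht : t < 0) (h : 0 < G.jac a y t) :
    a < G.slp t y := by
  rw [slp, lt_div_iff_of_neg (G.s_neg hconj ht y)]
  rw [jac] at h
  linarith

lemma jac_pos_of_slp_lt {a t : ℝ} {y : V2 × V2} (ht : 0 < t) (h : G.slp t y < a) :
    0 < G.jac a y t := by
  rw [slp, div_lt_iff₀ (G.s_pos hconj ht y)] at h
  rw [jac]
  linarith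

lemma jac_pos_of_lt_slp {a t : ℝ} {y : V2 × V2} (ht : t < 0) (h : a < G.slp t y) :
    0 < G.jac a y t := by
  rw [slp, lt_div_iff_of_neg (G.s_neg hconj ht y)] at h
  rw [jac]
  linarith

lemma slp_lt_slp {S T : ℝ} (hS : 0 < S) (hST : S < T) (y : V2 × V2) : G.slp S y < G.slp T y :=
  G.slp_lt_of_jac_pos hconj hS (G.jac_slp_pos_of_lt hconj (hS.trans hST) hST y)

lemma slp_lt_slp_of_neg {S T : ℝ} (hT : T < 0) (hST : S < T) (y : V2 × V2) :
    G.slp S y < G.slp T y :=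
  G.lt_slp_of_jac_pos hconj hT (G.jac_slp_pos_of_gt hconj (hST.trans hT) hST y)

lemma slp_pos_lt_slp_neg {S T : ℝ} (hS : S < 0) (hT : 0 < T) (y : V2 × V2) :
    G.slp T y < G.slp S y :=
  G.slp_lt_of_jac_pos hconj hT (G.jac_slp_pos_of_gt hconj hS (hS.trans hT) y)

omit hconj in
/-- The limit slope of E. Hopf. -/
def hopf (y : V2 × V2) : ℝ := ⨆ n : ℕ, G.slp (n + 1) y

lemma bddAbove_slp (y : V2 × V2) : BddAbove (range fun n : ℕ => G.slp (n + 1) y) := by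
  refine ⟨G.slp (-1) y, ?_⟩
  rintro _ ⟨n, rfl⟩
  exact (G.slp_pos_lt_slp_neg hconj (by norm_num) (by positivity) y).le

lemma slp_lt_hopf {T : ℝ} (hT : 0 < T) (y : V2 × V2) : G.slp T y < G.hopf y := by
  obtain ⟨n, hn⟩ := exists_nat_gt T
  refine (G.slp_lt_slp hconj hT (T := n + 1) (by linarith) y).trans_le ?_
  exact le_ciSup (G.bddAbove_slp hconj y) n

lemma hopf_lt_slp {S : ℝ} (hS : S < 0) (y : V2 × V2) : G.hopf y < G.slp S y := by
  refine lt_of_le_of_lt (ciSup_le fun n => ?_)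
    (G.slp_lt_slp_of_neg hconj hS (S := S - 1) (by linarith) y)
  exact (G.slp_pos_lt_slp_neg hconj (by linarith) (by positivity) y).le

lemma tendsto_slp (y : V2 × V2) : Tendsto (fun T => G.slp T y) atTop (𝓝 (G.hopf y)) := by
  rw [tendsto_order]
  constructor
  · intro a ha
    obtain ⟨n, hn⟩ := exists_lt_of_lt_ciSup ha
    filter_upwards [eventually_gt_atTop ((n : ℝ) + 1)] with T hT
    exact hn.trans (G.slp_lt_slp hconj (by positivity) hT y)
  · intro a ha
    filter_upwards [eventually_gt_atTop (0 : ℝ)] with T hT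
    exact (G.slp_lt_hopf hconj hT y).trans ha

lemma continuous_slp {T : ℝ} (hT : T ≠ 0) : Continuous (G.slp T) := by
  have h1 : Continuous (G.c T) := G.continuous_c.comp (continuous_const.prodMk continuous_id)
  have h2 : Continuous (G.s T) := G.continuous_s.comp (continuous_const.prodMk continuous_id)
  exact h1.neg.div h2 (G.s_ne_zero hconj hT)

lemma measurable_hopf : Measurable G.hopf := by
  have h : Tendsto (fun (n : ℕ) y => G.slp ((n : ℝ) + 1) y) atTop (𝓝 G.hopf) := by
    rw [tendsto_pi_nhds]
    intro y
    exact (G.tendsto_slp hconj y).comp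
      (tendsto_atTop_add_const_right _ _ tendsto_natCast_atTop_atTop)
  exact measurable_of_tendsto_metrizable
    (fun n => (G.continuous_slp hconj (by positivity)).measurable) h

lemma exists_hopf_bound {S : Set (V2 × V2)} (hS : IsCompact S) :
    ∃ C, 0 ≤ C ∧ ∀ y ∈ S, |G.hopf y| ≤ C := by
  obtain ⟨a, ha⟩ := hS.exists_bound_of_continuousOn
    (G.continuous_slp hconj (T := 1) one_ne_zero).continuousOn
  obtain ⟨b, hb⟩ := hS.exists_bound_of_continuousOn
    (G.continuous_slp hconj (T := -1) (by norm_num)).continuousOn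
  refine ⟨|a| + |b|, by positivity, fun y hy => ?_⟩
  have h1 := G.slp_lt_hopf hconj one_pos y
  have h2 := G.hopf_lt_slp hconj (S := -1) (by norm_num) y
  have h3 := abs_le.1 ((ha y hy).trans (le_abs_self a))
  have h4 := abs_le.1 ((hb y hy).trans (le_abs_self b))
  rw [abs_le]
  constructor
  · linarith [h3.1, abs_nonneg b]
  · linarith [h4.2, abs_nonneg a]

lemma jac_hopf_pos (y : V2 × V2) (t : ℝ) : 0 < G.jac (G.hopf y) y t := by
  rcases lt_trichotomy t 0 with h | h | h
  · exact G.jac_pos_of_lt_slp hconj h (G.hopf_lt_slp hconj h y)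
  · rw [h, jac_zero]
    exact one_pos
  · exact G.jac_pos_of_slp_lt hconj h (G.slp_lt_hopf hconj h y)

lemma slp_Φ {T r : ℝ} (hT : 0 < T) (hr : 0 < T + r) (y : V2 × V2) : G.slp T (G.Φ r y) =
    G.djac (G.slp (T + r) y) y r / G.jac (G.slp (T + r) y) y r := by
  have h0 := G.jac_slp hconj hr.ne' y
  have h1 := G.jac_add (G.slp (T + r) y) y r T
  rw [add_comm r T, h0] at h1
  have h2 := G.jac_slp_pos_of_lt hconj hr (t := r) (by linarith) y
  have h3 := G.s_pos hconj hT (G.Φ r y)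
  rw [slp, div_eq_div_iff h3.ne' h2.ne']
  linarith

lemma hopf_Φ (r : ℝ) (y : V2 × V2) : G.hopf (G.Φ r y) =
    G.djac (G.hopf y) y r / G.jac (G.hopf y) y r := by
  have h1 := G.tendsto_slp hconj (G.Φ r y)
  have h2 : Tendsto (fun T => G.slp (T + r) y) atTop (𝓝 (G.hopf y)) :=
    (G.tendsto_slp hconj y).comp (tendsto_atTop_add_const_right _ _ tendsto_id)
  have h3 : Tendsto (fun T => G.djac (G.slp (T + r) y) y r / G.jac (G.slp (T + r) y) y r) atTop
      (𝓝 (G.djac (G.hopf y) y r / G.jac (G.hopf y) y r)) :=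
    ((h2.mul_const _).const_add _).div ((h2.mul_const _).const_add _)
      (G.jac_hopf_pos hconj y r).ne'
  refine tendsto_nhds_unique (h1.congr' ?_) h3
  filter_upwards [eventually_gt_atTop |r|] with T hT
  exact G.slp_Φ hconj ((abs_nonneg r).trans_lt hT) (by linarith [neg_abs_le r]) y

/-- The Riccati equation. -/
lemma hasDerivAt_hopf (y : V2 × V2) (t : ℝ) : HasDerivAt (fun t => G.hopf (G.Φ t y))
    (-G.hopf (G.Φ t y) ^ 2 - nsq y.2 * M.K (G.Φ t y).1) t := by
  have h0 := (G.jac_hopf_pos hconj y t).ne'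
  have h1 := (G.hasDerivAt_djac (G.hopf y) y t).div (G.hasDerivAt_jac (G.hopf y) y t) h0
  rw [show (fun t => G.hopf (G.Φ t y)) = _ from funext fun t => G.hopf_Φ hconj t y]
  refine h1.congr_deriv ?_
  rw [G.nsq_Φ, G.hopf_Φ hconj]
  field_simp
  ring

end GeoFlow

lemma isCompact_nsq_le (r : ℝ) : IsCompact {v : V2 | nsq v ≤ r} := by
  refine Metric.isCompact_of_isClosed_isBounded (isClosed_le continuous_nsq continuous_const) ?_
  refine (Metric.isBounded_iff_subset_closedBall 0).2 ⟨√(1 + r), fun v hv => ?_⟩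
  rw [mem_closedBall_zero_iff]
  exact (GeoFlow.norm_le_sqrt_nsq v).trans (Real.sqrt_le_sqrt (by simpa using hv))

lemma measurableSet_nsq_lt (r : ℝ) : MeasurableSet {v : V2 | nsq v < r} :=
  (isOpen_lt continuous_nsq continuous_const).measurableSet

/-- Integration of a radial function over the unit disc. -/
lemma integral_disc (f : ℝ → ℝ) :
    ∫ v in {v : V2 | nsq v < 1}, f (nsq v) = 2 * π * ∫ r in (0 : ℝ)..1, r * f (r ^ 2) := by
  rw [← integral_indicator (measurableSet_nsq_lt 1), integral_polar]
  have h1 : ∀ q : ℝ × ℝ, nsq (q.1 • ![cos q.2, sin q.2]) = q.1 ^ 2 := fun q => by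
    rw [nsq_smul]
    have := nsq_unitDir q.2
    rw [unitDir] at this
    rw [this, mul_one]
  have h2 : ∀ q : ℝ × ℝ, q.1 * indicator {v : V2 | nsq v < 1} (fun v => f (nsq v))
      (q.1 • ![cos q.2, sin q.2]) =
      (indicator {r : ℝ | r ^ 2 < 1} (fun r => r * f (r ^ 2)) q.1) * (fun _ => (1 : ℝ)) q.2 := by
    intro q
    simp only [indicator, mem_ofPred_eq, h1]
    split_ifs <;> simp
  simp only [h2]
  rw [polarCoord_target, Measure.volume_eq_prod, setIntegral_prod_mul
    (f := indicator {r : ℝ | r ^ 2 < 1} (fun r => r * f (r ^ 2))) (g := fun _ => (1 : ℝ))]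
  have h3 : MeasurableSet {r : ℝ | r ^ 2 < 1} :=
    (isOpen_lt (by fun_prop) continuous_const).measurableSet
  have h4 : Ioi (0 : ℝ) ∩ {r : ℝ | r ^ 2 < 1} = Ioo 0 1 := by
    ext r
    simp only [mem_inter_iff, mem_Ioi, mem_ofPred_eq, mem_Ioo]
    refine and_congr_right fun h => ?_
    rw [sq_lt_one_iff₀ h.le]
  rw [setIntegral_indicator h3, h4, intervalIntegral.integral_of_le zero_le_one,
    integral_Ioc_eq_integral_Ioo]
  have h5 : ∫ _ in Ioo (-π) π, (1 : ℝ) = 2 * π := by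
    simp [Real.pi_pos.le]
    ring
  rw [h5]
  ring

lemma volume_disc : volume {v : V2 | nsq v < 1} = ENNReal.ofReal π := by
  have h := integral_disc fun _ => 1
  have h1 : ∫ r in (0 : ℝ)..1, r * (1 : ℝ) = 1 / 2 := by simp [integral_id]
  have h2 : volume {v : V2 | nsq v < 1} ≠ ⊤ :=
    ((measure_mono fun v (hv : nsq v < 1) => hv.le).trans_lt
      (isCompact_nsq_le 1).measure_lt_top).ne
  rw [h1] at h
  simp only [integral_const, MeasurableSet.univ, measureReal_restrict_apply, univ_inter,
    smul_eq_mul, mul_one] at h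
  rw [← ENNReal.ofReal_toReal h2]
  congr 1
  rw [Measure.real] at h
  rw [h]
  ring

lemma integral_nsq_disc : ∫ v in {v : V2 | nsq v < 1}, nsq v = π / 2 := by
  have h := integral_disc id
  simp only [id] at h
  rw [h]
  have h1 : ∀ r : ℝ, r * r ^ 2 = r ^ 3 := fun r => by ring
  simp only [h1, integral_pow]
  norm_num
  ring

namespace RMetric

variable (M : RMetric)

/-- The Liouville measure on the unit disc bundle. -/
def liouDisc : Measure (V2 × V2) := M.liou.restrict {y | nsq y.2 < 1}

lemma measurableSet_discBundle : MeasurableSet {y : V2 × V2 | nsq y.2 < 1} :=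
  (isOpen_lt (continuous_nsq.comp continuous_snd) continuous_const).measurableSet

lemma liouDisc_eq : M.liouDisc = M.area.prod (volume.restrict {v : V2 | nsq v < 1}) := by
  have h : {y : V2 × V2 | nsq y.2 < 1} = univ ×ˢ {v : V2 | nsq v < 1} := by
    ext y; simp
  rw [liouDisc, h, liou, ← Measure.prod_restrict, Measure.restrict_univ]

lemma ae_liouDisc : ∀ᵐ y ∂M.liouDisc, nsq y.2 < 1 := ae_restrict_mem measurableSet_discBundle

instance : IsFiniteMeasure ((volume : Measure V2).restrict {v : V2 | nsq v < 1}) :=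
  ⟨by rw [Measure.restrict_apply_univ, volume_disc]; exact ENNReal.ofReal_lt_top⟩

lemma liouDisc_fst_preimage {S : Set V2} :
    M.liouDisc {y | y.1 ∈ S} = M.area S * ENNReal.ofReal π := by
  have h : {y : V2 × V2 | y.1 ∈ S} = S ×ˢ univ := by ext y; simp
  rw [liouDisc_eq, h, Measure.prod_prod, Measure.restrict_apply_univ, volume_disc]

end RMetric

namespace GeoFlow

variable {M : RMetric} (G : GeoFlow M)

lemma measurePreserving_Φ_disc (t : ℝ) :
    MeasurePreserving (G.Φ t) M.liouDisc M.liouDisc := by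
  have h := (G.measurePreserving_Φ t).restrict_preimage RMetric.measurableSet_discBundle
  have h1 : G.Φ t ⁻¹' {y : V2 × V2 | nsq y.2 < 1} = {y | nsq y.2 < 1} := by
    ext y
    simp [G.nsq_Φ]
  rwa [h1] at h

variable (hconj : M.NoConjugatePoints) (p : V2)

lemma integrable_of_rad_support {f : V2 × V2 → ℝ} (hm : Measurable f) (R C : ℝ)
    (hb : ∀ y : V2 × V2, nsq y.2 < 1 → G.rad hconj p y.1 ≤ R → |f y| ≤ C)
    (h0 : ∀ y : V2 × V2, nsq y.2 < 1 → R < G.rad hconj p y.1 → f y = 0) :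
    Integrable f M.liouDisc := by
  have hS : MeasurableSet {y : V2 × V2 | y.1 ∈ {q | G.rad hconj p q ≤ R}} :=
    measurable_fst (isClosed_le (G.continuous_rad hconj p) continuous_const).measurableSet
  refine Integrable.mono' (g := indicator {y : V2 × V2 | y.1 ∈ {q | G.rad hconj p q ≤ R}}
    fun _ => C) ?_ hm.aestronglyMeasurable ?_
  · refine (integrable_indicator_iff hS).2 (integrableOn_const ?_)
    rw [M.liouDisc_fst_preimage]
    exact ENNReal.mul_ne_top (G.isCompact_rad_le hconj p R).measure_lt_top.ne ENNReal.ofReal_ne_top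
  · filter_upwards [M.ae_liouDisc] with y hy
    by_cases h : G.rad hconj p y.1 ≤ R
    · rw [indicator_of_mem (by exact h), Real.norm_eq_abs]
      exact hb y hy h
    · rw [indicator_of_notMem (by exact h), h0 y hy (not_le.1 h)]
      simp

/-- The truncated distance to the boundary of the ball of radius `R`. -/
def cut (R : ℝ) (q : V2) : ℝ := max (R - G.rad hconj p q) 0

lemma continuous_cut (R : ℝ) : Continuous (G.cut hconj p R) :=
  (continuous_const.sub (G.continuous_rad hconj p)).max continuous_const

lemma cut_nonneg (R : ℝ) (q : V2) : 0 ≤ G.cut hconj p R q := le_max_right _ _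

lemma cut_le {R : ℝ} (hR : 0 ≤ R) (q : V2) : G.cut hconj p R q ≤ R :=
  max_le (by linarith [G.rad_nonneg hconj p q]) hR

lemma cut_of_le {R : ℝ} {q : V2} (h : R ≤ G.rad hconj p q) : G.cut hconj p R q = 0 :=
  max_eq_right (by linarith)

lemma cut_of_lt {R : ℝ} {q : V2} (h : G.rad hconj p q < R) :
    G.cut hconj p R q = R - G.rad hconj p q :=
  max_eq_left (by linarith)

lemma abs_rad_Φ_sub_le_of_disc (t : ℝ) {y : V2 × V2} (hy : nsq y.2 < 1) :
    |G.rad hconj p (G.Φ t y).1 - G.rad hconj p y.1| ≤ |t| := by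
  refine (G.abs_rad_Φ_sub_le hconj p t y).trans (mul_le_of_le_one_right (abs_nonneg t) ?_)
  exact (Real.sqrt_le_sqrt hy.le).trans_eq Real.sqrt_one

lemma abs_cut_Φ_sub_le (R t : ℝ) {y : V2 × V2} (hy : nsq y.2 < 1) :
    |G.cut hconj p R (G.Φ t y).1 - G.cut hconj p R y.1| ≤ |t| := by
  refine (abs_max_sub_max_le_abs _ _ _).trans ?_
  have := G.abs_rad_Φ_sub_le_of_disc hconj p t hy
  rwa [sub_sub_sub_cancel_left, abs_sub_comm]

lemma exists_hopf_rad_bound (R : ℝ) : ∃ C, 0 ≤ C ∧ ∀ y : V2 × V2, nsq y.2 < 1 →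
    G.rad hconj p y.1 ≤ R → |G.hopf y| ≤ C := by
  obtain ⟨C, hC, h⟩ := G.exists_hopf_bound hconj
    ((G.isCompact_rad_le hconj p R).prod (isCompact_nsq_le 1))
  exact ⟨C, hC, fun y h1 h2 => h y ⟨h2, h1.le⟩⟩

lemma exists_curvature_rad_bound (R : ℝ) : ∃ C, 0 ≤ C ∧ ∀ q,
    G.rad hconj p q ≤ R → |M.K q| ≤ C := by
  obtain ⟨C, hC⟩ := (G.isCompact_rad_le hconj p R).exists_bound_of_continuousOn
    M.continuous_K.continuousOn
  exact ⟨max C 0, le_max_right _ _, fun q hq => (hC q hq).trans (le_max_left _ _)⟩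

end GeoFlow

namespace GeoFlow

variable {M : RMetric} (G : GeoFlow M)

variable (hconj : M.NoConjugatePoints) (p : V2)

include hconj in
lemma continuous_hopf_Φ (y : V2 × V2) : Continuous fun t => G.hopf (G.Φ t y) :=
  continuous_iff_continuousAt.2 fun t => (G.hasDerivAt_hopf hconj y t).continuousAt

lemma continuous_Φ_time (y : V2 × V2) : Continuous fun t => G.Φ t y :=
  continuous_iff_continuousAt.2 fun t => (G.hasDerivAt_Φ y t).continuousAt

lemma continuous_Φ_state (t : ℝ) : Continuous (G.Φ t) := (G.contDiff_Φ t).continuous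

lemma exists_hopf_lipschitz (R : ℝ) : ∃ C, 0 ≤ C ∧ ∀ y : V2 × V2, nsq y.2 < 1 →
    G.rad hconj p y.1 ≤ R → ∀ t, 0 ≤ t → t ≤ 1 → |G.hopf (G.Φ t y) - G.hopf y| ≤ C * t := by
  obtain ⟨A, hA, hA'⟩ := G.exists_hopf_rad_bound hconj p (R + 1)
  obtain ⟨B, hB, hB'⟩ := G.exists_curvature_rad_bound hconj p (R + 1)
  refine ⟨A ^ 2 + B, by positivity, fun y hy hr t ht ht1 => ?_⟩
  have h := norm_image_sub_le_of_norm_deriv_le_segment' (f := fun t => G.hopf (G.Φ t y))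
    (C := A ^ 2 + B) (a := 0) (b := t)
    (fun s _ => (G.hasDerivAt_hopf hconj y s).hasDerivWithinAt) (fun s hs => ?_) t ⟨ht, le_rfl⟩
  · simpa [G.Φ_zero] using h
  have h1 := (abs_le.1 (G.abs_rad_Φ_sub_le_of_disc hconj p s hy)).2
  have h2 : G.rad hconj p (G.Φ s y).1 ≤ R + 1 := by
    rw [abs_of_nonneg hs.1] at h1
    linarith [hs.2]
  have h3 := hA' (G.Φ s y) (by rwa [G.nsq_Φ]) h2
  have h4 := hB' _ h2
  have h5 : G.hopf (G.Φ s y) ^ 2 ≤ A ^ 2 := sq_le_sq.2 (by rwa [abs_of_nonneg hA])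
  have h6 : nsq y.2 * |M.K (G.Φ s y).1| ≤ B :=
    (mul_le_of_le_one_left (abs_nonneg _) hy.le).trans h4
  rw [Real.norm_eq_abs]
  refine (abs_sub _ _).trans ?_
  rw [abs_neg, abs_mul, abs_of_nonneg (nsq_nonneg _), abs_of_nonneg (sq_nonneg _)]
  exact add_le_add h5 h6

lemma measurable_cut_fst (R : ℝ) : Measurable fun y : V2 × V2 => G.cut hconj p R y.1 :=
  ((G.continuous_cut hconj p R).comp continuous_fst).measurable

lemma integrable_cut_hopf (R : ℝ) :
    Integrable (fun y => G.cut hconj p R y.1 * |G.hopf y|) M.liouDisc := by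
  obtain ⟨A, hA, hA'⟩ := G.exists_hopf_rad_bound hconj p R
  refine G.integrable_of_rad_support hconj p (R := R) (C := |R| * A)
    ((G.measurable_cut_fst hconj p R).mul (G.measurable_hopf hconj).norm) ?_ ?_
  · intro y hy hr
    rw [abs_mul, abs_abs]
    refine mul_le_mul ?_ (hA' y hy hr) (abs_nonneg _) (abs_nonneg _)
    rw [abs_of_nonneg (G.cut_nonneg hconj p R _)]
    exact max_le (by linarith [G.rad_nonneg hconj p y.1, le_abs_self R]) (abs_nonneg _)
  · intro y hy hr
    rw [G.cut_of_le hconj p hr.le, zero_mul]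

lemma integrable_cut_sq_mul (R : ℝ) {f : V2 × V2 → ℝ} (hf : Measurable f) {C : ℝ}
    (hC : ∀ y : V2 × V2, nsq y.2 < 1 → G.rad hconj p y.1 ≤ R → |f y| ≤ C) :
    Integrable (fun y => G.cut hconj p R y.1 ^ 2 / 2 * f y) M.liouDisc := by
  refine G.integrable_of_rad_support hconj p (R := R) (C := |R| ^ 2 / 2 * C)
    ((((G.measurable_cut_fst hconj p R).pow_const 2).div_const 2).mul hf) ?_ ?_
  · intro y hy hr
    have h1 : G.cut hconj p R y.1 ≤ |R| :=
      max_le (by linarith [G.rad_nonneg hconj p y.1, le_abs_self R]) (abs_nonneg _)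
    have h2 := G.cut_nonneg hconj p R y.1
    rw [abs_mul, abs_of_nonneg (by positivity)]
    exact mul_le_mul (by gcongr) (hC y hy hr) (abs_nonneg _) (by positivity)
  · intro y hy hr
    rw [G.cut_of_le hconj p hr.le]
    ring

lemma integrable_cut_sq_hopf (R : ℝ) :
    Integrable (fun y => G.cut hconj p R y.1 ^ 2 / 2 * G.hopf y) M.liouDisc := by
  obtain ⟨A, hA, hA'⟩ := G.exists_hopf_rad_bound hconj p R
  exact G.integrable_cut_sq_mul hconj p R (G.measurable_hopf hconj) hA'

lemma integrable_cut_sq_hopf_sq (R : ℝ) :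
    Integrable (fun y => G.cut hconj p R y.1 ^ 2 / 2 * G.hopf y ^ 2) M.liouDisc := by
  obtain ⟨A, hA, hA'⟩ := G.exists_hopf_rad_bound hconj p R
  refine G.integrable_cut_sq_mul hconj p R ((G.measurable_hopf hconj).pow_const 2) (C := A ^ 2)
    fun y hy hr => ?_
  rw [abs_of_nonneg (sq_nonneg _)]
  exact sq_le_sq.2 ((hA' y hy hr).trans (le_abs_self A))

lemma measurable_nsq_curvature : Measurable fun y : V2 × V2 => nsq y.2 * M.K y.1 :=
  ((continuous_nsq.comp continuous_snd).mul (M.continuous_K.comp continuous_fst)).measurable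

lemma integrable_cut_sq_curvature (R : ℝ) :
    Integrable (fun y => G.cut hconj p R y.1 ^ 2 / 2 * (nsq y.2 * M.K y.1)) M.liouDisc := by
  obtain ⟨A, hA, hA'⟩ := G.exists_curvature_rad_bound hconj p R
  refine G.integrable_cut_sq_mul hconj p R measurable_nsq_curvature (C := A) fun y hy hr => ?_
  rw [abs_mul, abs_of_nonneg (nsq_nonneg _)]
  exact (mul_le_of_le_one_left (abs_nonneg _) hy.le).trans (hA' _ hr)

/-- The increment of `cut ^ 2 / 2 * hopf` along the flow has vanishing integral. -/
lemma integral_increment (R t : ℝ) :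
    ∫ y, (G.cut hconj p R (G.Φ t y).1 ^ 2 / 2 * G.hopf (G.Φ t y) -
      G.cut hconj p R y.1 ^ 2 / 2 * G.hopf y) ∂M.liouDisc = 0 := by
  have hmp := G.measurePreserving_Φ_disc t
  have hi := G.integrable_cut_sq_hopf hconj p R
  have h1 := hmp.integrable_comp_of_integrable hi
  have h2 := hmp.integral_comp' (f := ((Homeomorph.mk (Equiv.mk (G.Φ t) (G.Φ (-t))
    (G.Φ_neg_Φ t) (G.Φ_Φ_neg t)) (G.continuous_Φ_state t)
      (G.continuous_Φ_state (-t))).toMeasurableEquiv))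
    (fun y => G.cut hconj p R y.1 ^ 2 / 2 * G.hopf y)
  exact (integral_sub h1 hi).trans (sub_eq_zero.2 h2)

lemma abs_cut_sq_sub_le (R : ℝ) {t : ℝ} (ht : 0 ≤ t) {y : V2 × V2} (hy : nsq y.2 < 1) :
    |G.cut hconj p R (G.Φ t y).1 ^ 2 / 2 - G.cut hconj p R y.1 ^ 2 / 2| ≤
      t * (G.cut hconj p R y.1 + t) := by
  have h1 := G.abs_cut_Φ_sub_le hconj p R t hy
  rw [abs_of_nonneg ht] at h1
  have h2 := G.cut_nonneg hconj p R y.1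
  have h3 := G.cut_nonneg hconj p R (G.Φ t y).1
  set a := G.cut hconj p R (G.Φ t y).1
  set b := G.cut hconj p R y.1
  have h4 : a ^ 2 / 2 - b ^ 2 / 2 = (a - b) * ((a + b) / 2) := by ring
  rw [h4, abs_mul, abs_of_nonneg (show 0 ≤ (a + b) / 2 by positivity)]
  refine mul_le_mul h1 ?_ (by positivity) ht
  linarith [(abs_le.1 h1).2]

/-- The part of the increment quotient that comes from the change of `hopf`. -/
def incr (R t : ℝ) (y : V2 × V2) : ℝ :=
  G.cut hconj p R (G.Φ t y).1 ^ 2 / 2 * ((G.hopf (G.Φ t y) - G.hopf y) / t)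

lemma measurable_cut_Φ (R t : ℝ) :
    Measurable fun y : V2 × V2 => G.cut hconj p R (G.Φ t y).1 :=
  ((G.continuous_cut hconj p R).comp (continuous_fst.comp (G.continuous_Φ_state t))).measurable

lemma measurable_incr (R t : ℝ) : Measurable (G.incr hconj p R t) :=
  (((G.measurable_cut_Φ hconj p R t).pow_const 2).div_const 2).mul
    ((((G.measurable_hopf hconj).comp (G.continuous_Φ_state t).measurable).sub
      (G.measurable_hopf hconj)).div_const t)

lemma cut_Φ_eq_zero {R t : ℝ} (ht : 0 ≤ t) (ht1 : t ≤ 1) {y : V2 × V2} (hy : nsq y.2 < 1)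
    (hr : R + 1 < G.rad hconj p y.1) : G.cut hconj p R (G.Φ t y).1 = 0 := by
  have h1 := (abs_le.1 (G.abs_rad_Φ_sub_le_of_disc hconj p t hy)).1
  rw [abs_of_nonneg ht] at h1
  exact G.cut_of_le hconj p (by linarith)

lemma exists_incr_bound {R : ℝ} (hR : 0 ≤ R) : ∃ C, 0 ≤ C ∧ ∀ t, 0 < t → t ≤ 1 →
    ∀ y : V2 × V2, nsq y.2 < 1 → |G.incr hconj p R t y| ≤
      indicator {y : V2 × V2 | y.1 ∈ {q | G.rad hconj p q ≤ R + 1}} (fun _ => C) y := by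
  obtain ⟨C, hC, hC'⟩ := G.exists_hopf_lipschitz hconj p (R + 1)
  refine ⟨R ^ 2 / 2 * C, by positivity, fun t ht ht1 y hy => ?_⟩
  by_cases hr : G.rad hconj p y.1 ≤ R + 1
  · rw [indicator_of_mem (by exact hr), incr, abs_mul, abs_of_nonneg (by positivity),
      abs_div, abs_of_pos ht]
    have h1 := G.cut_nonneg hconj p R (G.Φ t y).1
    have h2 := G.cut_le hconj p hR (G.Φ t y).1
    refine mul_le_mul (by gcongr) ?_ (by positivity) (by positivity)
    rw [div_le_iff₀ ht]
    exact hC' y hy hr t ht.le ht1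
  · rw [indicator_of_notMem (by exact hr), incr,
      G.cut_Φ_eq_zero hconj p ht.le ht1 hy (not_le.1 hr)]
    simp

lemma integrable_indicator_rad_le (R C : ℝ) : Integrable
    (indicator {y : V2 × V2 | y.1 ∈ {q | G.rad hconj p q ≤ R}} (fun _ => C)) M.liouDisc := by
  have hS : MeasurableSet {y : V2 × V2 | y.1 ∈ {q | G.rad hconj p q ≤ R}} :=
    measurable_fst (isClosed_le (G.continuous_rad hconj p) continuous_const).measurableSet
  refine (integrable_indicator_iff hS).2 (integrableOn_const ?_)
  rw [M.liouDisc_fst_preimage]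
  exact ENNReal.mul_ne_top (G.isCompact_rad_le hconj p R).measure_lt_top.ne ENNReal.ofReal_ne_top

lemma integrable_incr {R : ℝ} (hR : 0 ≤ R) {t : ℝ} (ht : 0 < t) (ht1 : t ≤ 1) :
    Integrable (G.incr hconj p R t) M.liouDisc := by
  obtain ⟨C, _, hC⟩ := G.exists_incr_bound hconj p hR
  refine (G.integrable_indicator_rad_le hconj p (R + 1) C).mono'
    (G.measurable_incr hconj p R t).aestronglyMeasurable ?_
  filter_upwards [M.ae_liouDisc] with y hy using hC t ht ht1 y hy

lemma tendsto_incr (R : ℝ) (y : V2 × V2) :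
    Tendsto (fun n : ℕ => G.incr hconj p R (1 / ((n : ℝ) + 1)) y) atTop
      (𝓝 (G.cut hconj p R y.1 ^ 2 / 2 * (-G.hopf y ^ 2 - nsq y.2 * M.K y.1))) := by
  have h0 : Tendsto (fun n : ℕ => 1 / ((n : ℝ) + 1)) atTop (𝓝 0) :=
    tendsto_one_div_add_atTop_nhds_zero_nat
  have h0' : Tendsto (fun n : ℕ => 1 / ((n : ℝ) + 1)) atTop (𝓝[≠] 0) :=
    tendsto_nhdsWithin_iff.2 ⟨h0, Eventually.of_forall fun n => by
      have : 0 < 1 / ((n : ℝ) + 1) := by positivity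
      exact this.ne'⟩
  refine Tendsto.mul ?_ ?_
  · have h1 : Continuous fun t => G.cut hconj p R (G.Φ t y).1 ^ 2 / 2 :=
      (((G.continuous_cut hconj p R).comp
        (continuous_fst.comp (G.continuous_Φ_time y))).pow 2).div_const 2
    have h2 := (h1.tendsto 0).comp h0
    simpa [G.Φ_zero, Function.comp_def] using h2
  · have h1 := (hasDerivAt_iff_tendsto_slope.1 (G.hasDerivAt_hopf hconj y 0)).comp h0'
    rw [G.Φ_zero] at h1
    refine h1.congr fun n => ?_
    simp [slope_def_field, G.Φ_zero]

/-- The integral of the increment is controlled by the variation of the cut-off function. -/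
lemma neg_le_integral_incr {R : ℝ} (hR : 0 ≤ R) : ∃ C, ∀ t, 0 < t → t ≤ 1 →
    -(∫ y, G.cut hconj p R y.1 * |G.hopf y| ∂M.liouDisc + t * C) ≤
      ∫ y, G.incr hconj p R t y ∂M.liouDisc := by
  obtain ⟨A, hA, hA'⟩ := G.exists_hopf_rad_bound hconj p (R + 1)
  set I := indicator {y : V2 × V2 | y.1 ∈ {q | G.rad hconj p q ≤ R + 1}} (fun _ => A)
  have hI : Integrable I M.liouDisc := G.integrable_indicator_rad_le hconj p (R + 1) A
  have hX := G.integrable_cut_hopf hconj p R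
  refine ⟨∫ y, I y ∂M.liouDisc, fun t ht ht1 => ?_⟩
  have h0 := G.integral_increment hconj p R t
  have hF := G.integrable_incr hconj p hR ht ht1
  have hi := G.integrable_cut_sq_hopf hconj p R
  have hi' := (G.measurePreserving_Φ_disc t).integrable_comp_of_integrable hi
  have hN : Integrable (fun y => (G.cut hconj p R (G.Φ t y).1 ^ 2 / 2 * G.hopf (G.Φ t y) -
      G.cut hconj p R y.1 ^ 2 / 2 * G.hopf y) / t) M.liouDisc := (hi'.sub hi).div_const t
  have hN0 : ∫ y, (G.cut hconj p R (G.Φ t y).1 ^ 2 / 2 * G.hopf (G.Φ t y) -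
      G.cut hconj p R y.1 ^ 2 / 2 * G.hopf y) / t ∂M.liouDisc = 0 := by
    rw [integral_div, h0, zero_div]
  have key : ∀ᵐ y ∂M.liouDisc, (G.cut hconj p R (G.Φ t y).1 ^ 2 / 2 * G.hopf (G.Φ t y) -
      G.cut hconj p R y.1 ^ 2 / 2 * G.hopf y) / t - G.incr hconj p R t y ≤
      G.cut hconj p R y.1 * |G.hopf y| + t * I y := by
    filter_upwards [M.ae_liouDisc] with y hy
    have e : (G.cut hconj p R (G.Φ t y).1 ^ 2 / 2 * G.hopf (G.Φ t y) -
        G.cut hconj p R y.1 ^ 2 / 2 * G.hopf y) / t - G.incr hconj p R t y =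
        (G.cut hconj p R (G.Φ t y).1 ^ 2 / 2 - G.cut hconj p R y.1 ^ 2 / 2) / t * G.hopf y := by
      rw [incr]
      field_simp
      ring
    rw [e]
    by_cases hr : G.rad hconj p y.1 ≤ R + 1
    · have h1 := G.abs_cut_sq_sub_le hconj p R ht.le hy
      have h2 := hA' y hy hr
      have h3 : I y = A := indicator_of_mem (by exact hr) _
      have h4 : |(G.cut hconj p R (G.Φ t y).1 ^ 2 / 2 - G.cut hconj p R y.1 ^ 2 / 2) / t| ≤
          G.cut hconj p R y.1 + t := by
        rw [abs_div, abs_of_pos ht, div_le_iff₀ ht]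
        linarith
      refine (le_abs_self _).trans ?_
      rw [abs_mul, h3]
      refine (mul_le_mul_of_nonneg_right h4 (abs_nonneg _)).trans ?_
      rw [add_mul]
      exact add_le_add le_rfl (mul_le_mul_of_nonneg_left h2 ht.le)
    · have h3 : I y = 0 := indicator_of_notMem (by exact hr) _
      rw [G.cut_Φ_eq_zero hconj p ht.le ht1 hy (not_le.1 hr),
        G.cut_of_le hconj p (R := R) (q := y.1) (by linarith [not_le.1 hr]), h3]
      simp
  have h5 := integral_mono_ae (hN.sub hF) (hX.add (hI.const_mul t)) key
  rw [integral_sub' hN hF, hN0] at h5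
  simp only [Pi.add_apply] at h5
  rw [integral_add hX (hI.const_mul t), integral_const_mul] at h5
  linarith

lemma neg_le_integral_riccati {R : ℝ} (hR : 0 ≤ R) :
    -∫ y, G.cut hconj p R y.1 * |G.hopf y| ∂M.liouDisc ≤
      ∫ y, G.cut hconj p R y.1 ^ 2 / 2 * (-G.hopf y ^ 2 - nsq y.2 * M.K y.1) ∂M.liouDisc := by
  obtain ⟨B, hB⟩ := G.neg_le_integral_incr hconj p hR
  obtain ⟨C, _, hC⟩ := G.exists_incr_bound hconj p hR
  have ht : ∀ n : ℕ, 0 < 1 / ((n : ℝ) + 1) := fun n => by positivity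
  have ht1 : ∀ n : ℕ, 1 / ((n : ℝ) + 1) ≤ 1 := fun n => by
    rw [div_le_one (by positivity)]
    linarith [(Nat.cast_nonneg n : (0 : ℝ) ≤ n)]
  have h1 := tendsto_integral_of_dominated_convergence (μ := M.liouDisc)
    (F := fun (n : ℕ) y => G.incr hconj p R (1 / ((n : ℝ) + 1)) y) _
    (fun n => (G.measurable_incr hconj p R _).aestronglyMeasurable)
    (G.integrable_indicator_rad_le hconj p (R + 1) C)
    (fun n => by
      filter_upwards [M.ae_liouDisc] with y hy using hC _ (ht n) (ht1 n) y hy)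
    (Eventually.of_forall fun y => G.tendsto_incr hconj p R y)
  have h2 : Tendsto (fun n : ℕ => -(∫ y, G.cut hconj p R y.1 * |G.hopf y| ∂M.liouDisc +
      1 / ((n : ℝ) + 1) * B)) atTop
      (𝓝 (-(∫ y, G.cut hconj p R y.1 * |G.hopf y| ∂M.liouDisc + 0 * B))) :=
    ((tendsto_one_div_add_atTop_nhds_zero_nat.mul_const B).const_add _).neg
  rw [zero_mul, add_zero] at h2
  exact le_of_tendsto_of_tendsto' h2 h1 fun n => hB _ (ht n) (ht1 n)

lemma integral_cut_sq_curvature {R : ℝ} (hR : 0 < R) :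
    ∫ y, G.cut hconj p R y.1 ^ 2 / 2 * (nsq y.2 * M.K y.1) ∂M.liouDisc =
      π / 2 * (π * R ^ 2 - (M.area {q | G.rad hconj p q < R}).toReal) := by
  have h1 : ∀ y : V2 × V2, G.cut hconj p R y.1 ^ 2 / 2 * (nsq y.2 * M.K y.1) =
      (fun q => G.cut hconj p R q ^ 2 / 2 * M.K q) y.1 * nsq y.2 := fun y => by ring
  simp only [h1]
  rw [M.liouDisc_eq, integral_prod_mul (fun q => G.cut hconj p R q ^ 2 / 2 * M.K q) nsq,
    integral_nsq_disc, mul_comm]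
  congr 1
  have hB := G.measurableSet_ball hconj p R
  have hlt := G.area_ball_lt_top hconj p R
  have h2 := G.integral_ball_curvature hconj p hR
  have h3 : ∫ q, G.cut hconj p R q ^ 2 / 2 * M.K q ∂M.area =
      ∫ q in {q | G.rad hconj p q < R}, (R - G.rad hconj p q) ^ 2 / 2 * M.K q ∂M.area := by
    rw [← integral_indicator hB]
    refine integral_congr_ae (Eventually.of_forall fun q => ?_)
    by_cases hq : G.rad hconj p q < R
    · rw [indicator_of_mem (by exact hq)]
      simp only [G.cut_of_lt hconj p hq]
    · rw [indicator_of_notMem (by exact hq)]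
      simp only [G.cut_of_le hconj p (not_lt.1 hq)]
      simp
  have hint : IntegrableOn (fun q => (R - G.rad hconj p q) ^ 2 / 2 * M.K q)
      {q | G.rad hconj p q < R} M.area := by
    refine (ContinuousOn.integrableOn_compact (G.isCompact_rad_le hconj p R) ?_).mono_set
      fun q (hq : G.rad hconj p q < R) => hq.le
    exact ((((continuous_const.sub (G.continuous_rad hconj p)).pow 2).div_const 2).mul
      M.continuous_K).continuousOn
  rw [integral_add hint (integrableOn_const hlt.ne)] at h2
  rw [h3, ← h2]
  simp [Measure.real]

/-- The fundamental inequality between area and the energy of the Hopf solution. -/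
lemma energy_sub_le {R : ℝ} (hR : 0 < R) :
    ∫ y, G.cut hconj p R y.1 ^ 2 / 2 * G.hopf y ^ 2 ∂M.liouDisc -
      ∫ y, G.cut hconj p R y.1 * |G.hopf y| ∂M.liouDisc ≤
      π / 2 * ((M.area {q | G.rad hconj p q < R}).toReal - π * R ^ 2) := by
  have h1 := G.neg_le_integral_riccati hconj p hR.le
  have h2 := G.integral_cut_sq_curvature hconj p hR
  have hE := G.integrable_cut_sq_hopf_sq hconj p R
  have hK := G.integrable_cut_sq_curvature hconj p R
  have h3 : ∫ y, G.cut hconj p R y.1 ^ 2 / 2 * (-G.hopf y ^ 2 - nsq y.2 * M.K y.1) ∂M.liouDisc =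
      -∫ y, G.cut hconj p R y.1 ^ 2 / 2 * G.hopf y ^ 2 ∂M.liouDisc -
        ∫ y, G.cut hconj p R y.1 ^ 2 / 2 * (nsq y.2 * M.K y.1) ∂M.liouDisc := by
    rw [← integral_neg]
    refine Eq.trans ?_ (integral_sub hE.neg hK)
    congr 1
    ext y
    ring
  rw [h3, h2] at h1
  linarith

end GeoFlow

namespace GeoFlow

variable {M : RMetric} (G : GeoFlow M)

variable (hconj : M.NoConjugatePoints) (p : V2)

/-- The part of the unit disc bundle over the ball of radius `R`. -/
def ballBundle (R : ℝ) : Set (V2 × V2) := {y | y.1 ∈ {q | G.rad hconj p q < R}}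

lemma measurableSet_ballBundle (R : ℝ) : MeasurableSet (G.ballBundle hconj p R) :=
  measurable_fst (G.measurableSet_ball hconj p R)

lemma liouDisc_ballBundle (R : ℝ) : M.liouDisc (G.ballBundle hconj p R) =
    M.area {q | G.rad hconj p q < R} * ENNReal.ofReal π := M.liouDisc_fst_preimage

lemma liouDisc_ballBundle_ne_top (R : ℝ) : M.liouDisc (G.ballBundle hconj p R) ≠ ⊤ := by
  rw [liouDisc_ballBundle]
  exact ENNReal.mul_ne_top (G.area_ball_lt_top hconj p R).ne ENNReal.ofReal_ne_top

lemma integrable_indicator_ballBundle (R C : ℝ) :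
    Integrable (indicator (G.ballBundle hconj p R) fun _ => C) M.liouDisc :=
  (integrable_indicator_iff (G.measurableSet_ballBundle hconj p R)).2
    (integrableOn_const (G.liouDisc_ballBundle_ne_top hconj p R))

lemma integral_indicator_ballBundle (R C : ℝ) :
    ∫ y, indicator (G.ballBundle hconj p R) (fun _ => C) y ∂M.liouDisc =
      (M.area {q | G.rad hconj p q < R}).toReal * π * C := by
  rw [integral_indicator (G.measurableSet_ballBundle hconj p R), setIntegral_const, Measure.real,
    liouDisc_ballBundle, ENNReal.toReal_mul, ENNReal.toReal_ofReal Real.pi_pos.le, smul_eq_mul]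

lemma integrableOn_hopf_sq (R : ℝ) :
    IntegrableOn (fun y => G.hopf y ^ 2) (G.ballBundle hconj p R) M.liouDisc := by
  obtain ⟨A, hA, hA'⟩ := G.exists_hopf_rad_bound hconj p R
  have hS := G.measurableSet_ballBundle hconj p R
  refine (integrable_indicator_iff hS).1 ?_
  refine G.integrable_of_rad_support hconj p (((G.measurable_hopf hconj).pow_const 2).indicator hS)
    R (A ^ 2) ?_ ?_
  · intro y hy hr
    have h : |G.hopf y ^ 2| ≤ A ^ 2 := by
      rw [abs_of_nonneg (sq_nonneg _)]
      exact sq_le_sq.2 ((hA' y hy hr).trans (le_abs_self A))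
    by_cases hm : y ∈ G.ballBundle hconj p R
    · rwa [indicator_of_mem hm]
    · rw [indicator_of_notMem hm, abs_zero]
      positivity
  · intro y hy hr
    exact indicator_of_notMem
      (s := G.ballBundle hconj p R) (fun h : G.rad hconj p y.1 < R => absurd h hr.le.not_gt) _

lemma integrableOn_hopf (R : ℝ) :
    IntegrableOn (fun y => |G.hopf y|) (G.ballBundle hconj p R) M.liouDisc := by
  have h1 : IntegrableOn (fun _ => (1 : ℝ)) (G.ballBundle hconj p R) M.liouDisc :=
    integrableOn_const (G.liouDisc_ballBundle_ne_top hconj p R)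
  refine Integrable.mono' (h1.add (G.integrableOn_hopf_sq hconj p R))
    (G.measurable_hopf hconj).norm.aestronglyMeasurable (Eventually.of_forall fun y => ?_)
  simp only [Real.norm_eq_abs, abs_abs, Pi.add_apply]
  rw [← sq_abs]
  nlinarith [sq_nonneg (|G.hopf y| - 1), abs_nonneg (G.hopf y)]

/-- The energy of the Hopf solution on a ball. -/
def energy (R : ℝ) : ℝ := ∫ y in G.ballBundle hconj p R, G.hopf y ^ 2 ∂M.liouDisc

lemma energy_nonneg (R : ℝ) : 0 ≤ G.energy hconj p R :=
  setIntegral_nonneg (G.measurableSet_ballBundle hconj p R) fun _ _ => sq_nonneg _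

lemma energy_le {r R : ℝ} (hr : 0 < r) (hR : 2 * r ≤ R) : R ^ 2 / 8 * G.energy hconj p r ≤
    ∫ y, G.cut hconj p R y.1 ^ 2 / 2 * G.hopf y ^ 2 ∂M.liouDisc := by
  have hS := G.measurableSet_ballBundle hconj p r
  rw [energy, ← integral_const_mul, ← integral_indicator hS]
  refine integral_mono ((integrable_indicator_iff hS).2
    ((G.integrableOn_hopf_sq hconj p r).const_mul _)) (G.integrable_cut_sq_hopf_sq hconj p R) ?_
  intro y
  by_cases hy : y ∈ G.ballBundle hconj p r
  swap
  · rw [indicator_of_notMem hy]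
    positivity
  rw [indicator_of_mem hy]
  have h : G.rad hconj p y.1 < r := hy
  beta_reduce
  rw [G.cut_of_lt hconj p (by linarith)]
  refine mul_le_mul_of_nonneg_right ?_ (sq_nonneg _)
  have h1 : (R / 2) ^ 2 ≤ (R - G.rad hconj p y.1) ^ 2 :=
    pow_le_pow_left₀ (by linarith) (by linarith) 2
  linarith

lemma cut_mul_le (R : ℝ) {δ : ℝ} (hδ : 0 < δ) (y : V2 × V2) :
    G.cut hconj p R y.1 * |G.hopf y| ≤
      indicator (G.ballBundle hconj p R) (fun _ => δ / 2) y +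
        1 / δ * (G.cut hconj p R y.1 ^ 2 / 2 * G.hopf y ^ 2) := by
  by_cases h : G.rad hconj p y.1 < R
  · rw [indicator_of_mem (by exact h), ← sub_nonneg]
    have e : δ / 2 + 1 / δ * (G.cut hconj p R y.1 ^ 2 / 2 * G.hopf y ^ 2) -
        G.cut hconj p R y.1 * |G.hopf y| =
        (δ - G.cut hconj p R y.1 * |G.hopf y|) ^ 2 / (2 * δ) := by
      rw [← sq_abs (G.hopf y)]
      field_simp
      ring
    rw [e]
    positivity
  · rw [indicator_of_notMem (by exact h), G.cut_of_le hconj p (not_lt.1 h)]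
    simp

/-- Area is bounded below by the energy. -/
lemma energy_le_area {r R : ℝ} (hr : 0 < r) (hR : 2 * r ≤ R) :
    R ^ 2 * G.energy hconj p r ≤ 24 * π * (M.area {q | G.rad hconj p q < R}).toReal := by
  have hR0 : 0 < R := by linarith
  have h1 := G.energy_sub_le hconj p hR0
  have h2 := G.energy_le hconj p hr hR
  have hE := G.integrable_cut_sq_hopf_sq hconj p R
  have h3 := integral_mono (G.integrable_cut_hopf hconj p R)
    ((G.integrable_indicator_ballBundle hconj p R (2 / 2)).add (hE.const_mul (1 / 2)))
    (fun y => G.cut_mul_le hconj p R two_pos y)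
  rw [integral_add' (G.integrable_indicator_ballBundle hconj p R (2 / 2)) (hE.const_mul (1 / 2)),
    integral_indicator_ballBundle, integral_const_mul] at h3
  have h4 : 0 ≤ π * (π * R ^ 2) := by positivity
  linarith

/-- The lower area bound when the energy outside of a ball is small. -/
lemma area_lower_bound (hi : Integrable (fun y => G.hopf y ^ 2) M.liouDisc) {δ r₀ : ℝ}
    (hδ : 0 < δ)
    (hε : ∫ y in (G.ballBundle hconj p r₀)ᶜ, G.hopf y ^ 2 ∂M.liouDisc ≤ δ ^ 2) {r R : ℝ}
    (hr : 0 < r) (hR : 2 * r ≤ R) :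
    R ^ 2 / 8 * G.energy hconj p r -
      R * (∫ y in G.ballBundle hconj p r₀, |G.hopf y| ∂M.liouDisc) -
      δ / 2 * (π * (M.area {q | G.rad hconj p q < R}).toReal + R ^ 2) ≤
      π / 2 * ((M.area {q | G.rad hconj p q < R}).toReal - π * R ^ 2) := by
  have hR0 : 0 < R := by linarith
  have h1 := G.energy_sub_le hconj p hR0
  have h2 := G.energy_le hconj p hr hR
  have hS := G.measurableSet_ballBundle hconj p r₀
  have hX := G.integrable_cut_hopf hconj p R
  have hU := G.integrableOn_hopf hconj p r₀
  have hE := G.integrable_cut_sq_hopf_sq hconj p R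
  have hI := G.integrable_indicator_ballBundle hconj p R (δ / 2)
  have h3 : ∫ y in G.ballBundle hconj p r₀, G.cut hconj p R y.1 * |G.hopf y| ∂M.liouDisc ≤
      R * ∫ y in G.ballBundle hconj p r₀, |G.hopf y| ∂M.liouDisc := by
    rw [← integral_const_mul]
    exact integral_mono hX.integrableOn (hU.const_mul R)
      fun y => mul_le_mul_of_nonneg_right (G.cut_le hconj p hR0.le _) (abs_nonneg _)
  have h4 : ∫ y in (G.ballBundle hconj p r₀)ᶜ, G.cut hconj p R y.1 * |G.hopf y| ∂M.liouDisc ≤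
      ∫ y in (G.ballBundle hconj p r₀)ᶜ, (indicator (G.ballBundle hconj p R) (fun _ => δ / 2) y +
        1 / δ * (R ^ 2 / 2 * G.hopf y ^ 2)) ∂M.liouDisc := by
    refine integral_mono hX.integrableOn
      (hI.integrableOn.add ((hi.integrableOn.const_mul (R ^ 2 / 2)).const_mul (1 / δ))) fun y => ?_
    refine (G.cut_mul_le hconj p R hδ y).trans ?_
    have := G.cut_nonneg hconj p R y.1
    have := G.cut_le hconj p hR0.le y.1
    gcongr
  rw [integral_add hI.integrableOn ((hi.integrableOn.const_mul (R ^ 2 / 2)).const_mul (1 / δ)),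
    integral_const_mul, integral_const_mul] at h4
  have h5 : ∫ y in (G.ballBundle hconj p r₀)ᶜ,
      indicator (G.ballBundle hconj p R) (fun _ => δ / 2) y ∂M.liouDisc ≤
      (M.area {q | G.rad hconj p q < R}).toReal * π * (δ / 2) := by
    rw [← integral_indicator_ballBundle]
    exact setIntegral_le_integral hI
      (Eventually.of_forall fun y => indicator_nonneg (fun _ _ => by positivity) y)
  have h6 := integral_add_compl hS hX
  have h7 : 1 / δ * (R ^ 2 / 2 * ∫ y in (G.ballBundle hconj p r₀)ᶜ, G.hopf y ^ 2 ∂M.liouDisc) ≤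
      1 / δ * (R ^ 2 / 2 * δ ^ 2) := by gcongr
  have h8 : 1 / δ * (R ^ 2 / 2 * δ ^ 2) = δ / 2 * R ^ 2 := by field_simp
  linarith

lemma aecover_ballBundle :
    AECover M.liouDisc atTop fun n : ℕ => G.ballBundle hconj p (n : ℝ) where
  ae_eventually_mem := Eventually.of_forall fun y => by
    obtain ⟨N, hN⟩ := exists_nat_gt (G.rad hconj p y.1)
    filter_upwards [eventually_ge_atTop N] with n hn
    exact hN.trans_le (by exact_mod_cast hn)
  measurableSet n := G.measurableSet_ballBundle hconj p n

lemma eventually_le_area {r b : ℝ} (hr : 0 < r) (hb : b < 1 + G.energy hconj p r / (4 * π ^ 2)) :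
    ∀ᶠ R in atTop, b * (π * R ^ 2) ≤ (M.area {q | G.rad hconj p q < R}).toReal := by
  by_cases hi : Integrable (fun y => G.hopf y ^ 2) M.liouDisc
  · set L := 1 + G.energy hconj p r / (4 * π ^ 2) with hL
    obtain ⟨δ, hδ, hδ'⟩ : ∃ δ, 0 < δ ∧ δ + b * δ < L - b := by
      by_cases h : 0 < 1 + b
      · refine ⟨(L - b) / (2 * (1 + b)), div_pos (by linarith) (by linarith), ?_⟩
        have : (L - b) / (2 * (1 + b)) * (1 + b) = (L - b) / 2 := by field_simp
        nlinarith
      · exact ⟨1, one_pos, by linarith⟩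
    have ht := (G.aecover_ballBundle hconj p).integral_tendsto_of_countably_generated hi
    obtain ⟨n, hn⟩ := (ht.eventually (lt_mem_nhds (show ∫ y, G.hopf y ^ 2 ∂M.liouDisc - δ ^ 2 <
      ∫ y, G.hopf y ^ 2 ∂M.liouDisc by linarith [pow_pos hδ 2]))).exists
    have hsum := integral_add_compl (G.measurableSet_ballBundle hconj p n) hi
    set C := ∫ y in G.ballBundle hconj p (n : ℝ), |G.hopf y| ∂M.liouDisc
    filter_upwards [eventually_ge_atTop (2 * r), eventually_gt_atTop (0 : ℝ),
      eventually_ge_atTop (2 * C / (L - b - (δ + b * δ)))] with R hR hR0 hRC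
    have h := G.area_lower_bound hconj p hi hδ (r₀ := n) (by linarith) hr hR
    have e1 : G.energy hconj p r = 4 * π ^ 2 * (L - 1) := by
      rw [hL]
      field_simp
      ring
    rw [e1] at h
    rw [div_le_iff₀ (by linarith)] at hRC
    set A := (M.area {q | G.rad hconj p q < R}).toReal
    have h1 := mul_le_mul_of_nonneg_left hRC hR0.le
    have h2 : 0 ≤ L - b - b * δ := by linarith
    have h3 : 1 ≤ π ^ 2 := one_le_pow₀ (by linarith [Real.pi_gt_three])
    have h4 := mul_le_mul_of_nonneg_right h3 (mul_nonneg (sq_nonneg R) h2)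
    have h5 : π / 2 * (1 + δ) * (b * (π * R ^ 2)) ≤ π / 2 * (1 + δ) * A := by linarith
    exact le_of_mul_le_mul_left h5 (by positivity)
  · obtain ⟨n, hn0, hn⟩ : ∃ n : ℕ, 0 < n ∧ 24 * π ^ 2 * b ≤ G.energy hconj p (n : ℝ) := by
      by_contra! hcon
      refine hi ((G.aecover_ballBundle hconj p).integrable_of_integral_bounded_of_nonneg_ae
        (24 * π ^ 2 * b) (fun n => G.integrableOn_hopf_sq hconj p n)
        (Eventually.of_forall fun y => sq_nonneg _) ?_)
      filter_upwards [eventually_gt_atTop 0] with n hn using (hcon n hn).le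
    filter_upwards [eventually_ge_atTop (2 * (n : ℝ))] with R hR
    have h := G.energy_le_area hconj p (by exact_mod_cast hn0) hR
    have h1 := mul_le_mul_of_nonneg_left hn (sq_nonneg R)
    have h2 : 24 * π * (b * (π * R ^ 2)) ≤
        24 * π * (M.area {q | G.rad hconj p q < R}).toReal := by linarith
    exact le_of_mul_le_mul_left h2 (by positivity)

lemma ofReal_le_liminf {r : ℝ} (hr : 0 < r) :
    ENNReal.ofReal (1 + G.energy hconj p r / (4 * π ^ 2)) ≤
      liminf (fun R : ℝ => M.area (M.ball p R) / ENNReal.ofReal (π * R ^ 2)) atTop := by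
  refine le_of_forall_lt fun c hc => ?_
  have hc' : c ≠ ⊤ := (hc.trans ENNReal.ofReal_lt_top).ne
  obtain ⟨d, hd1, hd2⟩ := exists_between hc
  have hd' : d ≠ ⊤ := (hd2.trans ENNReal.ofReal_lt_top).ne
  refine hd1.trans_le (le_liminf_of_le (by isBoundedDefault) ?_)
  have hd : d.toReal < 1 + G.energy hconj p r / (4 * π ^ 2) :=
    (ENNReal.lt_ofReal_iff_toReal_lt hd').1 hd2
  filter_upwards [G.eventually_le_area hconj p hr hd, eventually_gt_atTop (0 : ℝ)] with R hR hR0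
  have hpos : 0 < π * R ^ 2 := by positivity
  rw [ENNReal.le_div_iff_mul_le (Or.inl (ENNReal.ofReal_pos.2 hpos).ne')
    (Or.inl ENNReal.ofReal_ne_top), G.ball_eq hconj, ← ENNReal.ofReal_toReal hd',
    ← ENNReal.ofReal_mul ENNReal.toReal_nonneg,
    ← ENNReal.ofReal_toReal (G.area_ball_lt_top hconj p R).ne]
  exact ENNReal.ofReal_le_ofReal hR

lemma hopf_ae_eq_zero (h : ∀ r, 0 < r → G.energy hconj p r = 0) :
    ∀ᵐ y ∂M.liouDisc, G.hopf y = 0 := by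
  have h1 : ∀ n : ℕ, ∀ᵐ y ∂M.liouDisc, y ∈ G.ballBundle hconj p ((n : ℝ) + 1) →
      G.hopf y = 0 := fun n => by
    rw [← ae_restrict_iff' (G.measurableSet_ballBundle hconj p _)]
    have h2 := (integral_eq_zero_iff_of_nonneg (fun y => sq_nonneg _)
      (G.integrableOn_hopf_sq hconj p ((n : ℝ) + 1))).1 (h ((n : ℝ) + 1) (by positivity))
    filter_upwards [h2] with y hy using pow_eq_zero_iff two_ne_zero |>.1 hy
  filter_upwards [ae_all_iff.2 h1] with y hy
  obtain ⟨n, hn⟩ := exists_nat_gt (G.rad hconj p y.1)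
  exact hy n (show G.rad hconj p y.1 < n + 1 by linarith)

include hconj in
lemma flat_of_hopf_ae_eq_zero (h : ∀ᵐ y ∂M.liouDisc, G.hopf y = 0) : M.Flat := by
  have h1 : ∀ᵐ y ∂M.liouDisc, ∀ t : ℚ, G.hopf (G.Φ t y) = 0 :=
    ae_all_iff.2 fun t => (G.measurePreserving_Φ_disc t).quasiMeasurePreserving.ae h
  have h2 : ∀ᵐ y ∂M.liouDisc, nsq y.2 * M.K y.1 = 0 := by
    filter_upwards [h1] with y hy
    have h3 : (fun t => G.hopf (G.Φ t y)) = fun _ => 0 :=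
      (G.continuous_hopf_Φ hconj y).ext_on Rat.denseRange_cast continuous_const (by
        rintro _ ⟨t, rfl⟩
        exact hy t)
    have h4 := G.hasDerivAt_hopf hconj y 0
    rw [h3, congrFun h3 0, G.Φ_zero] at h4
    have h5 := h4.unique (hasDerivAt_const 0 0)
    linarith
  rw [M.liouDisc_eq] at h2
  have h3 : ∀ᵐ q ∂M.area, M.K q = 0 := by
    filter_upwards [Measure.ae_ae_of_ae_prod h2] with q hq
    by_contra hK
    have h4 : ∫ v in {v : V2 | nsq v < 1}, nsq v = 0 := by
      refine integral_eq_zero_of_ae ?_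
      filter_upwards [hq] with v hv using (mul_eq_zero.1 hv).resolve_right hK
    rw [integral_nsq_disc] at h4
    linarith [Real.pi_pos]
  have h4 : (volume : Measure V2) ≪ M.area :=
    withDensity_absolutelyContinuous' M.contDiff_rho.continuous.measurable.ennreal_ofReal.aemeasurable
      (Eventually.of_forall fun q => (ENNReal.ofReal_pos.2 (M.rho_pos q)).ne')
  have h5 : M.K =ᵐ[volume] fun _ => 0 := h4.ae_le h3
  exact congrFun ((M.continuous_K.ae_eq_iff_eq volume continuous_const).1 h5)

end GeoFlow

end

/-- **Theorem 1 (plane).** For a complete Riemannian metric without conjugate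
points on ℝ², for every point `p` the area `A_p(r)` of the metric ball of radius
`r` satisfies `liminf_{r→∞} A_p(r)/(π r²) ≥ 1`, with equality iff `g` is flat. -/
theorem plane_area_growth_rigidity (M : RMetric)
    (hcomp : M.Complete) (hconj : M.NoConjugatePoints) (p : V2) :
    1 ≤ Filter.liminf
        (fun r : ℝ => M.area (M.ball p r) / ENNReal.ofReal (π * r ^ 2)) atTop ∧
      (Filter.liminf
          (fun r : ℝ => M.area (M.ball p r) / ENNReal.ofReal (π * r ^ 2)) atTop = 1
        ↔ M.Flat) := by
  obtain ⟨G⟩ := M.exists_geoFlow hcomp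
  refine ⟨le_trans ?_ (G.ofReal_le_liminf hconj p one_pos), fun h => ?_, fun h => ?_⟩
  · rw [← ENNReal.ofReal_one]
    have := G.energy_nonneg hconj p 1
    exact ENNReal.ofReal_le_ofReal (le_add_of_nonneg_right (by positivity))
  · refine G.flat_of_hopf_ae_eq_zero hconj (G.hopf_ae_eq_zero hconj p fun r hr => ?_)
    have h1 := G.ofReal_le_liminf hconj p hr
    rw [h, ← ENNReal.ofReal_one, ENNReal.ofReal_le_ofReal_iff zero_le_one] at h1
    have h2 := G.energy_nonneg hconj p r
    have h3 : G.energy hconj p r / (4 * π ^ 2) ≤ 0 := by linarith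
    rw [div_le_iff₀ (by positivity), zero_mul] at h3
    exact le_antisymm h3 h2
  · refine Tendsto.liminf_eq (tendsto_const_nhds.congr' ?_)
    filter_upwards [eventually_gt_atTop (0 : ℝ)] with R hR
    have hpos : 0 < π * R ^ 2 := by positivity
    rw [G.ball_eq hconj, ← ENNReal.ofReal_toReal (G.area_ball_lt_top hconj p R).ne,
      G.toReal_area_ball_flat hconj h p hR,
      ENNReal.div_self (ENNReal.ofReal_pos.2 hpos).ne' ENNReal.ofReal_ne_top]
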